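/- Inductive confinement of the iteration: The constants A, B, N₀ > 0 can be chosen, depending only on the data at the interaction point, such that for ε sufficiently small every iterate (α¹₊,ₙ, β²₊,ₙ, xₙ), n = 0, 1, 2, …, of the shock interaction iteration scheme belongs to B_A × B_B × B_{N₀}. -/

import Mathlib

noncomputable section

open Set Filter

namespace ShockInteraction

/-- Partial derivative with respect to the first coordinate. -/
def pu (f : ℝ × ℝ → ℝ) (q : ℝ × ℝ) : ℝ := deriv (fun s => f (s, q.2)) q.1

/-- Partial derivative with respect to the second coordinate. -/
def pv (f : ℝ × ℝ → ℝ) (q : ℝ × ℝ) : ℝ := deriv (fun s => f (q.1, s)) q.2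

/-- The characteristic triangle `T_ε = {(u,v) : 0 ≤ u ≤ v ≤ u/a ≤ ε}`. -/
def Teps (a ε : ℝ) : Set (ℝ × ℝ) :=
  {q | 0 ≤ q.1 ∧ q.1 ≤ q.2 ∧ q.2 ≤ q.1 / a ∧ q.1 / a ≤ ε}

/-- The data of the shock interaction problem:  a barotropic pressure law `p` with sound
speed `η = √(dp/dρ)`, a primitive `σ` of `η(ρ)/ρ` with inverse `R` (so that the density and
velocity are smooth functions `ρ(α,β) = R((α+β)/2)`, `w(α,β) = (α−β)/2` of the Riemann
invariants), two smooth solutions `(ρ*ⁱ, wⁱ*)` of the Euler equations on the future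
developments `Dⁱ` of the data for `x ≤ 0` and `x ≥ 0` (coordinates `(t,x)`), and a solution
`(ρ₀, w₀ = 0, V¹₀, V²₀)` of the Rankine–Hugoniot conditions at the interaction point
`(0,0)` satisfying the determinism conditions and `V¹₀ < 0 < V²₀`. -/
structure Setup where
  p : ℝ → ℝ
  η : ℝ → ℝ
  σ : ℝ → ℝ
  R : ℝ → ℝ
  ρst₁ : ℝ × ℝ → ℝ
  wst₁ : ℝ × ℝ → ℝ
  ρst₂ : ℝ × ℝ → ℝ
  wst₂ : ℝ × ℝ → ℝ
  D₁ : Set (ℝ × ℝ)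
  D₂ : Set (ℝ × ℝ)
  ρ₀ : ℝ
  V₁₀ : ℝ
  V₂₀ : ℝ
  hp : ContDiffOn ℝ (⊤ : ℕ∞) p (Ioi 0)
  hp' : ∀ r > (0 : ℝ), 0 < deriv p r
  hη : ∀ r > (0 : ℝ), η r = Real.sqrt (deriv p r)
  hσ : ∀ r > (0 : ℝ), HasDerivAt σ (η r / r) r
  hR : ContDiff ℝ (⊤ : ℕ∞) R
  hRpos : ∀ s, 0 < R s
  hRσ : ∀ s, σ (R s) = s
  hρ₀ : 0 < ρ₀
  hD₁ : IsOpen D₁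
  hD₂ : IsOpen D₂
  hD₁0 : (0, 0) ∈ closure D₁
  hD₂0 : (0, 0) ∈ closure D₂
  hρst₁ : ContDiff ℝ (⊤ : ℕ∞) ρst₁
  hwst₁ : ContDiff ℝ (⊤ : ℕ∞) wst₁
  hρst₂ : ContDiff ℝ (⊤ : ℕ∞) ρst₂
  hwst₂ : ContDiff ℝ (⊤ : ℕ∞) wst₂
  hρst₁pos : ∀ q ∈ closure D₁, 0 < ρst₁ q
  hρst₂pos : ∀ q ∈ closure D₂, 0 < ρst₂ q
  heuler₁ : ∀ q ∈ D₁,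
    pu ρst₁ q + pv (fun q' => ρst₁ q' * wst₁ q') q = 0 ∧
    pu wst₁ q + wst₁ q * pv wst₁ q = -(1 / ρst₁ q) * pv (fun q' => p (ρst₁ q')) q
  heuler₂ : ∀ q ∈ D₂,
    pu ρst₂ q + pv (fun q' => ρst₂ q' * wst₂ q') q = 0 ∧
    pu wst₂ q + wst₂ q * pv wst₂ q = -(1 / ρst₂ q) * pv (fun q' => p (ρst₂ q')) q
  hjump₁V : (ρ₀ - ρst₁ (0, 0)) * V₁₀ = -(ρst₁ (0, 0) * wst₁ (0, 0))
  hjump₁M : (-(ρst₁ (0, 0) * wst₁ (0, 0))) * V₁₀ =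
    p ρ₀ - (ρst₁ (0, 0) * wst₁ (0, 0) ^ 2 + p (ρst₁ (0, 0)))
  hjump₂V : (ρ₀ - ρst₂ (0, 0)) * V₂₀ = -(ρst₂ (0, 0) * wst₂ (0, 0))
  hjump₂M : (-(ρst₂ (0, 0) * wst₂ (0, 0))) * V₂₀ =
    p ρ₀ - (ρst₂ (0, 0) * wst₂ (0, 0) ^ 2 + p (ρst₂ (0, 0)))
  hdet₁l : -η ρ₀ < V₁₀
  hdet₁r : V₁₀ < wst₁ (0, 0) - η (ρst₁ (0, 0))
  hdet₂l : wst₂ (0, 0) + η (ρst₂ (0, 0)) < V₂₀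
  hdet₂r : V₂₀ < η ρ₀
  hV₁₀neg : V₁₀ < 0
  hV₂₀pos : 0 < V₂₀

/-- The sound speed `η₀` of the state behind at the interaction point. -/
def η₀ (S : Setup) : ℝ := S.η S.ρ₀

/-- The constant `a = ((η₀+V¹₀)/(η₀−V¹₀))·((η₀−V²₀)/(η₀+V²₀)) ∈ (0,1)` determining the right
shock curve `u = av` in characteristic coordinates. -/
def aconst (S : Setup) : ℝ :=
  ((η₀ S + S.V₁₀) / (η₀ S - S.V₁₀)) * ((η₀ S - S.V₂₀) / (η₀ S + S.V₂₀))

/-- The constant `Γ₀ = −(η₀+V¹₀)/(η₀−V¹₀)`. -/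
def Γ₀ (S : Setup) : ℝ := -(η₀ S + S.V₁₀) / (η₀ S - S.V₁₀)

/-- The common value `β₀ = σ(ρ₀)` of the Riemann invariants of the state behind at the
interaction point (where `w₀ = 0`). -/
def β₀ (S : Setup) : ℝ := S.σ S.ρ₀

/-- Density as a function of the Riemann invariants. -/
def ρf (S : Setup) (α β : ℝ) : ℝ := S.R ((α + β) / 2)

/-- Velocity as a function of the Riemann invariants. -/
def wf (α β : ℝ) : ℝ := (α - β) / 2

/-- Incoming characteristic speed `c_in = w − η(ρ)` as a function of the Riemann invariants. -/
def cin (S : Setup) (α β : ℝ) : ℝ := wf α β - S.η (ρf S α β)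

/-- Outgoing characteristic speed `c_out = w + η(ρ)` as a function of the Riemann invariants. -/
def cout (S : Setup) (α β : ℝ) : ℝ := wf α β + S.η (ρf S α β)

/-- The jump function `J = [ρw]² − [ρw² + p(ρ)]·[ρ]` in terms of the Riemann invariants. -/
def Jf (S : Setup) (ap bp am bm : ℝ) : ℝ :=
  (ρf S ap bp * wf ap bp - ρf S am bm * wf am bm) ^ 2 -
    (ρf S ap bp * wf ap bp ^ 2 + S.p (ρf S ap bp)
      - ρf S am bm * wf am bm ^ 2 - S.p (ρf S am bm)) * (ρf S ap bp - ρf S am bm)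

/-- The Riemann invariant `α¹*` of the state ahead of the left moving shock. -/
def αst₁ (S : Setup) : ℝ × ℝ → ℝ := fun q => S.σ (S.ρst₁ q) + S.wst₁ q

/-- The Riemann invariant `β¹*` of the state ahead of the left moving shock. -/
def βst₁ (S : Setup) : ℝ × ℝ → ℝ := fun q => S.σ (S.ρst₁ q) - S.wst₁ q

/-- The Riemann invariant `α²*` of the state ahead of the right moving shock. -/
def αst₂ (S : Setup) : ℝ × ℝ → ℝ := fun q => S.σ (S.ρst₂ q) + S.wst₂ q

/-- The Riemann invariant `β²*` of the state ahead of the right moving shock. -/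
def βst₂ (S : Setup) : ℝ × ℝ → ℝ := fun q => S.σ (S.ρst₂ q) - S.wst₂ q

/-- Partial derivative of `J` with respect to `α₊`. -/
def Jαp (S : Setup) (ap bp am bm : ℝ) : ℝ := deriv (fun s => Jf S s bp am bm) ap

/-- Partial derivative of `J` with respect to `β₊`. -/
def Jβp (S : Setup) (ap bp am bm : ℝ) : ℝ := deriv (fun s => Jf S ap s am bm) bp

/-- Partial derivative of `J` with respect to `α₋`. -/
def Jαm (S : Setup) (ap bp am bm : ℝ) : ℝ := deriv (fun s => Jf S ap bp s bm) am

/-- Partial derivative of `J` with respect to `β₋`. -/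
def Jβm (S : Setup) (ap bp am bm : ℝ) : ℝ := deriv (fun s => Jf S ap bp am s) bm

/-- `F¹₀ = −((V¹₀+η₀)/(η₀−V¹₀))²`. -/
def F₁₀ (S : Setup) : ℝ := -((S.V₁₀ + η₀ S) / (η₀ S - S.V₁₀)) ^ 2

/-- `F²₀ = −((η₀−V²₀)/(V²₀+η₀))²`. -/
def F₂₀ (S : Setup) : ℝ := -((η₀ S - S.V₂₀) / (S.V₂₀ + η₀ S)) ^ 2

/-- The Riemann invariants of the states ahead at the interaction point. -/
def αm₁₀ (S : Setup) : ℝ := αst₁ S (0, 0)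

def βm₁₀ (S : Setup) : ℝ := βst₁ S (0, 0)

def αm₂₀ (S : Setup) : ℝ := αst₂ S (0, 0)

def βm₂₀ (S : Setup) : ℝ := βst₂ S (0, 0)

/-- `M¹₁₀ = −(∂J/∂α₋)/(∂J/∂α₊)` at the interaction point, left shock. -/
def M₁₁₀ (S : Setup) : ℝ :=
  -(Jαm S (β₀ S) (β₀ S) (αm₁₀ S) (βm₁₀ S)) / Jαp S (β₀ S) (β₀ S) (αm₁₀ S) (βm₁₀ S)

/-- `M¹₂₀ = −(∂J/∂β₋)/(∂J/∂α₊)` at the interaction point, left shock. -/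
def M₁₂₀ (S : Setup) : ℝ :=
  -(Jβm S (β₀ S) (β₀ S) (αm₁₀ S) (βm₁₀ S)) / Jαp S (β₀ S) (β₀ S) (αm₁₀ S) (βm₁₀ S)

/-- `M²₁₀ = −(∂J/∂α₋)/(∂J/∂β₊)` at the interaction point, right shock. -/
def M₂₁₀ (S : Setup) : ℝ :=
  -(Jαm S (β₀ S) (β₀ S) (αm₂₀ S) (βm₂₀ S)) / Jβp S (β₀ S) (β₀ S) (αm₂₀ S) (βm₂₀ S)

/-- `M²₂₀ = −(∂J/∂β₋)/(∂J/∂β₊)` at the interaction point, right shock. -/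
def M₂₂₀ (S : Setup) : ℝ :=
  -(Jβm S (β₀ S) (β₀ S) (αm₂₀ S) (βm₂₀ S)) / Jβp S (β₀ S) (β₀ S) (αm₂₀ S) (βm₂₀ S)

/-- `dα¹₋/du(0)`, expressed through the first derivatives of `α¹*` at the origin. -/
def dαm₁ (S : Setup) : ℝ :=
  pu (αst₁ S) (0, 0) * (1 / η₀ S) * (1 - 1 / Γ₀ S) + pv (αst₁ S) (0, 0) * (1 / Γ₀ S + 1)

/-- `dβ¹₋/du(0)`. -/
def dβm₁ (S : Setup) : ℝ :=
  pu (βst₁ S) (0, 0) * (1 / η₀ S) * (1 - 1 / Γ₀ S) + pv (βst₁ S) (0, 0) * (1 / Γ₀ S + 1)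

/-- `dα²₋/dv(0)`. -/
def dαm₂ (S : Setup) : ℝ :=
  pu (αst₂ S) (0, 0) * (1 / η₀ S) * (1 - aconst S / Γ₀ S)
    + pv (αst₂ S) (0, 0) * (aconst S / Γ₀ S + 1)

/-- `dβ²₋/dv(0)`. -/
def dβm₂ (S : Setup) : ℝ :=
  pu (βst₂ S) (0, 0) * (1 / η₀ S) * (1 - aconst S / Γ₀ S)
    + pv (βst₂ S) (0, 0) * (aconst S / Γ₀ S + 1)

/-- The inhomogeneity `a₀` of the linear system for `(α₀′, β₀′)`. -/
def a₀ (S : Setup) : ℝ := M₁₁₀ S * dαm₁ S + M₁₂₀ S * dβm₁ S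

/-- The inhomogeneity `b₀` of the linear system for `(α₀′, β₀′)`. -/
def b₀ (S : Setup) : ℝ := M₂₁₀ S * dαm₂ S + M₂₂₀ S * dβm₂ S

/-- `α₀′`, the unique solution together with `β₀′` of
`α₀′ = F¹₀ β₀′ + a₀`, `β₀′ = a F²₀ α₀′ + b₀`. -/
def α₀' (S : Setup) : ℝ := (a₀ S + F₁₀ S * b₀ S) / (1 - aconst S * F₁₀ S * F₂₀ S)

/-- `β₀′`, the unique solution together with `α₀′` of
`α₀′ = F¹₀ β₀′ + a₀`, `β₀′ = a F²₀ α₀′ + b₀`. -/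
def β₀' (S : Setup) : ℝ := (b₀ S + aconst S * F₂₀ S * a₀ S) / (1 - aconst S * F₁₀ S * F₂₀ S)

/-- **The shock interaction problem in characteristic coordinates.**
The functions `α, β, t, x` (of the characteristic coordinates `(u,v) ∈ T_ε`) are a `C²`
solution of the shock interaction problem:
(i) the characteristic system holds on `T_ε` and `t(0,0) = x(0,0) = 0`;
(ii) the shock curves `u ↦ (t,x)(u,u)` (left) and `v ↦ (t,x)(av,v)` (right) lie in the
respective future developments and satisfy the shock boundary conditions `dx₊ = V dt₊` with
`V = [ρw]/[ρ]`;
(iii) the jump conditions `J = 0` hold along both shocks;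
(iv) at the interaction point `α = β = β₀`, `∂α/∂u = α₀′`, `∂β/∂v = β₀′`, `Vⁱ(0) = Vⁱ₀`;
(v) the determinism conditions hold along both shocks. -/
def SolvesSIP (S : Setup) (ε : ℝ) (α β t x : ℝ × ℝ → ℝ) : Prop :=
  let a := aconst S
  let lα : ℝ → ℝ := fun u => α (u, u)
  let lβ : ℝ → ℝ := fun u => β (u, u)
  let lt : ℝ → ℝ := fun u => t (u, u)
  let lx : ℝ → ℝ := fun u => x (u, u)
  let rα : ℝ → ℝ := fun v => α (a * v, v)
  let rβ : ℝ → ℝ := fun v => β (a * v, v)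
  let rt : ℝ → ℝ := fun v => t (a * v, v)
  let rx : ℝ → ℝ := fun v => x (a * v, v)
  let lαm : ℝ → ℝ := fun u => αst₁ S (lt u, lx u)
  let lβm : ℝ → ℝ := fun u => βst₁ S (lt u, lx u)
  let rαm : ℝ → ℝ := fun v => αst₂ S (rt v, rx v)
  let rβm : ℝ → ℝ := fun v => βst₂ S (rt v, rx v)
  let V₁ : ℝ → ℝ := fun u =>
    (ρf S (lα u) (lβ u) * wf (lα u) (lβ u) - ρf S (lαm u) (lβm u) * wf (lαm u) (lβm u)) /
      (ρf S (lα u) (lβ u) - ρf S (lαm u) (lβm u))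
  let V₂ : ℝ → ℝ := fun v =>
    (ρf S (rα v) (rβ v) * wf (rα v) (rβ v) - ρf S (rαm v) (rβm v) * wf (rαm v) (rβm v)) /
      (ρf S (rα v) (rβ v) - ρf S (rαm v) (rβm v))
  -- regularity
  (ContDiffOn ℝ 2 α (Teps a ε) ∧ ContDiffOn ℝ 2 β (Teps a ε) ∧
    ContDiffOn ℝ 2 t (Teps a ε) ∧ ContDiffOn ℝ 2 x (Teps a ε)) ∧
  -- (i) characteristic system
  (t (0, 0) = 0 ∧ x (0, 0) = 0) ∧
  (∀ q ∈ Teps a ε,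
    pu x q = cin S (α q) (β q) * pu t q ∧
    pv x q = cout S (α q) (β q) * pv t q ∧
    pv α q = 0 ∧ pu β q = 0) ∧
  -- (ii), (iii), (v) along the left shock
  (∀ u ∈ Icc (0 : ℝ) (a * ε),
    (lt u, lx u) ∈ closure S.D₁ ∧
    deriv lx u = V₁ u * deriv lt u ∧
    Jf S (lα u) (lβ u) (lαm u) (lβm u) = 0 ∧
    cin S (lα u) (lβ u) < V₁ u ∧ V₁ u < cin S (lαm u) (lβm u)) ∧
  -- (ii), (iii), (v) along the right shock
  (∀ v ∈ Icc (0 : ℝ) ε,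
    (rt v, rx v) ∈ closure S.D₂ ∧
    deriv rx v = V₂ v * deriv rt v ∧
    Jf S (rα v) (rβ v) (rαm v) (rβm v) = 0 ∧
    cout S (rαm v) (rβm v) < V₂ v ∧ V₂ v < cout S (rα v) (rβ v)) ∧
  -- (iv) conditions at the interaction point
  (α (0, 0) = β₀ S ∧ β (0, 0) = β₀ S ∧
    pu α (0, 0) = α₀' S ∧ pv β (0, 0) = β₀' S ∧
    V₁ 0 = S.V₁₀ ∧ V₂ 0 = S.V₂₀)

/-- Extended data for the iteration scheme: in addition to the `Setup` data, the smooth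
implicit solutions `H¹, H²` (furnished by the implicit function theorem at the
interaction-point data) of the jump condition `J = 0` for the Riemann invariant behind. -/
structure IterSetup extends Setup where
  H₁ : ℝ × ℝ × ℝ → ℝ
  H₂ : ℝ × ℝ × ℝ → ℝ
  U₁ : Set (ℝ × ℝ × ℝ)
  U₂ : Set (ℝ × ℝ × ℝ)
  hU₁ : IsOpen U₁
  hU₂ : IsOpen U₂
  hU₁mem : (β₀ toSetup, αm₁₀ toSetup, βm₁₀ toSetup) ∈ U₁
  hU₂mem : (β₀ toSetup, αm₂₀ toSetup, βm₂₀ toSetup) ∈ U₂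
  hH₁ : ContDiffOn ℝ (⊤ : ℕ∞) H₁ U₁
  hH₂ : ContDiffOn ℝ (⊤ : ℕ∞) H₂ U₂
  hH₁val : H₁ (β₀ toSetup, αm₁₀ toSetup, βm₁₀ toSetup) = β₀ toSetup
  hH₂val : H₂ (β₀ toSetup, αm₂₀ toSetup, βm₂₀ toSetup) = β₀ toSetup
  hH₁J : ∀ y ∈ U₁, Jf toSetup (H₁ y) y.1 y.2.1 y.2.2 = 0
  hH₂J : ∀ y ∈ U₂, Jf toSetup y.1 (H₂ y) y.2.1 y.2.2 = 0

/-- A triple `(α¹₊, β²₊, x)` on which the iteration scheme operates. -/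
abbrev Triple : Type := (ℝ → ℝ) × (ℝ → ℝ) × (ℝ × ℝ → ℝ)

/-- One step of the iteration scheme: from `(α¹₊,ₙ, β²₊,ₙ, xₙ)` to
`(α¹₊,ₙ₊₁, β²₊,ₙ₊₁, xₙ₊₁)`, following the construction in the paper:
`αₙ(u,v) = α¹₊,ₙ(u)`, `βₙ(u,v) = β²₊,ₙ(v)`; `tₙ` by integration of the characteristic
system; states ahead by composing `αⁱ*, βⁱ*` with the shock traces; shock speeds `Vⁱₙ` by
the jump formula; `Γⁱₙ`, `μₙ`, `νₙ`, `Mₙ`, `γⁱₙ`, `Λⁱₙ`, `Φⁱₙ` as in the text; `xₙ₊₁` by the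
double-integral formula and `α¹₊,ₙ₊₁`, `β²₊,ₙ₊₁` via the implicit functions `H¹`, `H²`. -/
def step (T : IterSetup) (P : Triple) : Triple :=
  let S := T.toSetup
  let a := aconst S
  let A1 := P.1
  let B2 := P.2.1
  let X := P.2.2
  let cinn : ℝ × ℝ → ℝ := fun q => cin S (A1 q.1) (B2 q.2)
  let coutn : ℝ × ℝ → ℝ := fun q => cout S (A1 q.1) (B2 q.2)
  let φ : ℝ × ℝ → ℝ := fun q => pu X q / cinn q
  let ψ : ℝ × ℝ → ℝ := fun q => pv X q / coutn q
  let tn : ℝ × ℝ → ℝ := fun q =>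
    (∫ u' in (0 : ℝ)..q.1, (φ (u', u') + ψ (u', u'))) + ∫ v' in q.1..q.2, ψ (q.1, v')
  let lt : ℝ → ℝ := fun u => tn (u, u)
  let lx : ℝ → ℝ := fun u => X (u, u)
  let rt : ℝ → ℝ := fun v => tn (a * v, v)
  let rx : ℝ → ℝ := fun v => X (a * v, v)
  let lαm : ℝ → ℝ := fun u => αst₁ S (lt u, lx u)
  let lβm : ℝ → ℝ := fun u => βst₁ S (lt u, lx u)
  let rαm : ℝ → ℝ := fun v => αst₂ S (rt v, rx v)
  let rβm : ℝ → ℝ := fun v => βst₂ S (rt v, rx v)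
  let lα : ℝ → ℝ := A1
  let lβ : ℝ → ℝ := B2
  let rα : ℝ → ℝ := fun v => A1 (a * v)
  let rβ : ℝ → ℝ := B2
  let V₁ : ℝ → ℝ := fun u =>
    (ρf S (lα u) (lβ u) * wf (lα u) (lβ u) - ρf S (lαm u) (lβm u) * wf (lαm u) (lβm u)) /
      (ρf S (lα u) (lβ u) - ρf S (lαm u) (lβm u))
  let V₂ : ℝ → ℝ := fun v =>
    (ρf S (rα v) (rβ v) * wf (rα v) (rβ v) - ρf S (rαm v) (rβm v) * wf (rαm v) (rβm v)) /
      (ρf S (rα v) (rβ v) - ρf S (rαm v) (rβm v))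
  let Γ₁ : ℝ → ℝ := fun u =>
    (cout S (lα u) (lβ u) / cin S (lα u) (lβ u)) *
      ((V₁ u - cin S (lα u) (lβ u)) / (cout S (lα u) (lβ u) - V₁ u))
  let Γ₂ : ℝ → ℝ := fun v =>
    a * (cout S (rα v) (rβ v) / cin S (rα v) (rβ v)) *
      ((V₂ v - cin S (rα v) (rβ v)) / (cout S (rα v) (rβ v) - V₂ v))
  let μ : ℝ × ℝ → ℝ := fun q => (1 / (coutn q - cinn q)) * (coutn q / cinn q) * pv cinn q
  let ν : ℝ × ℝ → ℝ := fun q => -((1 / (coutn q - cinn q)) * (cinn q / coutn q) * pu coutn q)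
  let Mn : ℝ × ℝ → ℝ := fun q => μ q * pu X q + ν q * pv X q
  let γ₁ : ℝ → ℝ := fun u => Γ₂ u / Γ₁ u
  let γ₂ : ℝ → ℝ := fun v => Γ₂ v / Γ₁ (a * v)
  let Λ₁ : ℝ → ℝ := fun u =>
    deriv γ₁ u * pu X (a * u, u) + a * γ₁ u * pu (fun q => pu X q) (a * u, u)
      + γ₁ u * Mn (a * u, u)
  let Λ₂ : ℝ → ℝ := fun v =>
    deriv γ₂ v * pv X (a * v, a * v) + a * γ₂ v * pv (fun q => pv X q) (a * v, a * v)
      + a * γ₂ v * Mn (a * v, a * v)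
  let Φ₁ : ℝ → ℝ := fun u =>
    (∫ u' in (0 : ℝ)..u, Λ₁ u') + (1 / Γ₁ u) * ∫ u' in (a * u)..u, Mn (u', u)
  let Φ₂ : ℝ → ℝ := fun v =>
    (∫ v' in (0 : ℝ)..v, Λ₂ v') + Γ₂ v * ∫ v' in (a * v)..v, Mn (a * v, v')
  let Xnext : ℝ × ℝ → ℝ := fun q =>
    q.1 / Γ₀ S + q.2 + (∫ u' in (0 : ℝ)..q.1, Φ₁ u') + (∫ v' in (0 : ℝ)..q.2, Φ₂ v')
      + (∫ v' in (0 : ℝ)..q.1, ∫ u' in (a * v')..v', Mn (u', v'))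
      + ∫ v' in q.1..q.2, ∫ u' in (a * v')..q.1, Mn (u', v')
  let A1next : ℝ → ℝ := fun u => T.H₁ (B2 u, lαm u, lβm u)
  let B2next : ℝ → ℝ := fun v => T.H₂ (A1 (a * v), rαm v, rβm v)
  (A1next, B2next, Xnext)

/-- The sequence of iterates of the shock interaction iteration scheme, initialized by
`x₀(u,v) = u/Γ₀ + v`, `α¹₊,₀(u) = β₀ + α₀′u`, `β²₊,₀(v) = β₀ + β₀′v`. -/
def seq (T : IterSetup) : ℕ → Triple
  | 0 => (fun u => β₀ T.toSetup + α₀' T.toSetup * u,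
      fun v => β₀ T.toSetup + β₀' T.toSetup * v,
      fun q => q.1 / Γ₀ T.toSetup + q.2)
  | n + 1 => step T (seq T n)

/-- Membership in the ball `B_{N₀}` of `C²(T_ε)` functions with the prescribed values at the
interaction point and second derivatives bounded by `N₀`. -/
def memBN (S : Setup) (ε N₀ : ℝ) (f : ℝ × ℝ → ℝ) : Prop :=
  ContDiffOn ℝ 2 f (Teps (aconst S) ε) ∧
  f (0, 0) = 0 ∧ pu f (0, 0) = 1 / Γ₀ S ∧ pv f (0, 0) = 1 ∧
  ∀ q ∈ Teps (aconst S) ε,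
    |pu (fun q' => pu f q') q| ≤ N₀ ∧ |pv (fun q' => pu f q') q| ≤ N₀ ∧
    |pv (fun q' => pv f q') q| ≤ N₀

/-- Membership in the ball `B_A` of `C²[0, aε]` functions with `f(0) = β₀`, `f′(0) = α₀′`
and second derivative bounded by `A`. -/
def memBA (S : Setup) (ε A : ℝ) (f : ℝ → ℝ) : Prop :=
  ContDiffOn ℝ 2 f (Icc 0 (aconst S * ε)) ∧
  f 0 = β₀ S ∧ deriv f 0 = α₀' S ∧
  ∀ u ∈ Icc (0 : ℝ) (aconst S * ε), |deriv (deriv f) u| ≤ A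

/-- Membership in the ball `B_B` of `C²[0, ε]` functions with `f(0) = β₀`, `f′(0) = β₀′`
and second derivative bounded by `B`. -/
def memBB (S : Setup) (ε B : ℝ) (f : ℝ → ℝ) : Prop :=
  ContDiffOn ℝ 2 f (Icc 0 ε) ∧
  f 0 = β₀ S ∧ deriv f 0 = β₀' S ∧
  ∀ v ∈ Icc (0 : ℝ) ε, |deriv (deriv f) v| ≤ B

section

open scoped Topology ContDiff

/-- The segment integral `∫_p^s f(x, v) dx` as a function of `(p, s, v)`. -/
def segInt (f : ℝ × ℝ → ℝ) (p : ℝ × ℝ × ℝ) : ℝ := ∫ x in p.1..p.2.1, f (x, p.2.2)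

lemma exists_continuous_extension_of_box {f : ℝ × ℝ → ℝ} {d r : ℝ} (hr : 0 ≤ r) (hrd : r < d)
    (hf : ∀ q : ℝ × ℝ, ‖q‖ < d → ContinuousAt f q) :
    ∃ g : ℝ × ℝ → ℝ, Continuous g ∧ ∀ q : ℝ × ℝ, ‖q‖ ≤ r → g q = f q := by
  have hle : -r ≤ r := by linarith
  let c : ℝ → ℝ := fun x => max (-r) (min r x)
  have hc : Continuous c := by fun_prop
  have hcr : ∀ x, |c x| ≤ r := fun x => by
    rw [abs_le]; exact ⟨le_max_left _ _, max_le hle (min_le_left _ _)⟩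
  have hcid : ∀ x, |x| ≤ r → c x = x := fun x hx => by
    rw [abs_le] at hx
    simp only [c]
    rw [min_eq_right hx.2, max_eq_right hx.1]
  refine ⟨fun q => f (c q.1, c q.2), ?_, ?_⟩
  · rw [continuous_iff_continuousAt]
    intro q
    have h1 : ‖((c q.1, c q.2) : ℝ × ℝ)‖ < d := by
      rw [Prod.norm_def]
      exact lt_of_le_of_lt (max_le (hcr _) (hcr _)) hrd
    exact ContinuousAt.comp (f := fun q : ℝ × ℝ => (c q.1, c q.2)) (hf _ h1)
      (by fun_prop)
  · intro q hq
    rw [Prod.norm_def] at hq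
    have h1 : |q.1| ≤ r := (le_max_left _ _).trans hq
    have h2 : |q.2| ≤ r := (le_max_right _ _).trans hq
    simp [hcid _ h1, hcid _ h2]

lemma norm_seg_le {p : ℝ × ℝ × ℝ} {r x : ℝ} (hp : ‖p‖ ≤ r) (hx : x ∈ uIcc p.1 p.2.1) :
    ‖((x, p.2.2) : ℝ × ℝ)‖ ≤ r := by
  simp only [Prod.norm_def, Real.norm_eq_abs, sup_le_iff] at hp ⊢
  obtain ⟨h1, h2, h3⟩ := hp
  refine ⟨?_, h3⟩
  rw [abs_le] at h1 h2 ⊢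
  rcases mem_uIcc.1 hx with h | h
  · exact ⟨by linarith, by linarith⟩
  · exact ⟨by linarith, by linarith⟩

lemma segInt_eq_of_box {f g : ℝ × ℝ → ℝ} {r : ℝ} (h : ∀ q : ℝ × ℝ, ‖q‖ ≤ r → g q = f q)
    {p : ℝ × ℝ × ℝ} (hp : ‖p‖ ≤ r) : segInt g p = segInt f p :=
  intervalIntegral.integral_congr fun _ hx => h _ (norm_seg_le hp hx)

lemma continuous_segInt {g : ℝ × ℝ → ℝ} (hg : Continuous g) : Continuous (segInt g) := by
  have h : ∀ p : ℝ × ℝ × ℝ, segInt g p =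
      (∫ x in (0:ℝ)..p.2.1, g (x, p.2.2)) - ∫ x in (0:ℝ)..p.1, g (x, p.2.2) := by
    intro p
    have hi : ∀ a b, IntervalIntegrable (fun x => g (x, p.2.2)) MeasureTheory.volume a b :=
      fun a b => (by fun_prop : Continuous fun x => g (x, p.2.2)).intervalIntegrable a b
    rw [segInt, intervalIntegral.integral_interval_sub_left (hi _ _) (hi _ _)]
  rw [funext h]
  refine Continuous.sub ?_ ?_
  · exact intervalIntegral.continuous_parametric_intervalIntegral_of_continuous
      (f := fun (p : ℝ × ℝ × ℝ) x => g (x, p.2.2)) (by fun_prop) (by fun_prop)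
  · exact intervalIntegral.continuous_parametric_intervalIntegral_of_continuous
      (f := fun (p : ℝ × ℝ × ℝ) x => g (x, p.2.2)) (by fun_prop) (by fun_prop)

lemma continuousAt_segInt {f : ℝ × ℝ → ℝ} {d : ℝ}
    (hf : ∀ q : ℝ × ℝ, ‖q‖ < d → ContinuousAt f q) {p : ℝ × ℝ × ℝ} (hp : ‖p‖ < d) :
    ContinuousAt (segInt f) p := by
  obtain ⟨r, hpr, hrd⟩ := exists_between hp
  obtain ⟨g, hg, hgf⟩ :=
    exists_continuous_extension_of_box ((norm_nonneg p).trans hpr.le) hrd hf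
  refine (continuous_segInt hg).continuousAt.congr ?_
  filter_upwards [(continuous_norm.continuousAt (x := p)).eventually_lt_const hpr] with y hy
  exact segInt_eq_of_box hgf hy.le

lemma abs_segInt_le {f : ℝ × ℝ → ℝ} {d C : ℝ} (hC : ∀ q : ℝ × ℝ, ‖q‖ < d → |f q| ≤ C)
    {p : ℝ × ℝ × ℝ} (hp : ‖p‖ < d) : |segInt f p| ≤ C * (2 * d) := by
  have h := intervalIntegral.norm_integral_le_of_norm_le_const (a := p.1) (b := p.2.1)
    (f := fun x => f (x, p.2.2)) (C := C)
    (fun x hx => hC _ ((norm_seg_le le_rfl (uIoc_subset_uIcc hx)).trans_lt hp))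
  refine h.trans ?_
  have hC0 : 0 ≤ C := (abs_nonneg _).trans (hC 0 (by simpa using (norm_nonneg p).trans_lt hp))
  refine mul_le_mul_of_nonneg_left ?_ hC0
  simp only [Prod.norm_def, Real.norm_eq_abs, sup_lt_iff] at hp
  have h1 := abs_sub p.2.1 p.1
  linarith [hp.1, hp.2.1]

lemma hasFDerivAt_primitive_box {f : ℝ × ℝ → ℝ} {f' : ℝ × ℝ → ℝ × ℝ →L[ℝ] ℝ} {d : ℝ}
    (hf : ∀ q : ℝ × ℝ, ‖q‖ < d → HasFDerivAt f (f' q) q)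
    (hf' : ∀ q : ℝ × ℝ, ‖q‖ < d → ContinuousAt f' q) {q : ℝ × ℝ} (hq : ‖q‖ < d) :
    HasFDerivAt (fun q : ℝ × ℝ => ∫ x in (0:ℝ)..q.1, f (x, q.2))
      ((ContinuousLinearMap.toSpanSingleton ℝ (f q)).coprod
        (ContinuousLinearMap.toSpanSingleton ℝ (∫ x in (0:ℝ)..q.1, f' (x, q.2) (0, 1)))) q := by
  have hcont : ∀ q : ℝ × ℝ, ‖q‖ < d → ContinuousAt f q := fun q hq => (hf q hq).continuousAt
  have hcont' : ∀ q : ℝ × ℝ, ‖q‖ < d → ContinuousAt (fun q => f' q (0, 1)) q :=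
    fun q hq => (hf' q hq).clm_apply continuousAt_const
  have hnear : ∀ᶠ v : ℝ × ℝ in 𝓝 q, ‖v‖ < d := continuous_norm.continuousAt.eventually_lt_const hq
  have hseg : ∀ v : ℝ × ℝ, ‖v‖ < d → ‖((0, v.1, v.2) : ℝ × ℝ × ℝ)‖ < d := by
    intro v hv
    simp only [Prod.norm_def, sup_lt_iff] at hv ⊢
    exact ⟨by simpa using (abs_nonneg v.1).trans_lt hv.1, hv.1, hv.2⟩
  have h := hasStrictFDerivAt_uncurry_coprod (𝕜 := ℝ) (u := q)
    (f := fun y v => ∫ x in (0:ℝ)..y, f (x, v))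
    (f₁ := fun y v => ContinuousLinearMap.toSpanSingleton ℝ (f (y, v)))
    (f₂ := fun y v => ContinuousLinearMap.toSpanSingleton ℝ
      (∫ x in (0:ℝ)..y, f' (x, v) (0, 1))) ?_ ?_ ?_ ?_
  · exact h.hasFDerivAt
  · filter_upwards [hnear] with v hv
    refine HasDerivAt.hasFDerivAt ?_
    have hslice : ∀ x, ‖((x, v.2) : ℝ × ℝ)‖ < d → ContinuousAt (fun x => f (x, v.2)) x :=
      fun x hx => ContinuousAt.comp (f := fun x : ℝ => (x, v.2)) (hcont _ hx) (by fun_prop)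
    refine intervalIntegral.integral_hasDerivAt_right ?_ ?_ (hslice _ hv)
    · refine ContinuousOn.intervalIntegrable fun x hx => (hslice x ?_).continuousWithinAt
      exact (norm_seg_le (p := (0, v.1, v.2)) le_rfl hx).trans_lt (hseg v hv)
    · refine ContinuousOn.stronglyMeasurableAtFilter (s := {x | ‖((x, v.2) : ℝ × ℝ)‖ < d})
        (isOpen_lt (by fun_prop) continuous_const)
        (fun x hx => (hslice x hx).continuousWithinAt) _ hv
  · filter_upwards [hnear] with v hv
    refine HasDerivAt.hasFDerivAt ?_
    obtain ⟨r, hvr, hrd⟩ := exists_between (hseg v hv)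
    obtain ⟨g, hg, hgf⟩ :=
      exists_continuous_extension_of_box ((norm_nonneg _).trans hvr.le) hrd hcont'
    obtain ⟨C, hC⟩ := (isCompact_closedBall (0 : ℝ × ℝ) r).exists_bound_of_continuousOn
      hg.continuousOn
    have hbox : ∀ x ∈ uIcc 0 v.1, ∀ y, |y| < r → ‖((x, y) : ℝ × ℝ)‖ ≤ r := by
      intro x hx y hy
      have := norm_seg_le (p := (0, v.1, v.2)) hvr.le hx
      simp only [Prod.norm_def, sup_le_iff] at this ⊢
      exact ⟨this.1, hy.le⟩
    have hv2 : |v.2| < r := by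
      simp only [Prod.norm_def, sup_lt_iff] at hvr
      exact hvr.2.2
    have hopen : {y : ℝ | |y| < r} ∈ 𝓝 v.2 := (isOpen_lt continuous_abs continuous_const).mem_nhds hv2
    have hci : ∀ y, |y| < r → ContinuousOn (fun x => f (x, y)) (uIcc 0 v.1) := fun y hy x hx =>
      (ContinuousAt.comp (f := fun x : ℝ => (x, y)) (hcont _ ((hbox x hx y hy).trans_lt hrd))
        (by fun_prop)).continuousWithinAt
    refine (intervalIntegral.hasDerivAt_integral_of_dominated_loc_of_deriv_le (bound := fun _ => C)
      (F := fun y x => f (x, y)) (F' := fun y x => f' (x, y) (0, 1)) hopen ?_ ?_ ?_ ?_ ?_ ?_).2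
    · filter_upwards [hopen] with y hy
      exact ((hci y hy).mono uIoc_subset_uIcc).aestronglyMeasurable measurableSet_uIoc
    · exact (hci _ hv2).intervalIntegrable
    · refine ContinuousOn.aestronglyMeasurable (fun x hx => ?_) measurableSet_uIoc
      exact (ContinuousAt.comp (f := fun x : ℝ => (x, v.2))
        (hcont' _ ((hbox x (uIoc_subset_uIcc hx) _ hv2).trans_lt hrd))
        (by fun_prop)).continuousWithinAt
    · refine Eventually.of_forall fun x hx y hy => ?_
      have hb := hbox x (uIoc_subset_uIcc hx) y hy
      have := hC (x, y) (by simpa using hb)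
      rwa [hgf _ hb] at this
    · exact intervalIntegrable_const
    · refine Eventually.of_forall fun x hx y hy => ?_
      have hb := hbox x (uIoc_subset_uIcc hx) y hy
      have h1 := hf (x, y) (hb.trans_lt hrd)
      exact h1.comp_hasDerivAt y ((hasDerivAt_const y x).prodMk (hasDerivAt_id y))
  · have : Continuous (fun c : ℝ => ContinuousLinearMap.toSpanSingleton ℝ c) :=
      (ContinuousLinearMap.toSpanSingletonCLE (𝕜 := ℝ) (E := ℝ)).continuous
    exact this.continuousAt.comp (hcont q hq)
  · have : Continuous (fun c : ℝ => ContinuousLinearMap.toSpanSingleton ℝ c) :=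
      (ContinuousLinearMap.toSpanSingletonCLE (𝕜 := ℝ) (E := ℝ)).continuous
    exact this.continuousAt.comp (ContinuousAt.comp
      (f := fun v : ℝ × ℝ => ((0, v.1, v.2) : ℝ × ℝ × ℝ))
      (g := segInt (fun q => f' q (0, 1))) (continuousAt_segInt hcont' (hseg q hq)) (by fun_prop))

/-- The derivative of `segInt f` when `f` has derivative `f'`. -/
def segIntDeriv (f : ℝ × ℝ → ℝ) (f' : ℝ × ℝ → ℝ × ℝ →L[ℝ] ℝ) (p : ℝ × ℝ × ℝ) :
    ℝ × ℝ × ℝ →L[ℝ] ℝ :=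
  (-f (p.1, p.2.2)) • ContinuousLinearMap.fst ℝ ℝ (ℝ × ℝ) +
    f (p.2.1, p.2.2) • (ContinuousLinearMap.fst ℝ ℝ ℝ).comp (ContinuousLinearMap.snd ℝ ℝ (ℝ × ℝ)) +
    segInt (fun q => f' q (0, 1)) p •
      (ContinuousLinearMap.snd ℝ ℝ ℝ).comp (ContinuousLinearMap.snd ℝ ℝ (ℝ × ℝ))

lemma hasFDerivAt_segInt {f : ℝ × ℝ → ℝ} {f' : ℝ × ℝ → ℝ × ℝ →L[ℝ] ℝ} {d : ℝ}
    (hf : ∀ q : ℝ × ℝ, ‖q‖ < d → HasFDerivAt f (f' q) q)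
    (hf' : ∀ q : ℝ × ℝ, ‖q‖ < d → ContinuousAt f' q) {p : ℝ × ℝ × ℝ} (hp : ‖p‖ < d) :
    HasFDerivAt (segInt f) (segIntDeriv f f' p) p := by
  have hslice : ∀ (h : ℝ × ℝ → ℝ), (∀ q : ℝ × ℝ, ‖q‖ < d → ContinuousAt h q) →
      ∀ p : ℝ × ℝ × ℝ, ‖p‖ < d → segInt h p =
        (∫ x in (0:ℝ)..p.2.1, h (x, p.2.2)) - ∫ x in (0:ℝ)..p.1, h (x, p.2.2) := by
    intro h hh p hp
    have hi : ∀ b, ‖((b, p.2.2) : ℝ × ℝ)‖ < d →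
        IntervalIntegrable (fun x => h (x, p.2.2)) MeasureTheory.volume 0 b := by
      intro b hb
      refine ContinuousOn.intervalIntegrable fun x hx => ?_
      have hb' : ‖((0, b, p.2.2) : ℝ × ℝ × ℝ)‖ < d := by
        simp only [Prod.norm_def, sup_lt_iff] at hb ⊢
        exact ⟨by simpa using (abs_nonneg b).trans_lt hb.1, hb.1, hb.2⟩
      exact (ContinuousAt.comp (f := fun x : ℝ => (x, p.2.2))
        (hh _ ((norm_seg_le (p := (0, b, p.2.2)) le_rfl hx).trans_lt hb'))
        (by fun_prop)).continuousWithinAt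
    simp only [Prod.norm_def, sup_lt_iff] at hp hi
    rw [segInt, intervalIntegral.integral_interval_sub_left (hi _ ⟨hp.2.1, hp.2.2⟩)
      (hi _ ⟨hp.1, hp.2.2⟩)]
  have hp1 : ‖((p.2.1, p.2.2) : ℝ × ℝ)‖ < d := by
    simp only [Prod.norm_def, sup_lt_iff] at hp ⊢
    exact ⟨hp.2.1, hp.2.2⟩
  have hp2 : ‖((p.1, p.2.2) : ℝ × ℝ)‖ < d := by
    simp only [Prod.norm_def, sup_lt_iff] at hp ⊢
    exact ⟨hp.1, hp.2.2⟩
  have h1 := hasFDerivAt_primitive_box hf hf' hp1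
  have h2 := hasFDerivAt_primitive_box hf hf' hp2
  have l1 : HasFDerivAt (fun p : ℝ × ℝ × ℝ => ((p.2.1, p.2.2) : ℝ × ℝ))
      (ContinuousLinearMap.snd ℝ ℝ (ℝ × ℝ)) p := (ContinuousLinearMap.snd ℝ ℝ (ℝ × ℝ)).hasFDerivAt
  have l2 : HasFDerivAt (fun p : ℝ × ℝ × ℝ => ((p.1, p.2.2) : ℝ × ℝ))
      ((ContinuousLinearMap.fst ℝ ℝ (ℝ × ℝ)).prod
        ((ContinuousLinearMap.snd ℝ ℝ ℝ).comp (ContinuousLinearMap.snd ℝ ℝ (ℝ × ℝ)))) p :=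
    ((ContinuousLinearMap.fst ℝ ℝ (ℝ × ℝ)).prod
        ((ContinuousLinearMap.snd ℝ ℝ ℝ).comp (ContinuousLinearMap.snd ℝ ℝ (ℝ × ℝ)))).hasFDerivAt
  have h3 := (h1.comp p l1).sub (h2.comp p l2)
  have hev : segInt f =ᶠ[𝓝 p] fun p : ℝ × ℝ × ℝ =>
      (∫ x in (0:ℝ)..p.2.1, f (x, p.2.2)) - ∫ x in (0:ℝ)..p.1, f (x, p.2.2) := by
    filter_upwards [continuous_norm.continuousAt.eventually_lt_const hp] with y hy
    exact hslice f (fun q hq => (hf q hq).continuousAt) y hy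
  refine (h3.congr_of_eventuallyEq hev).congr_fderiv ?_
  have h4 := hslice (fun q => f' q (0, 1))
    (fun q hq => (hf' q hq).clm_apply continuousAt_const) p hp
  refine ContinuousLinearMap.ext fun x => ?_
  simp only [segIntDeriv, h4]
  simp
  ring

set_option linter.unusedSectionVars false

section Families

variable {ι : Type*} {E E' V W : Type*}
  [NormedAddCommGroup E] [NormedSpace ℝ E] [NormedAddCommGroup E'] [NormedSpace ℝ E']
  [NormedAddCommGroup V] [NormedSpace ℝ V] [NormedAddCommGroup W] [NormedSpace ℝ W]

/-- The filter on pairs (index, point), the point being in the open ball of radius `d i`. -/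
def nearF (G : Filter ι) (d : ι → ℝ) (E : Type*) [NormedAddCommGroup E] : Filter (ι × E) :=
  comap Prod.fst G ⊓ 𝓟 {z | ‖z.2‖ < d z.1}

lemma eventually_nearF {G : Filter ι} {d : ι → ℝ} {p : ι × E → Prop} :
    (∀ᶠ z in nearF G d E, p z) ↔ ∀ᶠ i in G, ∀ x : E, ‖x‖ < d i → p (i, x) := by
  rw [nearF, eventually_inf_principal, eventually_comap]
  constructor
  · intro h
    filter_upwards [h] with i hi x hx using hi (i, x) rfl hx
  · intro h
    filter_upwards [h] with i hi z hz hx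
    subst hz
    exact hi z.2 hx

lemma tendsto_fst_nearF (G : Filter ι) (d : ι → ℝ) : Tendsto Prod.fst (nearF G d E) G :=
  tendsto_comap.mono_left inf_le_left

lemma tendsto_nearF_lin (G : Filter ι) (d : ι → ℝ) {l : E → E'} (hl : ∀ x, ‖l x‖ ≤ ‖x‖) :
    Tendsto (fun z : ι × E => (z.1, l z.2)) (nearF G d E) (nearF G d E') := by
  rw [nearF, nearF, tendsto_inf, tendsto_comap_iff, tendsto_principal]
  refine ⟨(tendsto_fst_nearF G d), ?_⟩
  filter_upwards [mem_inf_of_right (mem_principal_self _)] with z hz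
  exact (hl _).trans_lt hz

variable (G : Filter ι) (d : ι → ℝ)

/-- The family `f` is continuous on the balls. -/
def Cont (f : ι → E → V) : Prop := ∀ᶠ z in nearF G d E, ContinuousAt (f z.1) z.2

/-- The family `f` is continuous on the balls, converges uniformly to the constant `c`, and takes
the value `c` at the origin. -/
structure CL (f : ι → E → V) (c : V) : Prop where
  cont : Cont G d f
  lim : Tendsto (fun z : ι × E => f z.1 z.2) (nearF G d E) (𝓝 c)
  zero : ∀ᶠ i in G, f i 0 = c

/-- The family `f` is continuous on the balls and uniformly `O(g)`. -/
structure CB (f : ι → E → V) (g : ι → ℝ) : Prop where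
  cont : Cont G d f
  bound : (fun z : ι × E => f z.1 z.2) =O[nearF G d E] fun z => g z.1

/-- The family `f` has Fréchet derivative `f'` on the balls. -/
def HF (f : ι → E → V) (f' : ι → E → E →L[ℝ] V) : Prop :=
  ∀ᶠ z in nearF G d E, HasFDerivAt (f z.1) (f' z.1 z.2) z.2

/-- The family `f` of functions of a real variable has derivative `f'` on the balls. -/
def HD (f f' : ι → ℝ → V) : Prop :=
  ∀ᶠ z in nearF G d ℝ, HasDerivAt (f z.1) (f' z.1 z.2) z.2

variable {G d}

lemma HF.cont {f : ι → E → V} {f' : ι → E → E →L[ℝ] V} (h : HF G d f f') : Cont G d f :=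
  Eventually.mono h fun _ hz => hz.continuousAt

lemma HD.cont {f f' : ι → ℝ → V} (h : HD G d f f') : Cont G d f :=
  Eventually.mono h fun _ hz => hz.continuousAt

lemma CL.const (c : V) : CL G d (fun (_ : ι) (_ : E) => c) c :=
  ⟨Eventually.of_forall fun _ => continuousAt_const, tendsto_const_nhds,
    Eventually.of_forall fun _ => rfl⟩

lemma CL.prodMk {f : ι → E → V} {g : ι → E → W} {c : V} {e : W} (hf : CL G d f c)
    (hg : CL G d g e) : CL G d (fun i x => (f i x, g i x)) (c, e) :=
  ⟨(hf.cont.and hg.cont).mono fun _ h => h.1.prodMk h.2, hf.lim.prodMk_nhds hg.lim,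
    (hf.zero.and hg.zero).mono fun _ h => Prod.ext h.1 h.2⟩

lemma CL.comp {f : ι → E → V} {c : V} {h : V → W} (hf : CL G d f c)
    (hh : ∀ᶠ y in 𝓝 c, ContinuousAt h y) : CL G d (fun i x => h (f i x)) (h c) :=
  ⟨(hf.cont.and (hf.lim.eventually hh)).mono fun _ hz => ContinuousAt.comp hz.2 hz.1,
    (hh.self_of_nhds).tendsto.comp hf.lim, hf.zero.mono fun _ h => congrArg _ h⟩

lemma CL.comp' {f : ι → E → V} {c : V} {h : V → W} (hf : CL G d f c)
    (hh : Continuous h) : CL G d (fun i x => h (f i x)) (h c) :=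
  hf.comp (Eventually.of_forall fun _ => hh.continuousAt)

lemma CL.lin {f : ι → E' → V} {c : V} (hf : CL G d f c) (l : E →L[ℝ] E')
    (hl : ∀ x, ‖l x‖ ≤ ‖x‖) : CL G d (fun i x => f i (l x)) c :=
  ⟨((tendsto_nearF_lin G d hl).eventually hf.cont).mono fun _ hz =>
    ContinuousAt.comp hz l.continuous.continuousAt, hf.lim.comp (tendsto_nearF_lin G d hl),
    hf.zero.mono fun _ h => by rw [map_zero, h]⟩

lemma CL.add {f g : ι → E → V} {c e : V} (hf : CL G d f c) (hg : CL G d g e) :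
    CL G d (fun i x => f i x + g i x) (c + e) :=
  (hf.prodMk hg).comp' (h := fun p : V × V => p.1 + p.2) (by fun_prop)

lemma CL.mul {f g : ι → E → ℝ} {c e : ℝ} (hf : CL G d f c) (hg : CL G d g e) :
    CL G d (fun i x => f i x * g i x) (c * e) :=
  (hf.prodMk hg).comp' (h := fun p : ℝ × ℝ => p.1 * p.2) (by fun_prop)

lemma CL.clm_apply {k : ι → E → V →L[ℝ] W} {f : ι → E → V} {K : V →L[ℝ] W} {c : V}
    (hk : CL G d k K) (hf : CL G d f c) : CL G d (fun i x => k i x (f i x)) (K c) :=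
  (hk.prodMk hf).comp' (h := fun p : (V →L[ℝ] W) × V => p.1 p.2) (by fun_prop)

lemma CL.cb {f : ι → E → V} {c : V} (hf : CL G d f c) {g : ι → ℝ} (hg : ∀ i, 1 ≤ g i) :
    CB G d f g :=
  ⟨hf.cont, (hf.lim.isBigO_one ℝ).trans (Asymptotics.isBigO_of_le _ fun z => by
    rw [norm_one]; exact (hg z.1).trans (le_abs_self _))⟩

lemma CB.mono {f : ι → E → V} {g h : ι → ℝ} (hf : CB G d f g) (hg : ∀ i, 0 ≤ g i)
    (hgh : ∀ i, g i ≤ h i) : CB G d f h :=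
  ⟨hf.cont, hf.bound.trans (Asymptotics.isBigO_of_le _ fun z => by
    rw [Real.norm_of_nonneg (hg _), Real.norm_of_nonneg ((hg _).trans (hgh _))]; exact hgh _)⟩

lemma CB.prodMk {f : ι → E → V} {f₂ : ι → E → W} {g : ι → ℝ} (hf : CB G d f g)
    (hf₂ : CB G d f₂ g) : CB G d (fun i x => (f i x, f₂ i x)) g :=
  ⟨(hf.cont.and hf₂.cont).mono fun _ h => h.1.prodMk h.2, hf.bound.prod_left hf₂.bound⟩

lemma CB.add {f f₂ : ι → E → V} {g : ι → ℝ} (hf : CB G d f g)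
    (hf₂ : CB G d f₂ g) : CB G d (fun i x => f i x + f₂ i x) g :=
  ⟨(hf.cont.and hf₂.cont).mono fun _ h => h.1.add h.2, hf.bound.add hf₂.bound⟩

lemma CB.clm_apply {k : ι → E → V →L[ℝ] W} {f : ι → E → V} {K : V →L[ℝ] W} {g : ι → ℝ}
    (hk : CL G d k K) (hf : CB G d f g) : CB G d (fun i x => k i x (f i x)) g := by
  refine ⟨(hk.cont.and hf.cont).mono fun _ h => h.1.clm_apply h.2, ?_⟩
  have h := (hk.lim.isBigO_one ℝ).norm_left.mul hf.bound.norm_left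
  simp only [one_mul] at h
  refine (Asymptotics.isBigO_of_le _ fun z => ?_).trans h
  rw [norm_mul, norm_norm, norm_norm]
  exact ContinuousLinearMap.le_opNorm _ _

lemma CB.mul {k f : ι → E → ℝ} {c : ℝ} {g : ι → ℝ}
    (hk : CL G d k c) (hf : CB G d f g) : CB G d (fun i x => k i x * f i x) g := by
  refine ⟨(hk.cont.and hf.cont).mono fun _ h => h.1.mul h.2, ?_⟩
  simpa using (hk.lim.isBigO_one ℝ).mul hf.bound

lemma CB.clm {f : ι → E → V} {g : ι → ℝ} (hf : CB G d f g) (k : V →L[ℝ] W) :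
    CB G d (fun i x => k (f i x)) g :=
  CB.clm_apply (CL.const k) hf

lemma CB.lin {f : ι → E' → V} {g : ι → ℝ} (hf : CB G d f g) (l : E →L[ℝ] E')
    (hl : ∀ x, ‖l x‖ ≤ ‖x‖) : CB G d (fun i x => f i (l x)) g :=
  ⟨((tendsto_nearF_lin G d hl).eventually hf.cont).mono fun _ hz =>
    ContinuousAt.comp hz l.continuous.continuousAt,
    hf.bound.comp_tendsto (tendsto_nearF_lin G d hl)⟩

lemma HF.prodMk {f : ι → E → V} {g : ι → E → W} {f' : ι → E → E →L[ℝ] V}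
    {g' : ι → E → E →L[ℝ] W} (hf : HF G d f f') (hg : HF G d g g') :
    HF G d (fun i x => (f i x, g i x)) (fun i x => (f' i x).prod (g' i x)) :=
  Eventually.mono (hf.and hg) fun _ h => h.1.prodMk h.2

lemma HD.prodMk {f f' : ι → ℝ → V} {g g' : ι → ℝ → W} (hf : HD G d f f') (hg : HD G d g g') :
    HD G d (fun i x => (f i x, g i x)) (fun i x => (f' i x, g' i x)) :=
  Eventually.mono (hf.and hg) fun _ h => h.1.prodMk h.2

lemma HD.add {f f' g g' : ι → ℝ → V} (hf : HD G d f f') (hg : HD G d g g') :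
    HD G d (fun i x => f i x + g i x) (fun i x => f' i x + g' i x) :=
  Eventually.mono (hf.and hg) fun _ h => h.1.add h.2

lemma HD.mul {f f' g g' : ι → ℝ → ℝ} (hf : HD G d f f') (hg : HD G d g g') :
    HD G d (fun i x => f i x * g i x) (fun i x => f' i x * g i x + f i x * g' i x) :=
  Eventually.mono (hf.and hg) fun _ h => h.1.mul h.2

lemma HF.lin {f : ι → E' → V} {f' : ι → E' → E' →L[ℝ] V} (hf : HF G d f f') (l : E →L[ℝ] E')
    (hl : ∀ x, ‖l x‖ ≤ ‖x‖) : HF G d (fun i x => f i (l x)) (fun i x => (f' i (l x)).comp l) :=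
  ((tendsto_nearF_lin G d hl).eventually hf).mono fun z hz =>
    HasFDerivAt.comp (f := l) z.2 hz l.hasFDerivAt

lemma HF.curve {f : ι → E → V} {f' : ι → E → E →L[ℝ] V} (hf : HF G d f f') (l : ℝ →L[ℝ] E)
    (hl : ∀ x, ‖l x‖ ≤ ‖x‖) : HD G d (fun i x => f i (l x)) (fun i x => f' i (l x) (l 1)) :=
  ((tendsto_nearF_lin G d hl).eventually hf).mono fun _ hz =>
    hz.comp_hasDerivAt _ l.hasDerivAt

lemma HD.lin {f f' : ι → ℝ → ℝ} (hf : HD G d f f') (l : E →L[ℝ] ℝ)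
    (hl : ∀ x, ‖l x‖ ≤ ‖x‖) : HF G d (fun i x => f i (l x)) (fun i x => f' i (l x) • l) :=
  ((tendsto_nearF_lin G d hl).eventually hf).mono fun _ hz =>
    HasDerivAt.comp_hasFDerivAt _ hz l.hasFDerivAt

lemma eventually_hasFDerivAt {h : V → W} {c : V} (hh : ContDiffAt ℝ 1 h c) :
    ∀ᶠ y in 𝓝 c, HasFDerivAt h (fderiv ℝ h y) y :=
  (hh.eventually (by simp)).mono fun _ hy => (hy.differentiableAt (by simp)).hasFDerivAt

lemma eventually_continuousAt {h : V → W} {c : V} (hh : ContDiffAt ℝ 1 h c) :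
    ∀ᶠ y in 𝓝 c, ContinuousAt h y :=
  (hh.eventually (by simp)).mono fun _ hy => hy.continuousAt

lemma eventually_continuousAt_fderiv {h : V → W} {c : V} (hh : ContDiffAt ℝ 1 h c) :
    ∀ᶠ y in 𝓝 c, ContinuousAt (fderiv ℝ h) y :=
  (hh.eventually (by simp)).mono fun _ hy => hy.continuousAt_fderiv (by simp)

lemma CL.compC {f : ι → E → V} {c : V} {h : V → W} (hf : CL G d f c)
    (hh : ContDiffAt ℝ 1 h c) : CL G d (fun i x => h (f i x)) (h c) :=
  hf.comp (eventually_continuousAt hh)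

lemma CL.fderiv {f : ι → E → V} {c : V} {h : V → W} (hf : CL G d f c)
    (hh : ContDiffAt ℝ 1 h c) : CL G d (fun i x => fderiv ℝ h (f i x)) (fderiv ℝ h c) :=
  hf.comp (eventually_continuousAt_fderiv hh)

lemma HF.comp {f : ι → E → V} {f' : ι → E → E →L[ℝ] V} {c : V} {h : V → W}
    (hf : HF G d f f') (hc : CL G d f c) (hh : ContDiffAt ℝ 1 h c) :
    HF G d (fun i x => h (f i x)) (fun i x => (fderiv ℝ h (f i x)).comp (f' i x)) :=
  Eventually.mono (hf.and (hc.lim.eventually (eventually_hasFDerivAt hh)))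
    fun _ hz => hz.2.comp _ hz.1

lemma HD.comp {f f' : ι → ℝ → V} {c : V} {h : V → W}
    (hf : HD G d f f') (hc : CL G d f c) (hh : ContDiffAt ℝ 1 h c) :
    HD G d (fun i x => h (f i x)) (fun i x => fderiv ℝ h (f i x) (f' i x)) :=
  Eventually.mono (hf.and (hc.lim.eventually (eventually_hasFDerivAt hh)))
    fun _ hz => hz.2.comp_hasDerivAt _ hz.1

lemma cb_comp_deriv {f : ι → E → V} {f' : ι → E → E →L[ℝ] V} {c : V} {h : V → W} {g : ι → ℝ}
    (hc : CL G d f c) (hf' : CB G d f' g) (hh : ContDiffAt ℝ 1 h c) :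
    CB G d (fun i x => (fderiv ℝ h (f i x)).comp (f' i x)) g := by
  have h1 := (hc.fderiv hh).comp' (h := fun k => ContinuousLinearMap.compL ℝ E V W k) (by fun_prop)
  exact CB.clm_apply h1 hf'

/-- `fderiv h` as a function of base point and direction. -/
def tangentMap (h : V → W) (p : V × V) : W := _root_.fderiv ℝ h p.1 p.2

lemma contDiffAt_tangentMap {h : V → W} {c : V × V} (hh : ContDiffAt ℝ 2 h c.1) :
    ContDiffAt ℝ 1 (tangentMap h) c := by
  have h1 : ContDiffAt ℝ 1 (_root_.fderiv ℝ h) c.1 := hh.fderiv_right (by norm_num)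
  exact (h1.comp c contDiffAt_fst).clm_apply contDiffAt_snd

lemma Cont.forall {f : ι → E → V} (h : Cont G d f) :
    ∀ᶠ i in G, ∀ x : E, ‖x‖ < d i → ContinuousAt (f i) x := eventually_nearF.1 h

lemma HF.forall {f : ι → E → V} {f' : ι → E → E →L[ℝ] V} (h : HF G d f f') :
    ∀ᶠ i in G, ∀ x : E, ‖x‖ < d i → HasFDerivAt (f i) (f' i x) x := eventually_nearF.1 h

lemma HD.forall {f f' : ι → ℝ → V} (h : HD G d f f') :
    ∀ᶠ i in G, ∀ x : ℝ, ‖x‖ < d i → HasDerivAt (f i) (f' i x) x := eventually_nearF.1 h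

lemma CB.forall {f : ι → E → V} {g : ι → ℝ} (h : CB G d f g) :
    ∃ C > 0, ∀ᶠ i in G, ∀ x : E, ‖x‖ < d i → ‖f i x‖ ≤ C * ‖g i‖ := by
  obtain ⟨C, hC, h⟩ := h.bound.exists_pos
  exact ⟨C, hC, eventually_nearF.1 h.bound⟩

lemma tendsto_nearF_zero {f : ι → E → ℝ} {b : ι → ℝ} (hb : Tendsto b G (𝓝 0))
    (h : ∀ᶠ i in G, ∀ x : E, ‖x‖ < d i → ‖f i x‖ ≤ b i) :
    Tendsto (fun z : ι × E => f z.1 z.2) (nearF G d E) (𝓝 0) :=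
  squeeze_zero_norm' (eventually_nearF.2 h) (hb.comp (tendsto_fst_nearF G d))

lemma CB.segInt {f : ι → ℝ × ℝ → ℝ} {g : ι → ℝ} (hf : CB G d f g)
    (hg : Tendsto (fun i => d i * g i) G (𝓝 0)) : CL G d (fun i => segInt (f i)) 0 := by
  refine ⟨?_, ?_, Eventually.of_forall fun i => intervalIntegral.integral_same⟩
  · rw [Cont, eventually_nearF]
    filter_upwards [hf.cont.forall] with i hi x hx using continuousAt_segInt hi hx
  · obtain ⟨C, hC, h⟩ := hf.forall
    refine tendsto_nearF_zero (f := fun i => ShockInteraction.segInt (f i)) (b := fun i => 2 * C * ‖d i * g i‖) ?_ ?_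
    · simpa using hg.norm.const_mul (2 * C)
    · filter_upwards [h] with i hi x hx
      refine (abs_segInt_le hi hx).trans_eq ?_
      rw [norm_mul, Real.norm_of_nonneg ((norm_nonneg x).trans hx.le)]
      ring

lemma HF.segInt {f : ι → ℝ × ℝ → ℝ} {f' : ι → ℝ × ℝ → ℝ × ℝ →L[ℝ] ℝ} (hf : HF G d f f')
    (hf' : Cont G d f') :
    HF G d (fun i => segInt (f i)) (fun i => segIntDeriv (f i) (f' i)) := by
  rw [HF, eventually_nearF]
  filter_upwards [hf.forall, hf'.forall] with i hi hi' x hx using hasFDerivAt_segInt hi hi' hx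

lemma CL.segIntDeriv {f : ι → ℝ × ℝ → ℝ} {f' : ι → ℝ × ℝ → ℝ × ℝ →L[ℝ] ℝ} {c : ℝ} {g : ι → ℝ}
    (hf : CL G d f c) (hf' : CB G d f' g) (hg : Tendsto (fun i => d i * g i) G (𝓝 0)) :
    CL G d (fun i => segIntDeriv (f i) (f' i))
      ((-c) • ContinuousLinearMap.fst ℝ ℝ (ℝ × ℝ) +
        c • (ContinuousLinearMap.fst ℝ ℝ ℝ).comp (ContinuousLinearMap.snd ℝ ℝ (ℝ × ℝ)) +
        (0 : ℝ) •
          (ContinuousLinearMap.snd ℝ ℝ ℝ).comp (ContinuousLinearMap.snd ℝ ℝ (ℝ × ℝ))) := by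
  have h1 := hf.lin ((ContinuousLinearMap.fst ℝ ℝ (ℝ × ℝ)).prod
    ((ContinuousLinearMap.snd ℝ ℝ ℝ).comp (ContinuousLinearMap.snd ℝ ℝ (ℝ × ℝ)))) (fun x => by
      simp only [Prod.norm_def, ContinuousLinearMap.prod_apply, ContinuousLinearMap.comp_apply,
        ContinuousLinearMap.coe_fst', ContinuousLinearMap.coe_snd']
      exact max_le_max_left _ (le_max_right _ _))
  have h2 := hf.lin (ContinuousLinearMap.snd ℝ ℝ (ℝ × ℝ)) (fun x => le_max_right _ _)
  have h3 := (hf'.clm (ContinuousLinearMap.apply ℝ ℝ ((0, 1) : ℝ × ℝ))).segInt hg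
  exact ((h1.prodMk h2).prodMk h3).comp' (h := fun y : (ℝ × ℝ) × ℝ =>
    (-y.1.1) • ContinuousLinearMap.fst ℝ ℝ (ℝ × ℝ) +
      y.1.2 • (ContinuousLinearMap.fst ℝ ℝ ℝ).comp (ContinuousLinearMap.snd ℝ ℝ (ℝ × ℝ)) +
      y.2 • (ContinuousLinearMap.snd ℝ ℝ ℝ).comp (ContinuousLinearMap.snd ℝ ℝ (ℝ × ℝ)))
    (by fun_prop)

/-- The primitive of `f` vanishing at `0`. -/
def prim (f : ℝ → ℝ) (u : ℝ) : ℝ := ∫ x in (0 : ℝ)..u, f x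

lemma norm_le_of_mem_uIcc {u x : ℝ} (hx : x ∈ uIcc 0 u) : ‖x‖ ≤ ‖u‖ := by
  have := norm_seg_le (p := (0, u, 0)) (r := ‖u‖) (by simp [Prod.norm_def]) hx
  exact (le_max_left _ _).trans this

lemma Cont.prim {f : ι → ℝ → ℝ} (hf : Cont G d f) : HD G d (fun i => prim (f i)) f := by
  rw [HD, eventually_nearF]
  filter_upwards [hf.forall] with i hi x hx
  refine intervalIntegral.integral_hasDerivAt_right ?_ ?_ (hi x hx)
  · exact ContinuousOn.intervalIntegrable fun y hy =>
      (hi y ((norm_le_of_mem_uIcc hy).trans_lt hx)).continuousWithinAt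
  · exact ContinuousOn.stronglyMeasurableAtFilter (s := {x | ‖x‖ < d i})
      (isOpen_lt continuous_norm continuous_const) (fun y hy => (hi y hy).continuousWithinAt) _ hx

lemma CB.prim {f : ι → ℝ → ℝ} {g : ι → ℝ} (hf : CB G d f g)
    (hg : Tendsto (fun i => d i * g i) G (𝓝 0)) : CL G d (fun i => prim (f i)) 0 := by
  refine ⟨hf.cont.prim.cont, ?_, Eventually.of_forall fun i => intervalIntegral.integral_same⟩
  obtain ⟨C, hC, h⟩ := hf.forall
  refine tendsto_nearF_zero (f := fun i => ShockInteraction.prim (f i)) (b := fun i => C * ‖d i * g i‖) ?_ ?_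
  · simpa using hg.norm.const_mul C
  · filter_upwards [h] with i hi x hx
    have h1 := intervalIntegral.norm_integral_le_of_norm_le_const (a := 0) (b := x)
      (f := f i) (C := C * ‖g i‖)
      (fun y hy => hi y ((norm_le_of_mem_uIcc (uIoc_subset_uIcc hy)).trans_lt hx))
    refine h1.trans ?_
    have h2 : |x - 0| ≤ ‖d i‖ := by
      rw [sub_zero, Real.norm_of_nonneg ((norm_nonneg x).trans hx.le)]; exact hx.le
    rw [norm_mul, mul_comm ‖d i‖, ← mul_assoc]
    gcongr

lemma CL.of_deriv {f : ι → E → V} {f' : ι → E → E →L[ℝ] V} {c : V} {g : ι → ℝ} (hf : HF G d f f')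
    (hf' : CB G d f' g) (hg : Tendsto (fun i => d i * g i) G (𝓝 0))
    (h0 : ∀ᶠ i in G, f i 0 = c) : CL G d f c := by
  refine ⟨hf.cont, ?_, h0⟩
  rw [tendsto_iff_norm_sub_tendsto_zero]
  obtain ⟨C, hC, h⟩ := hf'.forall
  refine tendsto_nearF_zero (f := fun i x => ‖f i x - c‖) (b := fun i => C * ‖d i * g i‖) ?_ ?_
  · simpa using hg.norm.const_mul C
  · filter_upwards [h, hf.forall, h0] with i hi hfi hc x hx
    have hd : 0 < d i := (norm_nonneg x).trans_lt hx
    have h1 := (convex_ball (0 : E) (d i)).norm_image_sub_le_of_norm_hasFDerivWithin_le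
      (f := f i) (f' := f' i) (C := C * ‖g i‖) (x := 0) (y := x)
      (fun y hy => (hfi y (by simpa using hy)).hasFDerivWithinAt)
      (fun y hy => hi y (by simpa using hy)) (by simpa using hd) (by simpa using hx)
    rw [norm_norm, ← hc]
    refine h1.trans ?_
    rw [sub_zero, norm_mul, mul_comm ‖d i‖, ← mul_assoc]
    gcongr
    exact hx.le.trans (le_abs_self _)

lemma HD.toHF {f f' : ι → ℝ → V} (hf : HD G d f f') :
    HF G d f (fun i x => ContinuousLinearMap.toSpanSingletonCLE (f' i x)) :=
  Eventually.mono hf fun _ hz => hz.hasFDerivAt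

lemma CL.of_hd {f f' : ι → ℝ → V} {c : V} {g : ι → ℝ} (hf : HD G d f f')
    (hf' : CB G d f' g) (hg : Tendsto (fun i => d i * g i) G (𝓝 0))
    (h0 : ∀ᶠ i in G, f i 0 = c) : CL G d f c :=
  CL.of_deriv hf.toHF (hf'.clm (ContinuousLinearMap.toSpanSingletonCLE (𝕜 := ℝ) (E := V)
    : V →L[ℝ] ℝ →L[ℝ] V)) hg h0

lemma HF.add {f g : ι → E → V} {f' g' : ι → E → E →L[ℝ] V} (hf : HF G d f f')
    (hg : HF G d g g') : HF G d (fun i x => f i x + g i x) (fun i x => f' i x + g' i x) :=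
  Eventually.mono (hf.and hg) fun _ h => h.1.add h.2

lemma HF.mul {f g : ι → E → ℝ} {f' g' : ι → E → E →L[ℝ] ℝ} (hf : HF G d f f')
    (hg : HF G d g g') :
    HF G d (fun i x => f i x * g i x) (fun i x => f i x • g' i x + g i x • f' i x) :=
  Eventually.mono (hf.and hg) fun _ h => h.1.mul h.2

lemma CB.smul {k : ι → E → ℝ} {f : ι → E → V} {c : ℝ} {g : ι → ℝ}
    (hk : CL G d k c) (hf : CB G d f g) : CB G d (fun i x => k i x • f i x) g := by
  refine ⟨(hk.cont.and hf.cont).mono fun _ h => h.1.smul h.2, ?_⟩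
  simpa using (hk.lim.isBigO_one ℝ).smul hf.bound

lemma CB.smul_cl {k : ι → E → ℝ} {f : ι → E → V} {c : V} {g : ι → ℝ}
    (hk : CB G d k g) (hf : CL G d f c) : CB G d (fun i x => k i x • f i x) g := by
  refine ⟨(hk.cont.and hf.cont).mono fun _ h => h.1.smul h.2, ?_⟩
  simpa using hk.bound.smul (hf.lim.isBigO_one ℝ)

lemma HD.scale {f f' : ι → ℝ → ℝ} (hf : HD G d f f') {a : ℝ} (ha : |a| ≤ 1) :
    HD G d (fun i x => f i (a * x)) (fun i x => a * f' i (a * x)) := by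
  have h := hf.toHF.curve (a • ContinuousLinearMap.id ℝ ℝ) (fun x => by
    simpa [abs_mul] using mul_le_of_le_one_left (abs_nonneg x) ha)
  refine Eventually.mono h fun z hz => ?_
  simpa [mul_comm] using hz

/-- Rescaling of the real line. -/
def scaleL (a : ℝ) : ℝ →L[ℝ] ℝ := a • ContinuousLinearMap.id ℝ ℝ

lemma norm_scaleL_le {a : ℝ} (ha : |a| ≤ 1) (x : ℝ) : ‖scaleL a x‖ ≤ ‖x‖ := by
  simpa [scaleL, abs_mul] using mul_le_of_le_one_left (abs_nonneg x) ha

lemma CL.scale {f : ι → ℝ → V} {c : V} (hf : CL G d f c) {a : ℝ} (ha : |a| ≤ 1) :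
    CL G d (fun i x => f i (a * x)) c := hf.lin (scaleL a) (norm_scaleL_le ha)

lemma CB.scale {f : ι → ℝ → V} {g : ι → ℝ} (hf : CB G d f g) {a : ℝ} (ha : |a| ≤ 1) :
    CB G d (fun i x => f i (a * x)) g := hf.lin (scaleL a) (norm_scaleL_le ha)

lemma CB.segIntDeriv {f : ι → ℝ × ℝ → ℝ} {f' : ι → ℝ × ℝ → ℝ × ℝ →L[ℝ] ℝ} {g h : ι → ℝ}
    (hf : CB G d f g) (hg1 : ∀ i, 1 ≤ g i) (hf' : CB G d f' h)
    (hh : Tendsto (fun i => d i * h i) G (𝓝 0)) :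
    CB G d (fun i => segIntDeriv (f i) (f' i)) g := by
  have h1 := hf.lin ((ContinuousLinearMap.fst ℝ ℝ (ℝ × ℝ)).prod
    ((ContinuousLinearMap.snd ℝ ℝ ℝ).comp (ContinuousLinearMap.snd ℝ ℝ (ℝ × ℝ)))) (fun x => by
      simp only [Prod.norm_def, ContinuousLinearMap.prod_apply, ContinuousLinearMap.comp_apply,
        ContinuousLinearMap.coe_fst', ContinuousLinearMap.coe_snd']
      exact max_le_max_left _ (le_max_right _ _))
  have h2 := hf.lin (ContinuousLinearMap.snd ℝ ℝ (ℝ × ℝ)) (fun x => le_max_right _ _)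
  have h3 := ((hf'.clm (ContinuousLinearMap.apply ℝ ℝ ((0, 1) : ℝ × ℝ))).segInt hh).cb hg1
  have h4 := (h1.smul_cl (CL.const (-ContinuousLinearMap.fst ℝ ℝ (ℝ × ℝ)))).add
    (h2.smul_cl (CL.const
      ((ContinuousLinearMap.fst ℝ ℝ ℝ).comp (ContinuousLinearMap.snd ℝ ℝ (ℝ × ℝ)))))
  have h5 := h4.add (h3.smul_cl (CL.const
    ((ContinuousLinearMap.snd ℝ ℝ ℝ).comp (ContinuousLinearMap.snd ℝ ℝ (ℝ × ℝ)))))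
  simp only [smul_neg, ← neg_smul] at h5
  exact h5

/-- A linear form on the plane from its two components. -/
def coL : ℝ × ℝ →L[ℝ] ℝ × ℝ →L[ℝ] ℝ :=
  (ContinuousLinearMap.fst ℝ ℝ ℝ).smulRight (ContinuousLinearMap.fst ℝ ℝ ℝ) +
    (ContinuousLinearMap.snd ℝ ℝ ℝ).smulRight (ContinuousLinearMap.snd ℝ ℝ ℝ)

@[simp] lemma coL_apply (p q : ℝ × ℝ) : coL p q = p.1 * q.1 + p.2 * q.2 := by simp [coL]

lemma coL_ext {k : ℝ × ℝ →L[ℝ] ℝ} {p : ℝ × ℝ} (h1 : k (1, 0) = p.1) (h2 : k (0, 1) = p.2) :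
    k = coL p := by
  ext <;> simp [h1, h2]

end Families

section BaseState

variable (S : Setup)

lemma eta_pos {r : ℝ} (hr : 0 < r) : 0 < S.η r := by
  rw [S.hη r hr]; exact Real.sqrt_pos.2 (S.hp' r hr)

lemma η₀_pos : 0 < η₀ S := eta_pos S S.hρ₀

lemma eta_sq {r : ℝ} (hr : 0 < r) : deriv S.p r = S.η r ^ 2 := by
  rw [S.hη r hr, Real.sq_sqrt (S.hp' r hr).le]

lemma contDiffOn_eta : ContDiffOn ℝ ∞ S.η (Ioi 0) := by
  have h1 : ContDiffOn ℝ ∞ (deriv S.p) (Ioi 0) :=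
    ((contDiffOn_infty_iff_deriv_of_isOpen isOpen_Ioi).1 S.hp).2
  exact (h1.sqrt fun r hr => (S.hp' r hr).ne').congr S.hη

lemma contDiffOn_sigma : ContDiffOn ℝ ∞ S.σ (Ioi 0) := by
  rw [contDiffOn_infty_iff_deriv_of_isOpen isOpen_Ioi]
  refine ⟨fun r hr => (S.hσ r hr).differentiableAt.differentiableWithinAt, ?_⟩
  refine ((contDiffOn_eta S).div contDiffOn_id fun r hr => ne_of_gt hr).congr ?_
  exact fun r hr => (S.hσ r hr).deriv

lemma R_sigma {r : ℝ} (hr : 0 < r) : S.R (S.σ r) = r := by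
  have hmono : StrictMonoOn S.σ (Ioi 0) := by
    refine strictMonoOn_of_deriv_pos (convex_Ioi 0) (contDiffOn_sigma S).continuousOn ?_
    intro x hx
    rw [interior_Ioi] at hx
    rw [(S.hσ x hx).deriv]
    exact div_pos (eta_pos S hx) hx
  exact hmono.injOn (S.hRpos _) hr (S.hRσ _)

lemma contDiff_eta_R : ContDiff ℝ ∞ fun s => S.η (S.R s) := by
  rw [← contDiffOn_univ]
  exact (contDiffOn_eta S).comp S.hR.contDiffOn fun s _ => S.hRpos s

lemma hasDerivAt_R (s : ℝ) : HasDerivAt S.R (S.R s / S.η (S.R s)) s := by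
  have h1 : HasDerivAt S.R (deriv S.R s) s :=
    (S.hR.differentiable (by simp) s).hasDerivAt
  have h2 := (S.hσ _ (S.hRpos s)).comp s h1
  have h3 : S.σ ∘ S.R = id := funext S.hRσ
  rw [h3] at h2
  have h4 := h2.unique (hasDerivAt_id s)
  have hR := (S.hRpos s).ne'
  have hη := (eta_pos S (S.hRpos s)).ne'
  have h5 : deriv S.R s = S.R s / S.η (S.R s) := by
    field_simp at h4 ⊢
    linarith
  rwa [h5] at h1

lemma contDiff_ρf : ContDiff ℝ ∞ fun q : ℝ × ℝ => ρf S q.1 q.2 :=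
  S.hR.comp (by fun_prop : ContDiff ℝ ∞ fun q : ℝ × ℝ => (q.1 + q.2) / 2)

lemma contDiff_wf : ContDiff ℝ ∞ fun q : ℝ × ℝ => wf q.1 q.2 := by
  unfold wf; fun_prop

lemma contDiff_cin : ContDiff ℝ ∞ fun q : ℝ × ℝ => cin S q.1 q.2 :=
  contDiff_wf.sub ((contDiff_eta_R S).comp
    (by fun_prop : ContDiff ℝ ∞ fun q : ℝ × ℝ => (q.1 + q.2) / 2))

lemma contDiff_cout : ContDiff ℝ ∞ fun q : ℝ × ℝ => cout S q.1 q.2 :=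
  contDiff_wf.add ((contDiff_eta_R S).comp
    (by fun_prop : ContDiff ℝ ∞ fun q : ℝ × ℝ => (q.1 + q.2) / 2))

@[simp] lemma ρf_base : ρf S (β₀ S) (β₀ S) = S.ρ₀ := by
  rw [ρf, add_self_div_two, β₀, R_sigma S S.hρ₀]

@[simp] lemma wf_self (b : ℝ) : wf b b = 0 := by simp [wf]

@[simp] lemma cin_base : cin S (β₀ S) (β₀ S) = -η₀ S := by simp [cin, η₀]

@[simp] lemma cout_base : cout S (β₀ S) (β₀ S) = η₀ S := by simp [cout, η₀]

lemma ρf_of_invariants {r : ℝ} (hr : 0 < r) (w : ℝ) : ρf S (S.σ r + w) (S.σ r - w) = r := by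
  rw [ρf, show (S.σ r + w + (S.σ r - w)) / 2 = S.σ r by ring, R_sigma S hr]

lemma wf_of_invariants (s w : ℝ) : wf (s + w) (s - w) = w := by
  rw [wf]; ring

lemma ρst₁_pos : 0 < S.ρst₁ (0, 0) := S.hρst₁pos _ S.hD₁0

lemma ρst₂_pos : 0 < S.ρst₂ (0, 0) := S.hρst₂pos _ S.hD₂0

lemma ρf_ahead₁ : ρf S (αm₁₀ S) (βm₁₀ S) = S.ρst₁ (0, 0) := ρf_of_invariants S (ρst₁_pos S) _

lemma wf_ahead₁ : wf (αm₁₀ S) (βm₁₀ S) = S.wst₁ (0, 0) := wf_of_invariants _ _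

lemma ρf_ahead₂ : ρf S (αm₂₀ S) (βm₂₀ S) = S.ρst₂ (0, 0) := ρf_of_invariants S (ρst₂_pos S) _

lemma wf_ahead₂ : wf (αm₂₀ S) (βm₂₀ S) = S.wst₂ (0, 0) := wf_of_invariants _ _

lemma contDiffAt_sigma_comp {f : ℝ × ℝ → ℝ} (hf : ContDiff ℝ ∞ f) {q : ℝ × ℝ} (hq : 0 < f q) :
    ContDiffAt ℝ ∞ (fun q => S.σ (f q)) q :=
  ((contDiffOn_sigma S).contDiffAt (Ioi_mem_nhds hq)).comp q hf.contDiffAt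

lemma contDiffAt_αst₁ : ContDiffAt ℝ ∞ (αst₁ S) (0, 0) :=
  (contDiffAt_sigma_comp S S.hρst₁ (ρst₁_pos S)).add S.hwst₁.contDiffAt

lemma contDiffAt_βst₁ : ContDiffAt ℝ ∞ (βst₁ S) (0, 0) :=
  (contDiffAt_sigma_comp S S.hρst₁ (ρst₁_pos S)).sub S.hwst₁.contDiffAt

lemma contDiffAt_αst₂ : ContDiffAt ℝ ∞ (αst₂ S) (0, 0) :=
  (contDiffAt_sigma_comp S S.hρst₂ (ρst₂_pos S)).add S.hwst₂.contDiffAt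

lemma contDiffAt_βst₂ : ContDiffAt ℝ ∞ (βst₂ S) (0, 0) :=
  (contDiffAt_sigma_comp S S.hρst₂ (ρst₂_pos S)).sub S.hwst₂.contDiffAt

lemma jump_ne₁ : S.ρ₀ - S.ρst₁ (0, 0) ≠ 0 := by
  intro h
  have h1 := S.hjump₁V
  rw [h, zero_mul, eq_comm, neg_eq_zero, mul_eq_zero] at h1
  have hw : S.wst₁ (0, 0) = 0 := h1.resolve_left (ρst₁_pos S).ne'
  have h2 : S.ρ₀ = S.ρst₁ (0, 0) := sub_eq_zero.1 h
  have h3 := S.hdet₁l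
  have h4 := S.hdet₁r
  rw [hw, ← h2] at h4
  linarith

lemma jump_ne₂ : S.ρ₀ - S.ρst₂ (0, 0) ≠ 0 := by
  intro h
  have h1 := S.hjump₂V
  rw [h, zero_mul, eq_comm, neg_eq_zero, mul_eq_zero] at h1
  have hw : S.wst₂ (0, 0) = 0 := h1.resolve_left (ρst₂_pos S).ne'
  have h2 : S.ρ₀ = S.ρst₂ (0, 0) := sub_eq_zero.1 h
  have h3 := S.hdet₂l
  have h4 := S.hdet₂r
  rw [hw, ← h2] at h3
  linarith

lemma plus₁_pos : 0 < η₀ S + S.V₁₀ := by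
  have := S.hdet₁l
  unfold η₀
  linarith

lemma minus₁_pos : 0 < η₀ S - S.V₁₀ := by
  have := η₀_pos S
  linarith [S.hV₁₀neg]

lemma plus₂_pos : 0 < η₀ S + S.V₂₀ := by
  have := η₀_pos S
  linarith [S.hV₂₀pos]

lemma minus₂_pos : 0 < η₀ S - S.V₂₀ := by
  have := S.hdet₂r
  unfold η₀
  linarith

lemma ratio₁_pos : 0 < (η₀ S + S.V₁₀) / (η₀ S - S.V₁₀) := div_pos (plus₁_pos S) (minus₁_pos S)

lemma ratio₁_lt_one : (η₀ S + S.V₁₀) / (η₀ S - S.V₁₀) < 1 := by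
  rw [div_lt_one (minus₁_pos S)]; linarith [S.hV₁₀neg]

lemma ratio₂_pos : 0 < (η₀ S - S.V₂₀) / (η₀ S + S.V₂₀) := div_pos (minus₂_pos S) (plus₂_pos S)

lemma ratio₂_lt_one : (η₀ S - S.V₂₀) / (η₀ S + S.V₂₀) < 1 := by
  rw [div_lt_one (plus₂_pos S)]; linarith [S.hV₂₀pos]

lemma aconst_pos : 0 < aconst S := mul_pos (ratio₁_pos S) (ratio₂_pos S)

lemma aconst_lt_one : aconst S < 1 :=
  mul_lt_one_of_nonneg_of_lt_one_left (ratio₁_pos S).le (ratio₁_lt_one S) (ratio₂_lt_one S).le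

lemma Γ₀_eq : Γ₀ S = -((η₀ S + S.V₁₀) / (η₀ S - S.V₁₀)) := neg_div _ _

lemma Γ₀_ne : Γ₀ S ≠ 0 := by
  rw [Γ₀_eq]; exact neg_ne_zero.2 (ratio₁_pos S).ne'

lemma abs_F₁₀_lt : |F₁₀ S| < 1 := by
  rw [F₁₀, abs_neg, abs_pow, sq_lt_one_iff₀ (abs_nonneg _), add_comm, abs_of_pos (ratio₁_pos S)]
  exact ratio₁_lt_one S

lemma abs_F₂₀_lt : |F₂₀ S| < 1 := by
  rw [F₂₀, abs_neg, abs_pow, sq_lt_one_iff₀ (abs_nonneg _), add_comm, abs_of_pos (ratio₂_pos S)]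
  exact ratio₂_lt_one S

lemma abs_aconst : |aconst S| = aconst S := abs_of_pos (aconst_pos S)

lemma system_det_ne : 1 - aconst S * F₁₀ S * F₂₀ S ≠ 0 := by
  have h1 : |aconst S * F₁₀ S * F₂₀ S| < 1 := by
    rw [abs_mul, abs_mul, abs_aconst]
    refine mul_lt_one_of_nonneg_of_lt_one_left (mul_nonneg (aconst_pos S).le (abs_nonneg _)) ?_
      (abs_F₂₀_lt S).le
    exact mul_lt_one_of_nonneg_of_lt_one_left (aconst_pos S).le (aconst_lt_one S)
      (abs_F₁₀_lt S).le
  intro h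
  rw [← sub_eq_zero.1 h, abs_one] at h1
  exact lt_irrefl _ h1

lemma α₀'_eq : α₀' S = F₁₀ S * β₀' S + a₀ S := by
  have := system_det_ne S
  rw [α₀', β₀', div_eq_iff this, add_mul, mul_assoc, div_mul_cancel₀ _ this]
  ring

lemma β₀'_eq : β₀' S = aconst S * F₂₀ S * α₀' S + b₀ S := by
  have := system_det_ne S
  rw [α₀', β₀', div_eq_iff this, add_mul, mul_assoc _ _ (1 - _), div_mul_cancel₀ _ this]
  ring

/-- The jump function as a function of the quadruple of Riemann invariants. -/
def jumpFun (y : ℝ × ℝ × ℝ × ℝ) : ℝ := Jf S y.1 y.2.1 y.2.2.1 y.2.2.2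

lemma contDiff_jumpFun : ContDiff ℝ ∞ (jumpFun S) := by
  have hp : ContDiff ℝ ∞ fun s => S.p (S.R s) := by
    rw [← contDiffOn_univ]
    exact S.hp.comp S.hR.contDiffOn fun s _ => S.hRpos s
  have key : ∀ q R : ℝ → ℝ, ContDiff ℝ ∞ q → ContDiff ℝ ∞ R →
      ContDiff ℝ ∞ fun y : ℝ × ℝ × ℝ × ℝ =>
        (R ((y.1 + y.2.1) / 2) * ((y.1 - y.2.1) / 2) -
          R ((y.2.2.1 + y.2.2.2) / 2) * ((y.2.2.1 - y.2.2.2) / 2)) ^ 2 -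
        (R ((y.1 + y.2.1) / 2) * ((y.1 - y.2.1) / 2) ^ 2 + q ((y.1 + y.2.1) / 2) -
          R ((y.2.2.1 + y.2.2.2) / 2) * ((y.2.2.1 - y.2.2.2) / 2) ^ 2 -
          q ((y.2.2.1 + y.2.2.2) / 2)) *
        (R ((y.1 + y.2.1) / 2) - R ((y.2.2.1 + y.2.2.2) / 2)) := by
    intro q R hq hR
    fun_prop
  exact key (fun s => S.p (S.R s)) S.R hp S.hR

lemma jump_slices (y : ℝ × ℝ × ℝ × ℝ) :
    Jαp S y.1 y.2.1 y.2.2.1 y.2.2.2 = fderiv ℝ (jumpFun S) y (1, 0, 0, 0) ∧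
    Jβp S y.1 y.2.1 y.2.2.1 y.2.2.2 = fderiv ℝ (jumpFun S) y (0, 1, 0, 0) ∧
    Jαm S y.1 y.2.1 y.2.2.1 y.2.2.2 = fderiv ℝ (jumpFun S) y (0, 0, 1, 0) ∧
    Jβm S y.1 y.2.1 y.2.2.1 y.2.2.2 = fderiv ℝ (jumpFun S) y (0, 0, 0, 1) := by
  have h := ((contDiff_jumpFun S).differentiable (by simp) y).hasFDerivAt
  obtain ⟨y1, y2, y3, y4⟩ := y
  refine ⟨?_, ?_, ?_, ?_⟩
  · exact (h.comp_hasDerivAt y1 ((hasDerivAt_id y1).prodMk ((hasDerivAt_const y1 y2).prodMk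
      ((hasDerivAt_const y1 y3).prodMk (hasDerivAt_const y1 y4))))).deriv
  · exact (h.comp_hasDerivAt y2 ((hasDerivAt_const y2 y1).prodMk ((hasDerivAt_id y2).prodMk
      ((hasDerivAt_const y2 y3).prodMk (hasDerivAt_const y2 y4))))).deriv
  · exact (h.comp_hasDerivAt y3 ((hasDerivAt_const y3 y1).prodMk ((hasDerivAt_const y3 y2).prodMk
      ((hasDerivAt_id y3).prodMk (hasDerivAt_const y3 y4))))).deriv
  · exact (h.comp_hasDerivAt y4 ((hasDerivAt_const y4 y1).prodMk ((hasDerivAt_const y4 y2).prodMk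
      ((hasDerivAt_const y4 y3).prodMk (hasDerivAt_id y4))))).deriv

lemma fderiv_jumpFun (y v : ℝ × ℝ × ℝ × ℝ) : fderiv ℝ (jumpFun S) y v =
    Jαp S y.1 y.2.1 y.2.2.1 y.2.2.2 * v.1 + Jβp S y.1 y.2.1 y.2.2.1 y.2.2.2 * v.2.1 +
    Jαm S y.1 y.2.1 y.2.2.1 y.2.2.2 * v.2.2.1 + Jβm S y.1 y.2.1 y.2.2.1 y.2.2.2 * v.2.2.2 := by
  obtain ⟨h1, h2, h3, h4⟩ := jump_slices S y
  rw [h1, h2, h3, h4]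
  have hv : v = v.1 • (1, 0, 0, 0) + v.2.1 • (0, 1, 0, 0) + v.2.2.1 • (0, 0, 1, 0) +
      v.2.2.2 • ((0, 0, 0, 1) : ℝ × ℝ × ℝ × ℝ) := by
    ext <;> simp
  conv_lhs => rw [hv]
  simp only [map_add, map_smul, smul_eq_mul]
  ring

/-- The derivative of the jump function in the state behind, at the base state. -/
lemma hasDerivAt_jump_behind {ρm wm V e : ℝ} {ap bp : ℝ → ℝ} {am bm : ℝ}
    (hρ : ρf S am bm = ρm) (hw : wf am bm = wm)
    (h1 : (S.ρ₀ - ρm) * V = -(ρm * wm))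
    (h2 : (-(ρm * wm)) * V = S.p S.ρ₀ - (ρm * wm ^ 2 + S.p ρm))
    (ha : HasDerivAt (fun s => (ap s + bp s) / 2) (1 / 2) (β₀ S))
    (hb : HasDerivAt (fun s => (ap s - bp s) / 2) (e / 2) (β₀ S)) (he : e ^ 2 = 1)
    (hap : ap (β₀ S) = β₀ S) (hbp : bp (β₀ S) = β₀ S) :
    HasDerivAt (fun s => Jf S (ap s) (bp s) am bm)
      (-(S.ρ₀ - ρm) * S.ρ₀ / (2 * η₀ S) * (η₀ S - e * V) ^ 2) (β₀ S) := by
  have hη := (η₀_pos S).ne'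
  have hR : HasDerivAt (fun s => ρf S (ap s) (bp s)) (S.ρ₀ / η₀ S * (1 / 2)) (β₀ S) := by
    have := (hasDerivAt_R S ((ap (β₀ S) + bp (β₀ S)) / 2)).comp (β₀ S) ha
    rw [hap, hbp, add_self_div_two] at this
    have h3 : S.R (β₀ S) = S.ρ₀ := R_sigma S S.hρ₀
    rwa [h3] at this
  have hρ0 : ρf S (ap (β₀ S)) (bp (β₀ S)) = S.ρ₀ := by rw [hap, hbp, ρf_base]
  have hw0 : wf (ap (β₀ S)) (bp (β₀ S)) = 0 := by rw [hap, hbp, wf_self]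
  have hW : HasDerivAt (fun s => wf (ap s) (bp s)) (e / 2) (β₀ S) := hb
  have hp : HasDerivAt S.p (η₀ S ^ 2) (ρf S (ap (β₀ S)) (bp (β₀ S))) := by
    rw [hρ0, η₀, ← eta_sq S S.hρ₀]
    exact ((S.hp.contDiffAt (Ioi_mem_nhds S.hρ₀)).differentiableAt (by simp)).hasDerivAt
  have hP := hp.comp (β₀ S) hR
  have h := (((hR.mul hW).sub_const (ρf S am bm * wf am bm)).pow 2).sub
    (((((hR.mul (hW.pow 2)).add hP).sub_const (ρf S am bm * wf am bm ^ 2)).sub_const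
      (S.p (ρf S am bm))).mul (hR.sub_const (ρf S am bm)))
  refine h.congr_deriv ?_
  simp only [Pi.mul_apply, Pi.add_apply, Pi.pow_apply, Function.comp_apply, hρ0, hw0,
    hρ, hw]
  have h3 : S.p S.ρ₀ - ρm * wm ^ 2 - S.p ρm = (S.ρ₀ - ρm) * V * V := by rw [h1]; linarith
  have h4 : ρm * wm = -((S.ρ₀ - ρm) * V) := by linarith
  have h5 : S.ρ₀ * 0 ^ 2 + S.p S.ρ₀ - ρm * wm ^ 2 - S.p ρm = (S.ρ₀ - ρm) * V * V := by
    rw [← h3]; ring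
  rw [h4]
  have h6 : ∀ k : ℝ, (S.ρ₀ * 0 ^ 2 + S.p S.ρ₀ - ρm * wm ^ 2 - S.p ρm) * k
    = (S.ρ₀ - ρm) * V * V * k := fun k => by rw [h5]
  rw [h6]
  field_simp
  norm_num
  linear_combination S.ρ₀ * (S.ρ₀ - ρm) * V ^ 2 * he

lemma Jαp_base {ρm wm V : ℝ} {am bm : ℝ} (hρ : ρf S am bm = ρm) (hw : wf am bm = wm)
    (h1 : (S.ρ₀ - ρm) * V = -(ρm * wm))
    (h2 : (-(ρm * wm)) * V = S.p S.ρ₀ - (ρm * wm ^ 2 + S.p ρm)) :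
    Jαp S (β₀ S) (β₀ S) am bm = -(S.ρ₀ - ρm) * S.ρ₀ / (2 * η₀ S) * (η₀ S - V) ^ 2 := by
  have := (hasDerivAt_jump_behind S (e := 1) (ap := fun s => s) (bp := fun _ => β₀ S) hρ hw h1 h2
    (((hasDerivAt_id _).add_const _).div_const 2) (((hasDerivAt_id _).sub_const _).div_const 2)
    (by norm_num) rfl rfl).deriv
  rw [one_mul] at this
  exact this

lemma Jβp_base {ρm wm V : ℝ} {am bm : ℝ} (hρ : ρf S am bm = ρm) (hw : wf am bm = wm)
    (h1 : (S.ρ₀ - ρm) * V = -(ρm * wm))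
    (h2 : (-(ρm * wm)) * V = S.p S.ρ₀ - (ρm * wm ^ 2 + S.p ρm)) :
    Jβp S (β₀ S) (β₀ S) am bm = -(S.ρ₀ - ρm) * S.ρ₀ / (2 * η₀ S) * (η₀ S + V) ^ 2 := by
  have := (hasDerivAt_jump_behind S (e := -1) (ap := fun _ => β₀ S) (bp := fun s => s) hρ hw h1 h2
    (((hasDerivAt_id _).const_add _).div_const 2) (((hasDerivAt_id _).const_sub _).div_const 2)
    (by norm_num) rfl rfl).deriv
  rw [neg_one_mul, sub_neg_eq_add] at this
  exact this

lemma Jαp₁ : Jαp S (β₀ S) (β₀ S) (αm₁₀ S) (βm₁₀ S) =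
    -(S.ρ₀ - S.ρst₁ (0, 0)) * S.ρ₀ / (2 * η₀ S) * (η₀ S - S.V₁₀) ^ 2 :=
  Jαp_base S (ρf_ahead₁ S) (wf_ahead₁ S) S.hjump₁V S.hjump₁M

lemma Jβp₁ : Jβp S (β₀ S) (β₀ S) (αm₁₀ S) (βm₁₀ S) =
    -(S.ρ₀ - S.ρst₁ (0, 0)) * S.ρ₀ / (2 * η₀ S) * (η₀ S + S.V₁₀) ^ 2 :=
  Jβp_base S (ρf_ahead₁ S) (wf_ahead₁ S) S.hjump₁V S.hjump₁M

lemma Jαp₂ : Jαp S (β₀ S) (β₀ S) (αm₂₀ S) (βm₂₀ S) =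
    -(S.ρ₀ - S.ρst₂ (0, 0)) * S.ρ₀ / (2 * η₀ S) * (η₀ S - S.V₂₀) ^ 2 :=
  Jαp_base S (ρf_ahead₂ S) (wf_ahead₂ S) S.hjump₂V S.hjump₂M

lemma Jβp₂ : Jβp S (β₀ S) (β₀ S) (αm₂₀ S) (βm₂₀ S) =
    -(S.ρ₀ - S.ρst₂ (0, 0)) * S.ρ₀ / (2 * η₀ S) * (η₀ S + S.V₂₀) ^ 2 :=
  Jβp_base S (ρf_ahead₂ S) (wf_ahead₂ S) S.hjump₂V S.hjump₂M

lemma jump_factor_ne {k : ℝ} (hk : k ≠ 0) : -k * S.ρ₀ / (2 * η₀ S) ≠ 0 := by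
  exact div_ne_zero (mul_ne_zero (neg_ne_zero.2 hk) S.hρ₀.ne')
    (mul_ne_zero two_ne_zero (η₀_pos S).ne')

lemma Jαp₁_ne : Jαp S (β₀ S) (β₀ S) (αm₁₀ S) (βm₁₀ S) ≠ 0 := by
  rw [Jαp₁]
  exact mul_ne_zero (jump_factor_ne S (jump_ne₁ S)) (pow_ne_zero 2 (minus₁_pos S).ne')

lemma Jβp₂_ne : Jβp S (β₀ S) (β₀ S) (αm₂₀ S) (βm₂₀ S) ≠ 0 := by
  rw [Jβp₂]
  exact mul_ne_zero (jump_factor_ne S (jump_ne₂ S)) (pow_ne_zero 2 (plus₂_pos S).ne')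

lemma F₁₀_eq : -Jβp S (β₀ S) (β₀ S) (αm₁₀ S) (βm₁₀ S) / Jαp S (β₀ S) (β₀ S) (αm₁₀ S) (βm₁₀ S) =
    F₁₀ S := by
  rw [Jβp₁, Jαp₁, ← mul_neg, mul_div_mul_left _ _ (jump_factor_ne S (jump_ne₁ S)), F₁₀, div_pow,
    neg_div, add_comm]

lemma F₂₀_eq : -Jαp S (β₀ S) (β₀ S) (αm₂₀ S) (βm₂₀ S) / Jβp S (β₀ S) (β₀ S) (αm₂₀ S) (βm₂₀ S) =
    F₂₀ S := by
  rw [Jβp₂, Jαp₂, ← mul_neg, mul_div_mul_left _ _ (jump_factor_ne S (jump_ne₂ S)), F₂₀, div_pow,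
    neg_div, add_comm S.V₂₀]

lemma fderiv_eq_pu_pv {f : ℝ × ℝ → ℝ} {q : ℝ × ℝ} (hf : DifferentiableAt ℝ f q) (v : ℝ × ℝ) :
    fderiv ℝ f q v = pu f q * v.1 + pv f q * v.2 := by
  obtain ⟨x, y⟩ := q
  have h1 : pu f (x, y) = fderiv ℝ f (x, y) (1, 0) :=
    (hf.hasFDerivAt.comp_hasDerivAt x ((hasDerivAt_id x).prodMk (hasDerivAt_const x y))).deriv
  have h2 : pv f (x, y) = fderiv ℝ f (x, y) (0, 1) :=
    (hf.hasFDerivAt.comp_hasDerivAt y ((hasDerivAt_const y x).prodMk (hasDerivAt_id y))).deriv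
  have hv : v = v.1 • (1, 0) + v.2 • ((0, 1) : ℝ × ℝ) := by ext <;> simp
  rw [h1, h2]
  conv_lhs => rw [hv]
  simp only [map_add, map_smul, smul_eq_mul]
  ring

end BaseState

section Implicit

variable (T : IterSetup)

lemma fderiv_H₁ (v : ℝ × ℝ × ℝ) :
    fderiv ℝ T.H₁ (β₀ T.toSetup, αm₁₀ T.toSetup, βm₁₀ T.toSetup) v =
      F₁₀ T.toSetup * v.1 + M₁₁₀ T.toSetup * v.2.1 + M₁₂₀ T.toSetup * v.2.2 := by
  set y₀ := (β₀ T.toSetup, αm₁₀ T.toSetup, βm₁₀ T.toSetup) with hy₀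
  have hU : T.U₁ ∈ 𝓝 y₀ := T.hU₁.mem_nhds T.hU₁mem
  have h1 := ((T.hH₁.contDiffAt hU).differentiableAt (by simp)).hasFDerivAt
  have h2 := ((contDiff_jumpFun T.toSetup).differentiable (by simp) (T.H₁ y₀, y₀)).hasFDerivAt
  have h3 := HasFDerivAt.comp (f := fun y => (T.H₁ y, y)) y₀ h2 (h1.prodMk (hasFDerivAt_id y₀))
  have h4 := h3.unique ((hasFDerivAt_const (0 : ℝ) y₀).congr_of_eventuallyEq
    (mem_of_superset hU fun y hy => T.hH₁J y hy))
  have h5 := DFunLike.congr_fun h4 v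
  simp only [ContinuousLinearMap.comp_apply, ContinuousLinearMap.prod_apply, fderiv_jumpFun,
    zero_apply, ContinuousLinearMap.id_apply] at h5
  have hval : T.H₁ y₀ = β₀ T.toSetup := T.hH₁val
  rw [hval] at h5
  simp only [hy₀] at h5 ⊢
  have hne := Jαp₁_ne T.toSetup
  rw [← F₁₀_eq, M₁₁₀, M₁₂₀]
  field_simp
  linear_combination h5

lemma fderiv_H₂ (v : ℝ × ℝ × ℝ) :
    fderiv ℝ T.H₂ (β₀ T.toSetup, αm₂₀ T.toSetup, βm₂₀ T.toSetup) v =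
      F₂₀ T.toSetup * v.1 + M₂₁₀ T.toSetup * v.2.1 + M₂₂₀ T.toSetup * v.2.2 := by
  set y₀ := (β₀ T.toSetup, αm₂₀ T.toSetup, βm₂₀ T.toSetup) with hy₀
  have hU : T.U₂ ∈ 𝓝 y₀ := T.hU₂.mem_nhds T.hU₂mem
  have h1 := ((T.hH₂.contDiffAt hU).differentiableAt (by simp)).hasFDerivAt
  have h2 := ((contDiff_jumpFun T.toSetup).differentiable (by simp)
    (y₀.1, T.H₂ y₀, y₀.2)).hasFDerivAt
  have h3 := h2.comp y₀ ((hasFDerivAt_fst (p := y₀)).prodMk (h1.prodMk (hasFDerivAt_snd (p := y₀))))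
  have h4 := h3.unique ((hasFDerivAt_const (0 : ℝ) y₀).congr_of_eventuallyEq
    (mem_of_superset hU fun y hy => T.hH₂J y hy))
  have h5 := DFunLike.congr_fun h4 v
  simp only [ContinuousLinearMap.comp_apply, ContinuousLinearMap.prod_apply, fderiv_jumpFun,
    zero_apply, ContinuousLinearMap.coe_fst', ContinuousLinearMap.coe_snd'] at h5
  have hval : T.H₂ y₀ = β₀ T.toSetup := T.hH₂val
  rw [hval] at h5
  simp only [hy₀] at h5 ⊢
  have hne := Jβp₂_ne T.toSetup
  rw [← F₂₀_eq, M₂₁₀, M₂₂₀]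
  field_simp
  linear_combination h5

end Implicit

lemma two_le_infty : (2 : WithTop ℕ∞) ≤ ((⊤ : ℕ∞) : WithTop ℕ∞) :=
  WithTop.coe_le_coe.2 (le_top (a := (2 : ℕ∞)))

section FixedFunctions

variable (S : Setup)

/-- The reciprocal incoming characteristic speed. -/
def recipIn (q : ℝ × ℝ) : ℝ := (cin S q.1 q.2)⁻¹

/-- The reciprocal outgoing characteristic speed. -/
def recipOut (q : ℝ × ℝ) : ℝ := (cout S q.1 q.2)⁻¹

lemma contDiffAt_recipIn : ContDiffAt ℝ 1 (recipIn S) (β₀ S, β₀ S) :=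
  ((contDiff_cin S).contDiffAt.inv (by simpa using (η₀_pos S).ne')).of_le (by simp)

lemma contDiffAt_recipOut : ContDiffAt ℝ 2 (recipOut S) (β₀ S, β₀ S) :=
  ((contDiff_cout S).contDiffAt.inv (by simpa using (η₀_pos S).ne')).of_le
    (two_le_infty)

/-- The source term `μ x_u + ν x_v` as a function of the Riemann invariants, their derivatives,
and the derivatives of `x`. -/
def sourceFun (y : (ℝ × ℝ) × (ℝ × ℝ) × ℝ × ℝ) : ℝ :=
  (1 / (cout S y.1.1 y.1.2 - cin S y.1.1 y.1.2)) * (cout S y.1.1 y.1.2 / cin S y.1.1 y.1.2) *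
      tangentMap (fun q : ℝ × ℝ => cin S q.1 q.2) (y.1, (0, y.2.1.2)) * y.2.2.1 +
    -((1 / (cout S y.1.1 y.1.2 - cin S y.1.1 y.1.2)) * (cin S y.1.1 y.1.2 / cout S y.1.1 y.1.2) *
      tangentMap (fun q : ℝ × ℝ => cout S q.1 q.2) (y.1, (y.2.1.1, 0))) * y.2.2.2

lemma contDiffAt_sourceFun (p : ℝ × ℝ) (r : ℝ × ℝ) :
    ContDiffAt ℝ 1 (sourceFun S) ((β₀ S, β₀ S), p, r) := by
  have hη := η₀_pos S
  have hin : ContDiffAt ℝ 1 (fun y : (ℝ × ℝ) × (ℝ × ℝ) × ℝ × ℝ => cin S y.1.1 y.1.2)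
      ((β₀ S, β₀ S), p, r) :=
    (((contDiff_cin S).comp contDiff_fst).contDiffAt).of_le (by simp)
  have hout : ContDiffAt ℝ 1 (fun y : (ℝ × ℝ) × (ℝ × ℝ) × ℝ × ℝ => cout S y.1.1 y.1.2)
      ((β₀ S, β₀ S), p, r) :=
    (((contDiff_cout S).comp contDiff_fst).contDiffAt).of_le (by simp)
  have h1 := (contDiffAt_const (c := (1 : ℝ))).div (hout.sub hin) (by simp; linarith)
  have h2 := hout.div hin (by simpa using hη.ne')
  have h3 := hin.div hout (by simpa using hη.ne')
  have h4 : ContDiffAt ℝ 1 (fun y : (ℝ × ℝ) × (ℝ × ℝ) × ℝ × ℝ =>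
      tangentMap (fun q : ℝ × ℝ => cin S q.1 q.2) (y.1, (0, y.2.1.2))) ((β₀ S, β₀ S), p, r) :=
    ContDiffAt.comp (f := fun y : (ℝ × ℝ) × (ℝ × ℝ) × ℝ × ℝ => (y.1, ((0 : ℝ), y.2.1.2))) _
      (contDiffAt_tangentMap ((contDiff_cin S).contDiffAt.of_le (two_le_infty)))
      (by fun_prop)
  have h5 : ContDiffAt ℝ 1 (fun y : (ℝ × ℝ) × (ℝ × ℝ) × ℝ × ℝ =>
      tangentMap (fun q : ℝ × ℝ => cout S q.1 q.2) (y.1, (y.2.1.1, 0))) ((β₀ S, β₀ S), p, r) :=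
    ContDiffAt.comp (f := fun y : (ℝ × ℝ) × (ℝ × ℝ) × ℝ × ℝ => (y.1, (y.2.1.1, (0 : ℝ)))) _
      (contDiffAt_tangentMap ((contDiff_cout S).contDiffAt.of_le (two_le_infty)))
      (by fun_prop)
  exact (((h1.mul h2).mul h4).mul (by fun_prop)).add (((h1.mul h3).mul h5).neg.mul (by fun_prop))

/-- The shock speed `[ρw]/[ρ]` as a function of the states on both sides. -/
def shockSpeed (ap bp am bm : ℝ) : ℝ :=
  (ρf S ap bp * wf ap bp - ρf S am bm * wf am bm) / (ρf S ap bp - ρf S am bm)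

/-- The coefficient `Γ¹` as a function of `(α₊, β₊)` and the position of the left shock. -/
def gammaL (y : (ℝ × ℝ) × ℝ × ℝ) : ℝ :=
  (cout S y.1.1 y.1.2 / cin S y.1.1 y.1.2) *
    ((shockSpeed S y.1.1 y.1.2 (αst₁ S y.2) (βst₁ S y.2) - cin S y.1.1 y.1.2) /
      (cout S y.1.1 y.1.2 - shockSpeed S y.1.1 y.1.2 (αst₁ S y.2) (βst₁ S y.2)))

/-- The coefficient `Γ²` as a function of `(α₊, β₊)` and the position of the right shock. -/
def gammaR (y : (ℝ × ℝ) × ℝ × ℝ) : ℝ :=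
  aconst S * (cout S y.1.1 y.1.2 / cin S y.1.1 y.1.2) *
    ((shockSpeed S y.1.1 y.1.2 (αst₂ S y.2) (βst₂ S y.2) - cin S y.1.1 y.1.2) /
      (cout S y.1.1 y.1.2 - shockSpeed S y.1.1 y.1.2 (αst₂ S y.2) (βst₂ S y.2)))

lemma shockSpeed₁ : shockSpeed S (β₀ S) (β₀ S) (αst₁ S (0, 0)) (βst₁ S (0, 0)) = S.V₁₀ := by
  have h1 := ρf_ahead₁ S
  have h2 := wf_ahead₁ S
  rw [αm₁₀, βm₁₀] at h1 h2
  rw [shockSpeed, h1, h2, ρf_base, wf_self, mul_zero, zero_sub, ← S.hjump₁V,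
    mul_div_cancel_left₀ _ (jump_ne₁ S)]

lemma shockSpeed₂ : shockSpeed S (β₀ S) (β₀ S) (αst₂ S (0, 0)) (βst₂ S (0, 0)) = S.V₂₀ := by
  have h1 := ρf_ahead₂ S
  have h2 := wf_ahead₂ S
  rw [αm₂₀, βm₂₀] at h1 h2
  rw [shockSpeed, h1, h2, ρf_base, wf_self, mul_zero, zero_sub, ← S.hjump₂V,
    mul_div_cancel_left₀ _ (jump_ne₂ S)]

lemma contDiffAt_shockSpeed {α β : ℝ × ℝ → ℝ} (hα : ContDiffAt ℝ 1 α (0, 0))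
    (hβ : ContDiffAt ℝ 1 β (0, 0)) (hne : S.ρ₀ - ρf S (α (0, 0)) (β (0, 0)) ≠ 0) :
    ContDiffAt ℝ 1 (fun y : (ℝ × ℝ) × ℝ × ℝ => shockSpeed S y.1.1 y.1.2 (α y.2) (β y.2))
      ((β₀ S, β₀ S), 0, 0) := by
  have e1 : ContDiffAt ℝ 1 (fun y : (ℝ × ℝ) × ℝ × ℝ => α y.2) ((β₀ S, β₀ S), 0, 0) :=
    ContDiffAt.comp (g := α) _ hα contDiffAt_snd
  have e2 : ContDiffAt ℝ 1 (fun y : (ℝ × ℝ) × ℝ × ℝ => β y.2) ((β₀ S, β₀ S), 0, 0) :=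
    ContDiffAt.comp (g := β) _ hβ contDiffAt_snd
  have r1 : ContDiffAt ℝ 1 (fun y : (ℝ × ℝ) × ℝ × ℝ => ρf S y.1.1 y.1.2) ((β₀ S, β₀ S), 0, 0) :=
    (((contDiff_ρf S).comp contDiff_fst).contDiffAt).of_le (by simp)
  have w1 : ContDiffAt ℝ 1 (fun y : (ℝ × ℝ) × ℝ × ℝ => wf y.1.1 y.1.2) ((β₀ S, β₀ S), 0, 0) :=
    ((contDiff_wf.comp contDiff_fst).contDiffAt).of_le (by simp)
  have r2 : ContDiffAt ℝ 1 (fun y : (ℝ × ℝ) × ℝ × ℝ => ρf S (α y.2) (β y.2))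
      ((β₀ S, β₀ S), 0, 0) :=
    ContDiffAt.comp (g := fun q : ℝ × ℝ => ρf S q.1 q.2) _
      ((contDiff_ρf S).contDiffAt.of_le (by simp)) (e1.prodMk e2)
  have w2 : ContDiffAt ℝ 1 (fun y : (ℝ × ℝ) × ℝ × ℝ => wf (α y.2) (β y.2))
      ((β₀ S, β₀ S), 0, 0) :=
    ContDiffAt.comp (g := fun q : ℝ × ℝ => wf q.1 q.2) _
      (contDiff_wf.contDiffAt.of_le (by simp)) (e1.prodMk e2)
  exact ((r1.mul w1).sub (r2.mul w2)).div (r1.sub r2) (by simpa using hne)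

lemma gammaL_base : gammaL S ((β₀ S, β₀ S), 0, 0) = Γ₀ S := by
  have h := shockSpeed₁ S
  have hη := (η₀_pos S).ne'
  simp only [gammaL, cin_base, cout_base]
  rw [show ((0, 0) : ℝ × ℝ) = 0 from rfl] at h
  simp only [Prod.mk_zero_zero, h, Γ₀]
  rw [div_neg, div_self hη]
  ring

lemma gammaR_base : gammaR S ((β₀ S, β₀ S), 0, 0) = Γ₀ S := by
  have h := shockSpeed₂ S
  have hη := (η₀_pos S).ne'
  have h1 := (plus₁_pos S).ne'
  have h2 := (minus₁_pos S).ne'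
  have h3 := (plus₂_pos S).ne'
  have h4 := (minus₂_pos S).ne'
  simp only [gammaR, cin_base, cout_base]
  rw [show ((0, 0) : ℝ × ℝ) = 0 from rfl] at h
  simp only [Prod.mk_zero_zero, h, Γ₀, aconst]
  rw [div_neg, div_self hη, sub_neg_eq_add, add_comm S.V₂₀]
  field_simp

lemma contDiffAt_gammaL : ContDiffAt ℝ 1 (gammaL S) ((β₀ S, β₀ S), 0, 0) := by
  have hη := η₀_pos S
  have hne := jump_ne₁ S
  have hV := contDiffAt_shockSpeed S ((contDiffAt_αst₁ S).of_le (by simp))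
    ((contDiffAt_βst₁ S).of_le (by simp)) (by rw [← ρf_ahead₁] at hne; exact hne)
  have hin : ContDiffAt ℝ 1 (fun y : (ℝ × ℝ) × ℝ × ℝ => cin S y.1.1 y.1.2)
      ((β₀ S, β₀ S), 0, 0) :=
    (((contDiff_cin S).comp contDiff_fst).contDiffAt).of_le (by simp)
  have hout : ContDiffAt ℝ 1 (fun y : (ℝ × ℝ) × ℝ × ℝ => cout S y.1.1 y.1.2)
      ((β₀ S, β₀ S), 0, 0) :=
    (((contDiff_cout S).comp contDiff_fst).contDiffAt).of_le (by simp)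
  refine (hout.div hin (by simpa using hη.ne')).mul ((hV.sub hin).div (hout.sub hV) ?_)
  have h := shockSpeed₁ S
  simpa [h] using (minus₁_pos S).ne'

lemma contDiffAt_gammaR : ContDiffAt ℝ 1 (gammaR S) ((β₀ S, β₀ S), 0, 0) := by
  have hη := η₀_pos S
  have hne := jump_ne₂ S
  have hV := contDiffAt_shockSpeed S ((contDiffAt_αst₂ S).of_le (by simp))
    ((contDiffAt_βst₂ S).of_le (by simp)) (by rw [← ρf_ahead₂] at hne; exact hne)
  have hin : ContDiffAt ℝ 1 (fun y : (ℝ × ℝ) × ℝ × ℝ => cin S y.1.1 y.1.2)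
      ((β₀ S, β₀ S), 0, 0) :=
    (((contDiff_cin S).comp contDiff_fst).contDiffAt).of_le (by simp)
  have hout : ContDiffAt ℝ 1 (fun y : (ℝ × ℝ) × ℝ × ℝ => cout S y.1.1 y.1.2)
      ((β₀ S, β₀ S), 0, 0) :=
    (((contDiff_cout S).comp contDiff_fst).contDiffAt).of_le (by simp)
  refine (contDiffAt_const.mul (hout.div hin (by simpa using hη.ne'))).mul
    ((hV.sub hin).div (hout.sub hV) ?_)
  have h := shockSpeed₂ S
  simpa [h] using (minus₂_pos S).ne'

end FixedFunctions

section Reflection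

variable (T : IterSetup)

/-- The invariant `α` behind the left shock, given `β` behind it and its position. -/
def behindL (y : ℝ × ℝ × ℝ) : ℝ := T.H₁ (y.1, αst₁ T.toSetup y.2, βst₁ T.toSetup y.2)

/-- The invariant `β` behind the right shock, given `α` behind it and its position. -/
def behindR (y : ℝ × ℝ × ℝ) : ℝ := T.H₂ (y.1, αst₂ T.toSetup y.2, βst₂ T.toSetup y.2)

lemma behindL_base : behindL T (β₀ T.toSetup, 0, 0) = β₀ T.toSetup := T.hH₁val

lemma behindR_base : behindR T (β₀ T.toSetup, 0, 0) = β₀ T.toSetup := T.hH₂val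

lemma contDiffAt_comp_ahead {n : ℕ∞} {H : ℝ × ℝ × ℝ → ℝ} {α β : ℝ × ℝ → ℝ} {b : ℝ}
    (hH : ContDiffAt ℝ n H (b, α (0, 0), β (0, 0))) (hα : ContDiffAt ℝ n α (0, 0))
    (hβ : ContDiffAt ℝ n β (0, 0)) :
    ContDiffAt ℝ n (fun y : ℝ × ℝ × ℝ => H (y.1, α y.2, β y.2)) (b, 0, 0) := by
  have e1 : ContDiffAt ℝ n (fun y : ℝ × ℝ × ℝ => α y.2) (b, 0, 0) :=
    ContDiffAt.comp (g := α) _ hα contDiffAt_snd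
  have e2 : ContDiffAt ℝ n (fun y : ℝ × ℝ × ℝ => β y.2) (b, 0, 0) :=
    ContDiffAt.comp (g := β) _ hβ contDiffAt_snd
  exact ContDiffAt.comp (g := H) _ hH (contDiffAt_fst.prodMk (e1.prodMk e2))

lemma contDiffAt_behindL : ContDiffAt ℝ 2 (behindL T) (β₀ T.toSetup, 0, 0) :=
  (contDiffAt_comp_ahead (n := ⊤) (T.hH₁.contDiffAt (T.hU₁.mem_nhds T.hU₁mem))
    (contDiffAt_αst₁ _) (contDiffAt_βst₁ _)).of_le (two_le_infty)

lemma contDiffAt_behindR : ContDiffAt ℝ 2 (behindR T) (β₀ T.toSetup, 0, 0) :=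
  (contDiffAt_comp_ahead (n := ⊤) (T.hH₂.contDiffAt (T.hU₂.mem_nhds T.hU₂mem))
    (contDiffAt_αst₂ _) (contDiffAt_βst₂ _)).of_le (two_le_infty)

lemma fderiv_comp_ahead {H : ℝ × ℝ × ℝ → ℝ} {α β : ℝ × ℝ → ℝ} {b : ℝ}
    (hH : DifferentiableAt ℝ H (b, α (0, 0), β (0, 0))) (hα : DifferentiableAt ℝ α (0, 0))
    (hβ : DifferentiableAt ℝ β (0, 0)) (v : ℝ × ℝ × ℝ) :
    fderiv ℝ (fun y : ℝ × ℝ × ℝ => H (y.1, α y.2, β y.2)) (b, 0, 0) v =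
      fderiv ℝ H (b, α (0, 0), β (0, 0)) (v.1,
        pu α (0, 0) * v.2.1 + pv α (0, 0) * v.2.2, pu β (0, 0) * v.2.1 + pv β (0, 0) * v.2.2) := by
  have e1 : HasFDerivAt (fun y : ℝ × ℝ × ℝ => α y.2) _ (b, 0, 0) :=
    HasFDerivAt.comp (g := α) (b, 0, 0) hα.hasFDerivAt hasFDerivAt_snd
  have e2 : HasFDerivAt (fun y : ℝ × ℝ × ℝ => β y.2) _ (b, 0, 0) :=
    HasFDerivAt.comp (g := β) (b, 0, 0) hβ.hasFDerivAt hasFDerivAt_snd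
  have h := HasFDerivAt.comp (g := H) (f := fun y : ℝ × ℝ × ℝ => (y.1, α y.2, β y.2))
    (b, 0, 0) hH.hasFDerivAt (hasFDerivAt_fst.prodMk (e1.prodMk e2))
  have h' : HasFDerivAt (fun y : ℝ × ℝ × ℝ => H (y.1, α y.2, β y.2)) _ (b, 0, 0) := h
  rw [h'.fderiv]
  simp only [ContinuousLinearMap.comp_apply, ContinuousLinearMap.prod_apply,
    ContinuousLinearMap.coe_fst', ContinuousLinearMap.coe_snd', fderiv_eq_pu_pv hα,
    fderiv_eq_pu_pv hβ]

lemma fderiv_behindL (v : ℝ × ℝ × ℝ) :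
    fderiv ℝ (behindL T) (β₀ T.toSetup, 0, 0) v = F₁₀ T.toSetup * v.1 +
      M₁₁₀ T.toSetup * (pu (αst₁ T.toSetup) (0, 0) * v.2.1 + pv (αst₁ T.toSetup) (0, 0) * v.2.2) +
      M₁₂₀ T.toSetup *
        (pu (βst₁ T.toSetup) (0, 0) * v.2.1 + pv (βst₁ T.toSetup) (0, 0) * v.2.2) := by
  have h := fderiv_comp_ahead (b := β₀ T.toSetup)
    ((T.hH₁.contDiffAt (T.hU₁.mem_nhds T.hU₁mem)).differentiableAt (by simp))
    ((contDiffAt_αst₁ T.toSetup).differentiableAt (by simp))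
    ((contDiffAt_βst₁ T.toSetup).differentiableAt (by simp)) v
  exact h.trans (fderiv_H₁ T _)

lemma fderiv_behindR (v : ℝ × ℝ × ℝ) :
    fderiv ℝ (behindR T) (β₀ T.toSetup, 0, 0) v = F₂₀ T.toSetup * v.1 +
      M₂₁₀ T.toSetup * (pu (αst₂ T.toSetup) (0, 0) * v.2.1 + pv (αst₂ T.toSetup) (0, 0) * v.2.2) +
      M₂₂₀ T.toSetup *
        (pu (βst₂ T.toSetup) (0, 0) * v.2.1 + pv (βst₂ T.toSetup) (0, 0) * v.2.2) := by
  have h := fderiv_comp_ahead (b := β₀ T.toSetup)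
    ((T.hH₂.contDiffAt (T.hU₂.mem_nhds T.hU₂mem)).differentiableAt (by simp))
    ((contDiffAt_αst₂ T.toSetup).differentiableAt (by simp))
    ((contDiffAt_βst₂ T.toSetup).differentiableAt (by simp)) v
  exact h.trans (fderiv_H₂ T _)

lemma fderiv_behindL_base : fderiv ℝ (behindL T) (β₀ T.toSetup, 0, 0) (β₀' T.toSetup,
    1 / η₀ T.toSetup * (1 - 1 / Γ₀ T.toSetup), 1 / Γ₀ T.toSetup + 1) = α₀' T.toSetup := by
  rw [fderiv_behindL, α₀'_eq, a₀, dαm₁, dβm₁]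
  ring

lemma fderiv_behindR_base : fderiv ℝ (behindR T) (β₀ T.toSetup, 0, 0)
    (aconst T.toSetup * α₀' T.toSetup,
      1 / η₀ T.toSetup * (1 - aconst T.toSetup / Γ₀ T.toSetup),
      aconst T.toSetup / Γ₀ T.toSetup + 1) = β₀' T.toSetup := by
  rw [fderiv_behindR, β₀'_eq, b₀, dαm₂, dβm₂]
  ring

end Reflection

/-- A triple `(α¹₊, β²₊, x)` together with functions standing for its derivatives. -/
structure Jet where
  A : ℝ → ℝ
  A1 : ℝ → ℝ
  A2 : ℝ → ℝ
  B : ℝ → ℝ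
  B1 : ℝ → ℝ
  B2 : ℝ → ℝ
  X : ℝ × ℝ → ℝ
  Xu : ℝ × ℝ → ℝ
  Xv : ℝ × ℝ → ℝ
  Xuu : ℝ × ℝ → ℝ
  Xuv : ℝ × ℝ → ℝ
  Xvv : ℝ × ℝ → ℝ
  W : ℝ × ℝ → ℝ × ℝ →L[ℝ] ℝ

/-- A family of jets on balls of radii `d` with the prescribed values at the origin, whose second
and third derivatives are controlled by the gauges `gN`, `gL` and `gK`. -/
structure Fam {ι : Type*} (S : Setup) (G : Filter ι) (d gN gL gK : ι → ℝ) (D : ι → Jet) :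
    Prop where
  one_le : ∀ i, 1 ≤ gN i
  le₁ : ∀ i, gN i ≤ gL i
  le₂ : ∀ i, gL i ≤ gK i
  lim : Tendsto (fun i => d i * gK i) G (𝓝 0)
  pos : ∀ᶠ i in G, 0 < d i
  A : HD G d (fun i => (D i).A) fun i => (D i).A1
  A1 : HD G d (fun i => (D i).A1) fun i => (D i).A2
  A2 : CB G d (fun i => (D i).A2) gL
  A_zero : ∀ᶠ i in G, (D i).A 0 = β₀ S
  A1_zero : ∀ᶠ i in G, (D i).A1 0 = α₀' S
  B : HD G d (fun i => (D i).B) fun i => (D i).B1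
  B1 : HD G d (fun i => (D i).B1) fun i => (D i).B2
  B2 : CB G d (fun i => (D i).B2) gL
  B_zero : ∀ᶠ i in G, (D i).B 0 = β₀ S
  B1_zero : ∀ᶠ i in G, (D i).B1 0 = β₀' S
  X : HF G d (fun i => (D i).X) fun i q => coL ((D i).Xu q, (D i).Xv q)
  Xu : HF G d (fun i => (D i).Xu) fun i q => coL ((D i).Xuu q, (D i).Xuv q)
  Xv : HF G d (fun i => (D i).Xv) fun i q => coL ((D i).Xuv q, (D i).Xvv q)
  Xuv : HF G d (fun i => (D i).Xuv) fun i => (D i).W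
  W : CB G d (fun i => (D i).W) gK
  Xuu_b : CB G d (fun i => (D i).Xuu) gN
  Xuv_b : CB G d (fun i => (D i).Xuv) gN
  Xvv_b : CB G d (fun i => (D i).Xvv) gN
  X_zero : ∀ᶠ i in G, (D i).X 0 = 0
  Xu_zero : ∀ᶠ i in G, (D i).Xu 0 = 1 / Γ₀ S
  Xv_zero : ∀ᶠ i in G, (D i).Xv 0 = 1

lemma aconst_abs_le (S : Setup) : |aconst S| ≤ 1 := by
  rw [abs_aconst]; exact (aconst_lt_one S).le

/-- The diagonal of the plane. -/
def diagL : ℝ →L[ℝ] ℝ × ℝ := (ContinuousLinearMap.id ℝ ℝ).prod (ContinuousLinearMap.id ℝ ℝ)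

/-- The line `u = a v`, parametrised by `v`. -/
def lineL (a : ℝ) : ℝ →L[ℝ] ℝ × ℝ := (scaleL a).prod (ContinuousLinearMap.id ℝ ℝ)

/-- The exchange of the two coordinates. -/
def swapL : ℝ × ℝ →L[ℝ] ℝ × ℝ :=
  (ContinuousLinearMap.snd ℝ ℝ ℝ).prod (ContinuousLinearMap.fst ℝ ℝ ℝ)

lemma norm_diagL_le (x : ℝ) : ‖diagL x‖ ≤ ‖x‖ := max_le le_rfl le_rfl

lemma norm_lineL_le {a : ℝ} (ha : |a| ≤ 1) (x : ℝ) : ‖lineL a x‖ ≤ ‖x‖ :=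
  max_le (norm_scaleL_le ha x) le_rfl

lemma norm_swapL_le (x : ℝ × ℝ) : ‖swapL x‖ ≤ ‖x‖ :=
  max_le (norm_snd_le x) (norm_fst_le x)

@[simp] lemma diagL_apply (x : ℝ) : diagL x = (x, x) := rfl

@[simp] lemma lineL_apply (a x : ℝ) : lineL a x = (a * x, x) := rfl

@[simp] lemma swapL_apply (x : ℝ × ℝ) : swapL x = (x.2, x.1) := rfl

section

variable {ι : Type*} {S : Setup} {G : Filter ι} {d gN gL gK : ι → ℝ} {D : ι → Jet}

lemma tendsto_gauge_of_le {g h : ι → ℝ} (hd : ∀ᶠ i in G, 0 < d i) (h0 : ∀ i, 0 ≤ g i)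
    (hgh : ∀ i, g i ≤ h i) (hh : Tendsto (fun i => d i * h i) G (𝓝 0)) :
    Tendsto (fun i => d i * g i) G (𝓝 0) := by
  refine tendsto_of_tendsto_of_tendsto_of_le_of_le' tendsto_const_nhds hh
    (hd.mono fun i hi => mul_nonneg hi.le (h0 i)) (hd.mono fun i hi => ?_)
  exact mul_le_mul_of_nonneg_left (hgh i) hi.le

namespace Fam

variable (h : Fam S G d gN gL gK D)
include h

lemma nonneg (i : ι) : 0 ≤ gN i := zero_le_one.trans (h.one_le i)

lemma one_le_gL (i : ι) : 1 ≤ gL i := (h.one_le i).trans (h.le₁ i)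

lemma limL : Tendsto (fun i => d i * gL i) G (𝓝 0) :=
  tendsto_gauge_of_le h.pos (fun i => zero_le_one.trans (h.one_le_gL i)) h.le₂ h.lim

lemma limN : Tendsto (fun i => d i * gN i) G (𝓝 0) :=
  tendsto_gauge_of_le h.pos h.nonneg h.le₁ h.limL

lemma lim1 : Tendsto (fun i => d i * (1 : ι → ℝ) i) G (𝓝 0) :=
  tendsto_gauge_of_le h.pos (fun _ => zero_le_one) h.one_le h.limN

lemma A1_cl : CL G d (fun i => (D i).A1) (α₀' S) := CL.of_hd h.A1 h.A2 h.limL h.A1_zero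

lemma B1_cl : CL G d (fun i => (D i).B1) (β₀' S) := CL.of_hd h.B1 h.B2 h.limL h.B1_zero

lemma A_cl : CL G d (fun i => (D i).A) (β₀ S) :=
  CL.of_hd h.A (h.A1_cl.cb h.one_le_gL) h.limL h.A_zero

lemma B_cl : CL G d (fun i => (D i).B) (β₀ S) :=
  CL.of_hd h.B (h.B1_cl.cb h.one_le_gL) h.limL h.B_zero

lemma Xu_deriv_cb : CB G d (fun i q => coL ((D i).Xuu q, (D i).Xuv q)) gN :=
  (h.Xuu_b.prodMk h.Xuv_b).clm coL

lemma Xv_deriv_cb : CB G d (fun i q => coL ((D i).Xuv q, (D i).Xvv q)) gN :=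
  (h.Xuv_b.prodMk h.Xvv_b).clm coL

lemma Xu_cl : CL G d (fun i => (D i).Xu) (1 / Γ₀ S) :=
  CL.of_deriv h.Xu h.Xu_deriv_cb h.limN h.Xu_zero

lemma Xv_cl : CL G d (fun i => (D i).Xv) 1 := CL.of_deriv h.Xv h.Xv_deriv_cb h.limN h.Xv_zero

lemma X_cl : CL G d (fun i => (D i).X) 0 :=
  CL.of_deriv h.X (((h.Xu_cl.prodMk h.Xv_cl).cb h.one_le).clm coL) h.limN h.X_zero

lemma AB_cl : CL G d (fun i (q : ℝ × ℝ) => ((D i).A q.1, (D i).B q.2)) (β₀ S, β₀ S) :=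
  (h.A_cl.lin (ContinuousLinearMap.fst ℝ ℝ ℝ) norm_fst_le).prodMk
    (h.B_cl.lin (ContinuousLinearMap.snd ℝ ℝ ℝ) norm_snd_le)

lemma AB1_cl : CL G d (fun i (q : ℝ × ℝ) => ((D i).A1 q.1, (D i).B1 q.2)) (α₀' S, β₀' S) :=
  (h.A1_cl.lin (ContinuousLinearMap.fst ℝ ℝ ℝ) norm_fst_le).prodMk
    (h.B1_cl.lin (ContinuousLinearMap.snd ℝ ℝ ℝ) norm_snd_le)

/-- The derivative of `(α, β)`. -/
lemma AB_hf : HF G d (fun i (q : ℝ × ℝ) => ((D i).A q.1, (D i).B q.2)) fun i q =>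
    ((D i).A1 q.1 • ContinuousLinearMap.fst ℝ ℝ ℝ).prod
      ((D i).B1 q.2 • ContinuousLinearMap.snd ℝ ℝ ℝ) :=
  (h.A.lin (ContinuousLinearMap.fst ℝ ℝ ℝ) norm_fst_le).prodMk
    (h.B.lin (ContinuousLinearMap.snd ℝ ℝ ℝ) norm_snd_le)

lemma AB_deriv_cl : CL G d (fun i (q : ℝ × ℝ) =>
    ((D i).A1 q.1 • ContinuousLinearMap.fst ℝ ℝ ℝ).prod
      ((D i).B1 q.2 • ContinuousLinearMap.snd ℝ ℝ ℝ))
    ((α₀' S • ContinuousLinearMap.fst ℝ ℝ ℝ).prod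
      (β₀' S • ContinuousLinearMap.snd ℝ ℝ ℝ)) :=
  h.AB1_cl.comp' (h := fun p : ℝ × ℝ => (p.1 • ContinuousLinearMap.fst ℝ ℝ ℝ).prod
    (p.2 • ContinuousLinearMap.snd ℝ ℝ ℝ)) (by
      have : (fun p : ℝ × ℝ => (p.1 • ContinuousLinearMap.fst ℝ ℝ ℝ).prod
          (p.2 • ContinuousLinearMap.snd ℝ ℝ ℝ)) = fun p : ℝ × ℝ =>
          p.1 • (ContinuousLinearMap.fst ℝ ℝ ℝ).prod (0 : ℝ × ℝ →L[ℝ] ℝ) +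
          p.2 • (0 : ℝ × ℝ →L[ℝ] ℝ).prod (ContinuousLinearMap.snd ℝ ℝ ℝ) := by
        funext p
        ext <;> simp
      rw [this]
      fun_prop)

lemma AB1_hf : HF G d (fun i (q : ℝ × ℝ) => ((D i).A1 q.1, (D i).B1 q.2)) fun i q =>
    ((D i).A2 q.1 • ContinuousLinearMap.fst ℝ ℝ ℝ).prod
      ((D i).B2 q.2 • ContinuousLinearMap.snd ℝ ℝ ℝ) :=
  (h.A1.lin (ContinuousLinearMap.fst ℝ ℝ ℝ) norm_fst_le).prodMk
    (h.B1.lin (ContinuousLinearMap.snd ℝ ℝ ℝ) norm_snd_le)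

lemma AB1_deriv_cb : CB G d (fun i (q : ℝ × ℝ) =>
    ((D i).A2 q.1 • ContinuousLinearMap.fst ℝ ℝ ℝ).prod
      ((D i).B2 q.2 • ContinuousLinearMap.snd ℝ ℝ ℝ)) gL := by
  have h1 := ((h.A2.lin (ContinuousLinearMap.fst ℝ ℝ ℝ) norm_fst_le).smul_cl
    (CL.const ((ContinuousLinearMap.fst ℝ ℝ ℝ).prod (0 : ℝ × ℝ →L[ℝ] ℝ)))).add
    ((h.B2.lin (ContinuousLinearMap.snd ℝ ℝ ℝ) norm_snd_le).smul_cl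
    (CL.const ((0 : ℝ × ℝ →L[ℝ] ℝ).prod (ContinuousLinearMap.snd ℝ ℝ ℝ))))
  convert h1 using 3
  ext <;> simp

end Fam

end

section

variable {ι : Type*} {S : Setup} {G : Filter ι} {d gN gL gK : ι → ℝ} {D : ι → Jet}

lemma cl_comp_deriv {E V W : Type*} [NormedAddCommGroup E] [NormedSpace ℝ E]
    [NormedAddCommGroup V] [NormedSpace ℝ V] [NormedAddCommGroup W] [NormedSpace ℝ W]
    {f : ι → E → V} {f' : ι → E → E →L[ℝ] V} {c : V} {k : E →L[ℝ] V} {h : V → W}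
    (hc : CL G d f c) (hf' : CL G d f' k) (hh : ContDiffAt ℝ 1 h c) :
    CL G d (fun i x => (fderiv ℝ h (f i x)).comp (f' i x)) ((fderiv ℝ h c).comp k) :=
  ((hc.fderiv hh).prodMk hf').comp' (h := fun y : (V →L[ℝ] W) × (E →L[ℝ] V) => y.1.comp y.2)
    (by fun_prop)

lemma CB.comp_swapL {f : ι → ℝ × ℝ → ℝ × ℝ →L[ℝ] ℝ} {g : ι → ℝ} (hf : CB G d f g) :
    CB G d (fun i q => (f i q).comp swapL) g :=
  hf.clm ((ContinuousLinearMap.compL ℝ (ℝ × ℝ) (ℝ × ℝ) ℝ).flip swapL)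

/-- A family of curves with two derivatives, converging together with its velocity, and with
acceleration controlled by the gauge `g`. -/
structure Curve (G : Filter ι) (d g : ι → ℝ) (f f1 f2 : ι → ℝ → ℝ) (c c1 : ℝ) : Prop where
  hd : HD G d f f1
  hd1 : HD G d f1 f2
  cb : CB G d f2 g
  cl : CL G d f c
  cl1 : CL G d f1 c1

namespace Jet

variable (S : Setup) (J : Jet)

/-- The derivative of `(α, β)`. -/
def dAB (q : ℝ × ℝ) : ℝ × ℝ →L[ℝ] ℝ × ℝ :=
  (J.A1 q.1 • ContinuousLinearMap.fst ℝ ℝ ℝ).prod (J.B1 q.2 • ContinuousLinearMap.snd ℝ ℝ ℝ)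

/-- The density `φ = x_u / c_in`. -/
def phi (q : ℝ × ℝ) : ℝ := J.Xu q * recipIn S (J.A q.1, J.B q.2)

/-- The density `ψ = x_v / c_out`. -/
def psi (q : ℝ × ℝ) : ℝ := J.Xv q * recipOut S (J.A q.1, J.B q.2)

/-- The derivative of `φ`. -/
def dphi (q : ℝ × ℝ) : ℝ × ℝ →L[ℝ] ℝ :=
  J.Xu q • (fderiv ℝ (recipIn S) (J.A q.1, J.B q.2)).comp (J.dAB q) +
    recipIn S (J.A q.1, J.B q.2) • coL (J.Xuu q, J.Xuv q)

/-- The derivative of `ψ`. -/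
def dpsi (q : ℝ × ℝ) : ℝ × ℝ →L[ℝ] ℝ :=
  J.Xv q • (fderiv ℝ (recipOut S) (J.A q.1, J.B q.2)).comp (J.dAB q) +
    recipOut S (J.A q.1, J.B q.2) • coL (J.Xuv q, J.Xvv q)

/-- The partial derivative of `ψ` in the first variable. -/
def psiU (q : ℝ × ℝ) : ℝ :=
  J.Xv q * tangentMap (recipOut S) ((J.A q.1, J.B q.2), (J.A1 q.1, 0)) +
    recipOut S (J.A q.1, J.B q.2) * J.Xuv q

lemma dpsi_apply (q : ℝ × ℝ) : J.dpsi S q (1, 0) = J.psiU S q := by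
  simp [dpsi, psiU, dAB, tangentMap]

/-- The velocity of `t` along the left shock. -/
def chi (u : ℝ) : ℝ := J.phi S (u, u) + J.psi S (u, u)

def chi1 (u : ℝ) : ℝ := J.dphi S (u, u) (1, 1) + J.dpsi S (u, u) (1, 1)

/-- The coordinate `t` along the left shock. -/
def lt : ℝ → ℝ := prim (J.chi S)

/-- The coordinate `x` along the left shock. -/
def lx (u : ℝ) : ℝ := J.X (u, u)

def lx1 (u : ℝ) : ℝ := J.Xu (u, u) + J.Xv (u, u)

def lx2 (u : ℝ) : ℝ := J.Xuu (u, u) + J.Xuv (u, u) + (J.Xuv (u, u) + J.Xvv (u, u))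

/-- The coordinate `t` along the right shock. -/
def rt (v : ℝ) : ℝ := J.lt S (aconst S * v) +
  segInt (fun q => J.psi S (swapL q)) (aconst S * v, v, aconst S * v)

def rt1 (v : ℝ) : ℝ := aconst S * J.chi S (aconst S * v) +
  (-J.psi S (aconst S * v, aconst S * v) * aconst S + J.psi S (aconst S * v, v) +
    segInt (fun q => J.psiU S (swapL q)) (aconst S * v, v, aconst S * v) * aconst S)

/-- The coordinate `x` along the right shock. -/
def rx (v : ℝ) : ℝ := J.X (aconst S * v, v)

def rx1 (v : ℝ) : ℝ := aconst S * J.Xu (aconst S * v, v) + J.Xv (aconst S * v, v)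

def rx2 (v : ℝ) : ℝ :=
  aconst S * (aconst S * J.Xuu (aconst S * v, v) + J.Xuv (aconst S * v, v)) +
    (aconst S * J.Xuv (aconst S * v, v) + J.Xvv (aconst S * v, v))

end Jet

lemma recipIn_base (S : Setup) : recipIn S (β₀ S, β₀ S) = -(1 / η₀ S) := by
  simp [recipIn]

lemma recipOut_base (S : Setup) : recipOut S (β₀ S, β₀ S) = 1 / η₀ S := by
  simp [recipOut]

/-- The line `v ↦ (a v, v, a v)`. -/
def rightL (a : ℝ) : ℝ →L[ℝ] ℝ × ℝ × ℝ := (scaleL a).prod ((ContinuousLinearMap.id ℝ ℝ).prod (scaleL a))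

lemma norm_rightL_le {a : ℝ} (ha : |a| ≤ 1) (x : ℝ) : ‖rightL a x‖ ≤ ‖x‖ :=
  max_le (norm_scaleL_le ha x) (max_le le_rfl (norm_scaleL_le ha x))

@[simp] lemma rightL_apply (a x : ℝ) : rightL a x = (a * x, x, a * x) := rfl

/-- The line `u ↦ (a u, u, u)`. -/
def leftL (a : ℝ) : ℝ →L[ℝ] ℝ × ℝ × ℝ :=
  (scaleL a).prod ((ContinuousLinearMap.id ℝ ℝ).prod (ContinuousLinearMap.id ℝ ℝ))

lemma norm_leftL_le {a : ℝ} (ha : |a| ≤ 1) (x : ℝ) : ‖leftL a x‖ ≤ ‖x‖ :=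
  max_le (norm_scaleL_le ha x) (max_le le_rfl le_rfl)

namespace Fam

variable (h : Fam S G d gN gL gK D)
include h

lemma recipIn_cl : CL G d (fun i (q : ℝ × ℝ) => recipIn S ((D i).A q.1, (D i).B q.2)) (-(1 / η₀ S)) := by
  rw [← recipIn_base]; exact h.AB_cl.compC (contDiffAt_recipIn S)

lemma recipOut_cl : CL G d (fun i (q : ℝ × ℝ) => recipOut S ((D i).A q.1, (D i).B q.2)) (1 / η₀ S) := by
  rw [← recipOut_base]; exact h.AB_cl.compC ((contDiffAt_recipOut S).of_le (by norm_num))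

lemma phi_cl : CL G d (fun i => (D i).phi S) (1 / Γ₀ S * -(1 / η₀ S)) := h.Xu_cl.mul h.recipIn_cl

lemma psi_cl : CL G d (fun i => (D i).psi S) (1 * (1 / η₀ S)) := h.Xv_cl.mul h.recipOut_cl

lemma phi_hf : HF G d (fun i => (D i).phi S) fun i => (D i).dphi S :=
  h.Xu.mul (h.AB_hf.comp h.AB_cl (contDiffAt_recipIn S))

lemma psi_hf : HF G d (fun i => (D i).psi S) fun i => (D i).dpsi S :=
  h.Xv.mul (h.AB_hf.comp h.AB_cl ((contDiffAt_recipOut S).of_le (by norm_num)))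

lemma dphi_cb : CB G d (fun i => (D i).dphi S) gN :=
  (((cl_comp_deriv h.AB_cl h.AB_deriv_cl (contDiffAt_recipIn S)).cb h.one_le).smul h.Xu_cl).add
    (h.Xu_deriv_cb.smul h.recipIn_cl)

lemma dpsi_cb : CB G d (fun i => (D i).dpsi S) gN :=
  (((cl_comp_deriv h.AB_cl h.AB_deriv_cl
    ((contDiffAt_recipOut S).of_le (by norm_num))).cb h.one_le).smul h.Xv_cl).add
    (h.Xv_deriv_cb.smul h.recipOut_cl)

lemma psiU_cb : CB G d (fun i => (D i).psiU S) gN := by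
  have := h.dpsi_cb.clm (ContinuousLinearMap.apply ℝ ℝ ((1, 0) : ℝ × ℝ))
  simpa only [ContinuousLinearMap.apply_apply, Jet.dpsi_apply] using this

lemma exists_psiU_deriv : ∃ P : ι → ℝ × ℝ → ℝ × ℝ →L[ℝ] ℝ,
    HF G d (fun i => (D i).psiU S) P ∧ CB G d P gK := by
  have c1 := contDiffAt_recipOut S
  have c0 : ContDiffAt ℝ 1 (recipOut S) (β₀ S, β₀ S) := c1.of_le (by norm_num)
  have h1 := h.A1_cl.lin (ContinuousLinearMap.fst ℝ ℝ ℝ) norm_fst_le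
  have h1' := h.A1.lin (ContinuousLinearMap.fst ℝ ℝ ℝ) norm_fst_le
  have h2 := h1.comp' (h := fun s : ℝ => ((s, 0) : ℝ × ℝ)) (by fun_prop)
  have h2' := h1'.comp h1 (h := fun s : ℝ => ((s, 0) : ℝ × ℝ)) (by fun_prop)
  have b2 := cb_comp_deriv h1 ((h.A2.lin (ContinuousLinearMap.fst ℝ ℝ ℝ) norm_fst_le).smul_cl
    (CL.const (ContinuousLinearMap.fst ℝ ℝ ℝ))) (h := fun s : ℝ => ((s, 0) : ℝ × ℝ))
    (by fun_prop)
  have h3 := h.AB_cl.prodMk h2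
  have h3' := h.AB_hf.prodMk h2'
  have b3 := ((h.AB_deriv_cl.cb h.one_le_gL).prodMk b2).clm
    (ContinuousLinearMap.prodₗᵢ (𝕜 := ℝ) ℝ :
      _ ≃ₗᵢ[ℝ] (ℝ × ℝ →L[ℝ] (ℝ × ℝ) × ℝ × ℝ)).toContinuousLinearEquiv.toContinuousLinearMap
  have c3 : ContDiffAt ℝ 1 (tangentMap (recipOut S)) ((β₀ S, β₀ S), (α₀' S, (0 : ℝ))) :=
    contDiffAt_tangentMap c1
  have h4 := h3.compC c3
  have h4' := h3'.comp h3 c3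
  have b4 := cb_comp_deriv h3 b3 c3
  have h5 := (h.Xv.mul h4').add ((h.AB_hf.comp h.AB_cl c0).mul h.Xuv)
  have hgL : ∀ i, 0 ≤ gL i := fun i => zero_le_one.trans (h.one_le_gL i)
  have hNK : ∀ i, gN i ≤ gK i := fun i => (h.le₁ i).trans (h.le₂ i)
  refine ⟨_, h5, ?_⟩
  exact (((b4.smul h.Xv_cl).mono hgL h.le₂).add ((h.Xv_deriv_cb.smul h4).mono h.nonneg hNK)).add
    ((h.W.smul h.recipOut_cl).add
      ((h.Xuv_b.smul_cl (cl_comp_deriv h.AB_cl h.AB_deriv_cl c0)).mono h.nonneg hNK))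

lemma chi_cl : CL G d (fun i => (D i).chi S) (1 / η₀ S * (1 - 1 / Γ₀ S)) := by
  have := (h.phi_cl.lin diagL norm_diagL_le).add (h.psi_cl.lin diagL norm_diagL_le)
  rwa [show 1 / Γ₀ S * -(1 / η₀ S) + 1 * (1 / η₀ S) = 1 / η₀ S * (1 - 1 / Γ₀ S) by ring] at this

lemma left_t : Curve G d gN (fun i => (D i).lt S) (fun i => (D i).chi S) (fun i => (D i).chi1 S)
    0 (1 / η₀ S * (1 - 1 / Γ₀ S)) where
  hd := h.chi_cl.cont.prim
  hd1 := (h.phi_hf.curve diagL norm_diagL_le).add (h.psi_hf.curve diagL norm_diagL_le)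
  cb := ((h.dphi_cb.lin diagL norm_diagL_le).clm (ContinuousLinearMap.apply ℝ ℝ (diagL 1))).add
    ((h.dpsi_cb.lin diagL norm_diagL_le).clm (ContinuousLinearMap.apply ℝ ℝ (diagL 1)))
  cl := (h.chi_cl.cb h.one_le).prim h.limN
  cl1 := h.chi_cl

lemma left_x : Curve G d gN (fun i => (D i).lx) (fun i => (D i).lx1) (fun i => (D i).lx2)
    0 (1 / Γ₀ S + 1) where
  hd := by
    have := h.X.curve diagL norm_diagL_le
    simp only [coL_apply, diagL_apply, mul_one] at this
    exact this
  hd1 := by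
    have := (h.Xu.curve diagL norm_diagL_le).add (h.Xv.curve diagL norm_diagL_le)
    simp only [coL_apply, diagL_apply, mul_one] at this
    exact this
  cb := (((h.Xuu_b.add h.Xuv_b).add (h.Xuv_b.add h.Xvv_b)).lin diagL norm_diagL_le)
  cl := h.X_cl.lin diagL norm_diagL_le
  cl1 := (h.Xu_cl.add h.Xv_cl).lin diagL norm_diagL_le

lemma right_x : Curve G d gN (fun i => (D i).rx S) (fun i => (D i).rx1 S) (fun i => (D i).rx2 S)
    0 (aconst S / Γ₀ S + 1) where
  hd := by
    have := h.X.curve (lineL (aconst S)) (norm_lineL_le (aconst_abs_le S))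
    simp only [coL_apply, lineL_apply, mul_one, mul_comm _ (aconst S)] at this
    exact this
  hd1 := by
    have h1 := (h.Xu.curve (lineL (aconst S)) (norm_lineL_le (aconst_abs_le S)))
    have h2 := (h.Xv.curve (lineL (aconst S)) (norm_lineL_le (aconst_abs_le S)))
    simp only [coL_apply, lineL_apply, mul_one] at h1 h2
    refine Eventually.mono (h1.and h2) fun z hz => ?_
    have := (hz.1.const_mul (aconst S)).add hz.2
    simp only [mul_comm _ (aconst S)] at this
    exact this
  cb := by
    have := (CB.mul (CL.const (aconst S)) (CB.add (CB.mul (CL.const (aconst S)) h.Xuu_b)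
      h.Xuv_b)).add (CB.add (CB.mul (CL.const (aconst S)) h.Xuv_b) h.Xvv_b)
    exact this.lin (lineL (aconst S)) (norm_lineL_le (aconst_abs_le S))
  cl := h.X_cl.lin (lineL (aconst S)) (norm_lineL_le (aconst_abs_le S))
  cl1 := by
    have := ((CL.mul (CL.const (aconst S)) h.Xu_cl).add h.Xv_cl).lin (lineL (aconst S))
      (norm_lineL_le (aconst_abs_le S))
    rwa [mul_one_div] at this

lemma psi_swap_hf : HF G d (fun i q => (D i).psi S (swapL q))
    fun i q => ((D i).dpsi S (swapL q)).comp swapL := h.psi_hf.lin swapL norm_swapL_le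

lemma dpsi_swap_cb : CB G d (fun i q => ((D i).dpsi S (swapL q)).comp swapL) gN :=
  (h.dpsi_cb.lin swapL norm_swapL_le).comp_swapL

lemma exists_right_t : ∃ rt2 : ι → ℝ → ℝ, Curve G d gN (fun i => (D i).rt S)
    (fun i => (D i).rt1 S) rt2 0 (1 / η₀ S * (1 - aconst S / Γ₀ S)) := by
  obtain ⟨P, hP, bP⟩ := h.exists_psiU_deriv
  have ha := aconst_abs_le S
  have la := norm_lineL_le ha
  have ra := norm_rightL_le ha
  have da : ∀ x, ‖(diagL.comp (scaleL (aconst S))) x‖ ≤ ‖x‖ := fun x =>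
    (norm_diagL_le _).trans (norm_scaleL_le ha x)
  have hPs := hP.lin swapL norm_swapL_le
  have bPs := (bP.lin swapL norm_swapL_le).comp_swapL
  have s0 := (h.psi_swap_hf.segInt h.dpsi_swap_cb.cont).curve (rightL (aconst S)) ra
  have s1 := (hPs.segInt bPs.cont).curve (rightL (aconst S)) ra
  have b1 := ((((h.psiU_cb.lin swapL norm_swapL_le).segIntDeriv h.one_le bPs h.lim).lin
    (rightL (aconst S)) ra).clm (ContinuousLinearMap.apply ℝ ℝ (rightL (aconst S) 1)))
  have l0 := ((((h.psi_cl.lin swapL norm_swapL_le).cb h.one_le).segInt h.limN).lin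
    (rightL (aconst S)) ra)
  have l1 := ((h.psiU_cb.lin swapL norm_swapL_le).segInt h.limN).lin (rightL (aconst S)) ra
  have p1 := h.psi_hf.curve (diagL.comp (scaleL (aconst S))) da
  have p2 := h.psi_hf.curve (lineL (aconst S)) la
  have q1 := (h.dpsi_cb.lin (diagL.comp (scaleL (aconst S))) da).clm
    (ContinuousLinearMap.apply ℝ ℝ ((diagL.comp (scaleL (aconst S))) 1))
  have q2 := (h.dpsi_cb.lin (lineL (aconst S)) la).clm
    (ContinuousLinearMap.apply ℝ ℝ (lineL (aconst S) 1))
  have c1 := h.psi_cl.lin (diagL.comp (scaleL (aconst S))) da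
  have c2 := h.psi_cl.lin (lineL (aconst S)) la
  have t0 := h.left_t.hd.scale ha
  have t1 := h.left_t.hd1.scale ha
  have ka : CL G d (fun _ _ => aconst S) (aconst S) := CL.const (E := ℝ) (aconst S)
  have hd1 : HD G d (fun i => (D i).rt1 S) fun i v =>
      aconst S * (aconst S * (D i).chi1 S (aconst S * v)) +
      (-(D i).dpsi S (diagL.comp (scaleL (aconst S)) v) (diagL.comp (scaleL (aconst S)) 1) *
        aconst S + (D i).dpsi S (lineL (aconst S) v) (lineL (aconst S) 1) +
      segIntDeriv (fun x => (D i).psiU S (swapL x)) (fun x => (P i (swapL x)).comp swapL)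
        (rightL (aconst S) v) (rightL (aconst S) 1) * aconst S) := by
    refine Eventually.mono ((t1.and p1).and (p2.and s1)) fun z hz => ?_
    have e := (hz.1.1.const_mul (aconst S)).add
      (((hz.1.2.neg.mul_const (aconst S)).add hz.2.1).add (hz.2.2.mul_const (aconst S)))
    exact e
  refine ⟨_, ?_, hd1, ?cb, ?_, ?_⟩
  · refine Eventually.mono (t0.and s0) fun z hz => ?_
    have e := hz.1.add hz.2
    simp only [segIntDeriv, add_apply, smul_apply,
      ContinuousLinearMap.comp_apply, ContinuousLinearMap.coe_fst', ContinuousLinearMap.coe_snd',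
      rightL_apply, mul_one, smul_eq_mul, swapL_apply, Jet.dpsi_apply] at e
    exact e
  case cb =>
    have := (CB.mul ka (CB.mul ka (h.left_t.cb.scale ha))).add
      (((CB.mul (CL.const (-aconst S)) q1).add q2).add (CB.mul ka b1))
    convert this using 3 with i v
    simp only [ContinuousLinearMap.apply_apply]
    ring
  · have := (h.left_t.cl.scale ha).add l0
    rw [add_zero] at this
    exact this
  · have := (ka.mul (h.left_t.cl1.scale ha)).add
      ((((CL.const (-1)).mul (c1.mul ka)).add c2).add (l1.mul ka))
    convert this using 1
    · funext i v
      simp [Jet.rt1, scaleL]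
    · ring

end Fam

end

section

variable {ι : Type*} {S : Setup} {G : Filter ι} {d g gN gL gK : ι → ℝ} {D : ι → Jet}

lemma fderiv_tangentMap_snd {V W : Type*} [NormedAddCommGroup V] [NormedSpace ℝ V]
    [NormedAddCommGroup W] [NormedSpace ℝ W] {h : V → W} {c : V × V}
    (hh : ContDiffAt ℝ 2 h c.1) (w : V) :
    fderiv ℝ (tangentMap h) c (0, w) = fderiv ℝ h c.1 w := by
  have h1 := ((contDiffAt_tangentMap hh).differentiableAt (by norm_num)).hasFDerivAt
  have h2 : HasFDerivAt (fun w : V => (c.1, w)) (ContinuousLinearMap.inr ℝ V V) c.2 :=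
    hasFDerivAt_prodMk_right c.1 c.2
  have h3 : HasFDerivAt (fun w : V => fderiv ℝ h c.1 w)
      ((fderiv ℝ (tangentMap h) c).comp (ContinuousLinearMap.inr ℝ V V)) c.2 :=
    HasFDerivAt.comp (g := tangentMap h) c.2 h1 h2
  have h4 := h3.unique (fderiv ℝ h c.1).hasFDerivAt
  simpa using congrArg (fun k : V →L[ℝ] W => k w) h4

/-- The family `f` is bounded by `θ |b| + O(g)`. -/
def BoundedBy {E : Type*} [NormedAddCommGroup E] (G : Filter ι) (d : ι → ℝ) (θ : ℝ)
    (b f : ι → E → ℝ) (g : ι → ℝ) : Prop :=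
  ∃ C ≥ 0, ∀ᶠ z in nearF G d E, |f z.1 z.2| ≤ θ * |b z.1 z.2| + C * g z.1

lemma BoundedBy.of_decomp {E : Type*} [NormedAddCommGroup E] {m b r : ι → E → ℝ} {m₀ θ : ℝ}
    (hm : CL G d m m₀) (hr : CB G d r g) (hg : ∀ i, 0 ≤ g i) (hθ : |m₀| < θ) :
    BoundedBy G d θ b (fun i x => m i x * b i x + r i x) g := by
  obtain ⟨C, hC, h⟩ := hr.bound.exists_nonneg
  refine ⟨C, hC, ?_⟩
  filter_upwards [h.bound, hm.lim.abs.eventually_le_const hθ] with z hz hmz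
  rw [Real.norm_eq_abs, Real.norm_of_nonneg (hg _)] at hz
  calc |m z.1 z.2 * b z.1 z.2 + r z.1 z.2| ≤ |m z.1 z.2 * b z.1 z.2| + |r z.1 z.2| := abs_add_le _ _
    _ ≤ _ := by
      rw [abs_mul]
      gcongr

/-- A nonlinear function of a curve `(b, t, x)`, with `t` and `x` well controlled, inherits the
second order regularity of `b`, its acceleration being that of `b` up to a factor. -/
lemma exists_next {h : ℝ × ℝ × ℝ → ℝ} {b b1 b2 t t1 t2 x x1 x2 : ι → ℝ → ℝ}
    {cb cb1 ct ct1 cx cx1 θ : ℝ} (hh : ContDiffAt ℝ 2 h (cb, ct, cx))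
    (hb : Curve G d gL b b1 b2 cb cb1) (ht : Curve G d g t t1 t2 ct ct1)
    (hx : Curve G d g x x1 x2 cx cx1) (hg : ∀ i, 1 ≤ g i)
    (hθ : |fderiv ℝ h (cb, ct, cx) (1, 0, 0)| < θ) :
    ∃ f1 f2 : ι → ℝ → ℝ, HD G d (fun i s => h (b i s, t i s, x i s)) f1 ∧ HD G d f1 f2 ∧
      Cont G d f2 ∧ CL G d (fun i s => h (b i s, t i s, x i s)) (h (cb, ct, cx)) ∧
      CL G d f1 (fderiv ℝ h (cb, ct, cx) (cb1, ct1, cx1)) ∧ BoundedBy G d θ b2 f2 g := by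
  have h1 : ContDiffAt ℝ 1 h (cb, ct, cx) := hh.of_le (by norm_num)
  have hk : ContDiffAt ℝ 1 (tangentMap h) ((cb, ct, cx), (cb1, ct1, cx1)) :=
    contDiffAt_tangentMap hh
  have y := hb.cl.prodMk (ht.cl.prodMk hx.cl)
  have y1 := hb.cl1.prodMk (ht.cl1.prodMk hx.cl1)
  have dy := hb.hd.prodMk (ht.hd.prodMk hx.hd)
  have dy1 := hb.hd1.prodMk (ht.hd1.prodMk hx.hd1)
  have z := y.prodMk y1
  have dz := dy.prodMk dy1
  have kz := z.fderiv hk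
  have f1 := y.fderiv h1 |>.clm_apply y1
  have m := kz.clm_apply (CL.const (((0, (1, 0, 0)) : (ℝ × ℝ × ℝ) × ℝ × ℝ × ℝ)))
  rw [fderiv_tangentMap_snd hh] at m
  have zb := ht.cb.prodMk hx.cb
  have r := CB.clm_apply kz ((y1.cb hg).prodMk
    (zb.clm (ContinuousLinearMap.inr ℝ ℝ (ℝ × ℝ))))
  have e : (fun i s => fderiv ℝ (tangentMap h)
      ((b i s, t i s, x i s), (b1 i s, t1 i s, x1 i s))
      ((b1 i s, t1 i s, x1 i s), (b2 i s, t2 i s, x2 i s))) = fun i s =>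
      fderiv ℝ (tangentMap h) ((b i s, t i s, x i s), (b1 i s, t1 i s, x1 i s)) (0, (1, 0, 0)) *
        b2 i s + fderiv ℝ (tangentMap h) ((b i s, t i s, x i s), (b1 i s, t1 i s, x1 i s))
      ((b1 i s, t1 i s, x1 i s), ContinuousLinearMap.inr ℝ ℝ (ℝ × ℝ) (t2 i s, x2 i s)) := by
    funext i s
    rw [mul_comm, ← smul_eq_mul, ← map_smul, ← map_add]
    simp
  refine ⟨_, _, dy.comp y h1, dz.comp z hk, ?_, y.compC h1, f1, ?_⟩
  · rw [e]
    exact Eventually.mono ((Eventually.and m.cont hb.cb.cont).and r.cont) fun z hz =>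
      (hz.1.1.mul hz.1.2).add hz.2
  · rw [e]
    exact BoundedBy.of_decomp m r (fun i => zero_le_one.trans (hg i)) hθ

namespace Fam

variable {T : IterSetup} (h : Fam T.toSetup G d gN gL gK D)
include h

lemma left_b : Curve G d gL (fun i => (D i).B) (fun i => (D i).B1) (fun i => (D i).B2)
    (β₀ T.toSetup) (β₀' T.toSetup) := ⟨h.B, h.B1, h.B2, h.B_cl, h.B1_cl⟩

lemma right_b : Curve G d gL (fun i v => (D i).A (aconst T.toSetup * v))
    (fun i v => aconst T.toSetup * (D i).A1 (aconst T.toSetup * v))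
    (fun i v => aconst T.toSetup * (aconst T.toSetup * (D i).A2 (aconst T.toSetup * v)))
    (β₀ T.toSetup) (aconst T.toSetup * α₀' T.toSetup) where
  hd := h.A.scale (aconst_abs_le _)
  hd1 := Eventually.mono (h.A1.scale (aconst_abs_le _)) fun _ hz => hz.const_mul _
  cb := CB.mul (CL.const _) (CB.mul (CL.const _) (h.A2.scale (aconst_abs_le _)))
  cl := h.A_cl.scale (aconst_abs_le _)
  cl1 := (CL.const _).mul (h.A1_cl.scale (aconst_abs_le _))

/-- The next invariant behind the left shock. -/
lemma exists_next_left {θ : ℝ} (hθ : |F₁₀ T.toSetup| < θ) : ∃ f1 f2 : ι → ℝ → ℝ,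
    HD G d (fun i s => behindL T ((D i).B s, (D i).lt T.toSetup s, (D i).lx s)) f1 ∧
    HD G d f1 f2 ∧ Cont G d f2 ∧
    CL G d (fun i s => behindL T ((D i).B s, (D i).lt T.toSetup s, (D i).lx s)) (β₀ T.toSetup) ∧
    CL G d f1 (α₀' T.toSetup) ∧ BoundedBy G d θ (fun i => (D i).B2) f2 gN := by
  have := exists_next (θ := θ) (contDiffAt_behindL T) h.left_b h.left_t h.left_x h.one_le
    (by simpa [fderiv_behindL] using hθ)
  rwa [behindL_base, fderiv_behindL_base] at this

/-- The next invariant behind the right shock. -/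
lemma exists_next_right {θ : ℝ} (hθ : |F₂₀ T.toSetup| < θ) : ∃ f1 f2 : ι → ℝ → ℝ,
    HD G d (fun i s => behindR T ((D i).A (aconst T.toSetup * s), (D i).rt T.toSetup s,
      (D i).rx T.toSetup s)) f1 ∧
    HD G d f1 f2 ∧ Cont G d f2 ∧
    CL G d (fun i s => behindR T ((D i).A (aconst T.toSetup * s), (D i).rt T.toSetup s,
      (D i).rx T.toSetup s)) (β₀ T.toSetup) ∧
    CL G d f1 (β₀' T.toSetup) ∧ BoundedBy G d θ (fun i v =>
      aconst T.toSetup * (aconst T.toSetup * (D i).A2 (aconst T.toSetup * v))) f2 gN := by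
  obtain ⟨rt2, hrt⟩ := h.exists_right_t
  have := exists_next (θ := θ) (contDiffAt_behindR T) h.right_b hrt h.right_x h.one_le
    (by simpa [fderiv_behindR] using hθ)
  rwa [behindR_base, fderiv_behindR_base] at this

end Fam

end

section

variable {ι : Type*} {S : Setup} {G : Filter ι} {d g gN gL gK : ι → ℝ} {D : ι → Jet}

lemma CL.congr {E V : Type*} [NormedAddCommGroup E] [NormedSpace ℝ E]
    [NormedAddCommGroup V] [NormedSpace ℝ V] {f f₂ : ι → E → V} {c : V} (hf : CL G d f c)
    (hd : ∀ᶠ i in G, 0 < d i) (h : ∀ᶠ z in nearF G d E, f₂ z.1 z.2 = f z.1 z.2) :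
    CL G d f₂ c where
  cont := by
    rw [Cont, eventually_nearF]
    filter_upwards [hf.cont.forall, eventually_nearF.1 h] with i hi he x hx
    exact (hi x hx).congr
      ((continuous_norm.continuousAt.eventually_lt_const hx).mono fun y hy => (he y hy).symm)
  lim := hf.lim.congr' (h.mono fun _ hz => hz.symm)
  zero := by
    filter_upwards [hf.zero, hd, eventually_nearF.1 h] with i h0 hi he
    rw [← h0]
    exact he 0 (by simpa using hi)

lemma CB.clm_prod {E V W : Type*} [NormedAddCommGroup E] [NormedSpace ℝ E]
    [NormedAddCommGroup V] [NormedSpace ℝ V] [NormedAddCommGroup W] [NormedSpace ℝ W]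
    {f : ι → E → E →L[ℝ] V} {f₂ : ι → E → E →L[ℝ] W} (hf : CB G d f g) (hf₂ : CB G d f₂ g) :
    CB G d (fun i x => (f i x).prod (f₂ i x)) g :=
  (hf.prodMk hf₂).clm (ContinuousLinearMap.prodₗᵢ (𝕜 := ℝ) ℝ :
    _ ≃ₗᵢ[ℝ] (E →L[ℝ] V × W)).toContinuousLinearEquiv.toContinuousLinearMap

/-- A family of functions of a real variable converging together with its derivative. -/
def CLD (G : Filter ι) (d : ι → ℝ) (f : ι → ℝ → ℝ) (c : ℝ) : Prop :=
  CL G d f c ∧ ∃ (f1 : ι → ℝ → ℝ) (c1 : ℝ), HD G d f f1 ∧ CL G d f1 c1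

lemma CLD.of_comp {V : Type*} [NormedAddCommGroup V] [NormedSpace ℝ V] {f f1 : ι → ℝ → V}
    {h : V → ℝ} {c c1 : V} (hf : CL G d f c) (hd : HD G d f f1) (hf1 : CL G d f1 c1)
    (hh : ContDiffAt ℝ 1 h c) : CLD G d (fun i x => h (f i x)) (h c) :=
  ⟨hf.compC hh, _, _, hd.comp hf hh, (hf.fderiv hh).clm_apply hf1⟩

lemma CLD.div {f g : ι → ℝ → ℝ} {c e : ℝ} (hf : CLD G d f c) (hg : CLD G d g e) (he : e ≠ 0) :
    CLD G d (fun i x => f i x / g i x) (c / e) := by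
  obtain ⟨hf, f1, c1, hf1, cf1⟩ := hf
  obtain ⟨hg, g1, e1, hg1, cg1⟩ := hg
  exact CLD.of_comp (h := fun p : ℝ × ℝ => p.1 / p.2) (hf.prodMk hg) (hf1.prodMk hg1)
    (cf1.prodMk cg1) (contDiffAt_fst.div contDiffAt_snd he)

lemma CLD.scale {f : ι → ℝ → ℝ} {c a : ℝ} (hf : CLD G d f c) (ha : |a| ≤ 1) :
    CLD G d (fun i x => f i (a * x)) c := by
  obtain ⟨hf, f1, c1, hf1, cf1⟩ := hf
  exact ⟨hf.scale ha, _, _, hf1.scale ha, (CL.const a).mul (cf1.scale ha)⟩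

lemma CLD.const (c : ℝ) : CLD G d (fun _ _ => c) c :=
  ⟨CL.const c, fun _ _ => 0, 0, Eventually.of_forall fun _ => hasDerivAt_const _ _, CL.const 0⟩

lemma CLD.deriv {f : ι → ℝ → ℝ} {c : ℝ} (hf : CLD G d f c) (hd : ∀ᶠ i in G, 0 < d i) :
    ∃ c1, HD G d f (fun i => deriv (f i)) ∧ CL G d (fun i => deriv (f i)) c1 := by
  obtain ⟨hf, f1, c1, hf1, cf1⟩ := hf
  exact ⟨c1, Eventually.mono hf1 fun z hz => hz.differentiableAt.hasDerivAt,
    cf1.congr hd (Eventually.mono hf1 fun z hz => hz.deriv)⟩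

/-- The map `(u, v) ↦ (u, v, u)`. -/
def edgeL : ℝ × ℝ →L[ℝ] ℝ × ℝ × ℝ :=
  (ContinuousLinearMap.fst ℝ ℝ ℝ).prod
    ((ContinuousLinearMap.snd ℝ ℝ ℝ).prod (ContinuousLinearMap.fst ℝ ℝ ℝ))

@[simp] lemma edgeL_apply (q : ℝ × ℝ) : edgeL q = (q.1, q.2, q.1) := rfl

lemma norm_edgeL_le (q : ℝ × ℝ) : ‖edgeL q‖ ≤ ‖q‖ :=
  max_le (norm_fst_le q) (max_le (norm_snd_le q) (norm_fst_le q))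

/-- The map `(u, v) ↦ (a v, u, v)`. -/
def baseL (a : ℝ) : ℝ × ℝ →L[ℝ] ℝ × ℝ × ℝ :=
  ((scaleL a).comp (ContinuousLinearMap.snd ℝ ℝ ℝ)).prod
    ((ContinuousLinearMap.fst ℝ ℝ ℝ).prod (ContinuousLinearMap.snd ℝ ℝ ℝ))

@[simp] lemma baseL_apply (a : ℝ) (q : ℝ × ℝ) : baseL a q = (a * q.2, q.1, q.2) := rfl

lemma norm_baseL_le {a : ℝ} (ha : |a| ≤ 1) (q : ℝ × ℝ) : ‖baseL a q‖ ≤ ‖q‖ :=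
  max_le ((norm_scaleL_le ha q.2).trans (norm_snd_le q)) (max_le (norm_fst_le q) (norm_snd_le q))

namespace Jet

variable (S : Setup) (J : Jet)

/-- The source term `M`. -/
def src (q : ℝ × ℝ) : ℝ :=
  sourceFun S ((J.A q.1, J.B q.2), (J.A1 q.1, J.B1 q.2), (J.Xu q, J.Xv q))

/-- The coefficient `Γ¹` along the left shock. -/
def gamL (u : ℝ) : ℝ := gammaL S ((J.A u, J.B u), (J.lt S u, J.lx u))

/-- The coefficient `Γ²` along the right shock. -/
def gamR (v : ℝ) : ℝ := gammaR S ((J.A (aconst S * v), J.B v), (J.rt S v, J.rx S v))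

/-- The quotient `γ¹`. -/
def kL (u : ℝ) : ℝ := J.gamR S u / J.gamL S u

/-- The quotient `γ²`. -/
def kR (v : ℝ) : ℝ := J.gamR S v / J.gamL S (aconst S * v)

/-- The density `Λ¹`. -/
def LamL (u : ℝ) : ℝ :=
  deriv (J.kL S) u * J.Xu (aconst S * u, u) + aconst S * J.kL S u * J.Xuu (aconst S * u, u) +
    J.kL S u * J.src S (aconst S * u, u)

/-- The density `Λ²`. -/
def LamR (v : ℝ) : ℝ :=
  deriv (J.kR S) v * J.Xv (aconst S * v, aconst S * v) +
    aconst S * J.kR S v * J.Xvv (aconst S * v, aconst S * v) +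
    aconst S * J.kR S v * J.src S (aconst S * v, aconst S * v)

/-- The function `Φ¹`. -/
def PhiL (u : ℝ) : ℝ := prim (J.LamL S) u + 1 / J.gamL S u * segInt (J.src S) (leftL (aconst S) u)

/-- The function `Φ²`. -/
def PhiR (v : ℝ) : ℝ :=
  prim (J.LamR S) v + J.gamR S v * segInt (fun q => J.src S (swapL q)) (rightL (aconst S) v)

/-- The inner integral of the source term. -/
def inner (q : ℝ × ℝ) : ℝ := segInt (J.src S) (baseL (aconst S) q)

/-- The next coordinate function `x`. -/
def nextX (q : ℝ × ℝ) : ℝ :=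
  q.1 / Γ₀ S + q.2 + prim (J.PhiL S) q.1 + prim (J.PhiR S) q.2 +
    prim (fun u => J.inner S (diagL u)) q.1 + segInt (fun q => J.inner S (swapL q)) (edgeL q)

/-- The first partial derivative of `nextX`. -/
def nextXu (q : ℝ × ℝ) : ℝ :=
  1 / Γ₀ S + J.PhiL S q.1 + segInt (fun q => J.src S (swapL q)) (edgeL q)

/-- The second partial derivative of `nextX`. -/
def nextXv (q : ℝ × ℝ) : ℝ := 1 + J.PhiR S q.2 + J.inner S q

end Jet

namespace Fam

variable (h : Fam S G d gN gL gK D)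
include h

lemma gamL_cld : CLD G d (fun i => (D i).gamL S) (Γ₀ S) := by
  have := CLD.of_comp ((h.A_cl.prodMk h.B_cl).prodMk (h.left_t.cl.prodMk h.left_x.cl))
    ((h.A.prodMk h.B).prodMk (h.left_t.hd.prodMk h.left_x.hd))
    ((h.A1_cl.prodMk h.B1_cl).prodMk (h.left_t.cl1.prodMk h.left_x.cl1)) (contDiffAt_gammaL S)
  rwa [gammaL_base] at this

lemma gamR_cld : CLD G d (fun i => (D i).gamR S) (Γ₀ S) := by
  obtain ⟨rt2, hrt⟩ := h.exists_right_t
  have ha := aconst_abs_le S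
  have := CLD.of_comp (((h.A_cl.scale ha).prodMk h.B_cl).prodMk (hrt.cl.prodMk h.right_x.cl))
    (((h.A.scale ha).prodMk h.B).prodMk (hrt.hd.prodMk h.right_x.hd))
    ((((CL.const (aconst S)).mul (h.A1_cl.scale ha)).prodMk h.B1_cl).prodMk
      (hrt.cl1.prodMk h.right_x.cl1)) (contDiffAt_gammaR S)
  rwa [gammaR_base] at this

lemma kL_cld : CLD G d (fun i => (D i).kL S) 1 := by
  have := h.gamR_cld.div h.gamL_cld (Γ₀_ne S)
  rwa [div_self (Γ₀_ne S)] at this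

lemma kR_cld : CLD G d (fun i => (D i).kR S) 1 := by
  have := h.gamR_cld.div (h.gamL_cld.scale (aconst_abs_le S)) (Γ₀_ne S)
  rwa [div_self (Γ₀_ne S)] at this

lemma exists_src_cl : ∃ m, CL G d (fun i => (D i).src S) m :=
  ⟨_, (h.AB_cl.prodMk (h.AB1_cl.prodMk (h.Xu_cl.prodMk h.Xv_cl))).compC
    (contDiffAt_sourceFun S _ _)⟩

lemma exists_src_deriv : ∃ P, HF G d (fun i => (D i).src S) P ∧ CB G d P gL := by
  have c := h.AB_cl.prodMk (h.AB1_cl.prodMk (h.Xu_cl.prodMk h.Xv_cl))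
  have f := h.AB_hf.prodMk (h.AB1_hf.prodMk (h.Xu.prodMk h.Xv))
  refine ⟨_, f.comp c (contDiffAt_sourceFun S _ _), ?_⟩
  refine cb_comp_deriv c ?_ (contDiffAt_sourceFun S _ _)
  have b1 := h.AB_deriv_cl.cb h.one_le_gL
  have b2 := h.AB1_deriv_cb
  have b3 := h.Xu_deriv_cb.mono h.nonneg h.le₁
  have b4 := h.Xv_deriv_cb.mono h.nonneg h.le₁
  exact b1.clm_prod (b2.clm_prod (b3.clm_prod b4))

end Fam

end

section

variable {ι : Type*} {S : Setup} {G : Filter ι} {d gN gL gK : ι → ℝ} {D : ι → Jet}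

lemma segIntDeriv_second (f : ℝ × ℝ → ℝ) (f' : ℝ × ℝ → ℝ × ℝ →L[ℝ] ℝ) (p : ℝ × ℝ × ℝ) :
    segIntDeriv f f' p (0, 1, 0) = f (p.2.1, p.2.2) := by
  simp [segIntDeriv]

namespace Fam

variable (h : Fam S G d gN gL gK D)
include h

lemma exists_boundary {m b r k : ι → ℝ → ℝ} {F : ι → ℝ × ℝ → ℝ} {F' : ι → ℝ × ℝ → ℝ × ℝ →L[ℝ] ℝ}
    {m₀ r₀ k₀ f₀ : ℝ} {l : ℝ →L[ℝ] ℝ × ℝ × ℝ} (hl : ∀ x, ‖l x‖ ≤ ‖x‖)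
    (hm : CL G d m m₀) (hb : CB G d b gN) (hr : CL G d r r₀) (hk : CLD G d k k₀)
    (cF : CL G d F f₀) (hF : HF G d F F') (hF' : CB G d F' gL) :
    CL G d (fun i u => prim (fun s => m i s * b i s + r i s) u + k i u * segInt (F i) (l u)) 0 ∧
    ∃ (r' : ι → ℝ → ℝ) (r₀' : ℝ), CL G d r' r₀' ∧
      HD G d (fun i u => prim (fun s => m i s * b i s + r i s) u + k i u * segInt (F i) (l u))
        fun i u => m i u * b i u + r' i u := by
  obtain ⟨ck, k1, k₁, hk1, ck1⟩ := hk
  have cI := ((cF.cb fun _ => le_rfl).segInt h.lim1).lin l hl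
  have dI := (hF.segInt hF'.cont).curve l hl
  have cI1 := ((cF.segIntDeriv hF' h.limL).lin l hl).clm_apply (CL.const (l 1))
  have bL := (CB.mul hm hb).add (hr.cb h.one_le)
  refine ⟨?_, _, _, hr.add ((ck1.mul cI).add (ck.mul cI1)), ?_⟩
  · simpa using (bL.prim h.limN).add (ck.mul cI)
  · convert bL.cont.prim.add (hk1.mul dI) using 3
    ring

lemma PhiL_prop : CL G d (fun i => (D i).PhiL S) 0 ∧
    ∃ (m r : ι → ℝ → ℝ) (r₀ : ℝ), CL G d m (aconst S) ∧ CL G d r r₀ ∧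
      HD G d (fun i => (D i).PhiL S)
        fun i u => m i u * (D i).Xuu (aconst S * u, u) + r i u := by
  obtain ⟨c1, -, dk⟩ := h.kL_cld.deriv h.pos
  obtain ⟨s₀, cs⟩ := h.exists_src_cl
  obtain ⟨P, hP, bP⟩ := h.exists_src_deriv
  have ha := aconst_abs_le S
  have hl := norm_lineL_le ha
  have hm : CL G d (fun i u => aconst S * (D i).kL S u) (aconst S) := by
    simpa using (CL.const (aconst S)).mul h.kL_cld.1
  obtain ⟨c, r', r₀', cr', hd⟩ := h.exists_boundary (norm_leftL_le ha) hm
    (h.Xuu_b.lin (lineL (aconst S)) hl)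
    ((dk.mul (h.Xu_cl.lin (lineL (aconst S)) hl)).add
      (h.kL_cld.1.mul (cs.lin (lineL (aconst S)) hl)))
    ((CLD.const 1).div h.gamL_cld (Γ₀_ne S)) cs hP bP
  have e : (fun i u => prim (fun s => aconst S * (D i).kL S s * (D i).Xuu (lineL (aconst S) s) +
        (deriv ((D i).kL S) s * (D i).Xu (lineL (aconst S) s) +
          (D i).kL S s * (D i).src S (lineL (aconst S) s))) u +
      1 / (D i).gamL S u * segInt ((D i).src S) (leftL (aconst S) u)) =
      fun i => (D i).PhiL S := by
    funext i u
    unfold Jet.PhiL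
    congr 2
    funext s
    simp only [Jet.LamL, lineL_apply]
    ring
  rw [e] at c hd
  exact ⟨c, _, r', r₀', hm, cr', hd⟩

lemma PhiR_prop : CL G d (fun i => (D i).PhiR S) 0 ∧
    ∃ (m r : ι → ℝ → ℝ) (r₀ : ℝ), CL G d m (aconst S) ∧ CL G d r r₀ ∧
      HD G d (fun i => (D i).PhiR S)
        fun i u => m i u * (D i).Xvv (aconst S * u, aconst S * u) + r i u := by
  obtain ⟨c1, -, dk⟩ := h.kR_cld.deriv h.pos
  obtain ⟨s₀, cs⟩ := h.exists_src_cl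
  obtain ⟨P, hP, bP⟩ := h.exists_src_deriv
  have ha := aconst_abs_le S
  have hl : ∀ x, ‖diagL.comp (scaleL (aconst S)) x‖ ≤ ‖x‖ := fun x =>
    (norm_diagL_le _).trans (norm_scaleL_le ha x)
  have hm : CL G d (fun i u => aconst S * (D i).kR S u) (aconst S) := by
    simpa using (CL.const (aconst S)).mul h.kR_cld.1
  obtain ⟨c, r', r₀', cr', hd⟩ := h.exists_boundary (norm_rightL_le ha) hm
    (h.Xvv_b.lin _ hl)
    ((dk.mul (h.Xv_cl.lin _ hl)).add (hm.mul (cs.lin _ hl)))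
    h.gamR_cld (cs.lin swapL norm_swapL_le) (hP.lin swapL norm_swapL_le) (bP.lin swapL norm_swapL_le).comp_swapL
  have e : (fun i u => prim (fun s => aconst S * (D i).kR S s *
        (D i).Xvv (diagL.comp (scaleL (aconst S)) s) +
        (deriv ((D i).kR S) s * (D i).Xv (diagL.comp (scaleL (aconst S)) s) +
          aconst S * (D i).kR S s * (D i).src S (diagL.comp (scaleL (aconst S)) s))) u +
      (D i).gamR S u * segInt (fun q => (D i).src S (swapL q)) (rightL (aconst S) u)) =
      fun i => (D i).PhiR S := by
    funext i u
    unfold Jet.PhiR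
    congr 2
    funext s
    simp only [Jet.LamR, ContinuousLinearMap.comp_apply, diagL_apply, scaleL, smul_eq_mul,
      smul_apply, ContinuousLinearMap.id_apply]
    ring
  rw [e] at c hd
  exact ⟨c, _, r', r₀', hm, cr', hd⟩

end Fam

end

section

variable {ι : Type*} {S : Setup} {G : Filter ι} {d gN gL gK : ι → ℝ} {D : ι → Jet}

namespace Fam

variable (h : Fam S G d gN gL gK D)
include h

/-- The first derivative of the next coordinate function with respect to the variable singled out
by the projection `k`. -/
lemma exists_interior {Φ m b r : ι → ℝ → ℝ} {F : ι → ℝ × ℝ → ℝ}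
    {F' : ι → ℝ × ℝ → ℝ × ℝ →L[ℝ] ℝ} {m₀ r₀ f₀ θ : ℝ} {l : ℝ × ℝ →L[ℝ] ℝ × ℝ × ℝ}
    {k : ℝ × ℝ →L[ℝ] ℝ} (hl : ∀ x, ‖l x‖ ≤ ‖x‖) (hk : ∀ x, ‖k x‖ ≤ ‖x‖) (c : ℝ)
    (hm : CL G d m m₀) (hb : CB G d b gN) (hr : CL G d r r₀)
    (cΦ : CL G d Φ 0) (hΦ : HD G d Φ fun i u => m i u * b i u + r i u)
    (cF : CL G d F f₀) (hF : HF G d F F') (hF' : CB G d F' gL) (hθ : |m₀| < θ)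
    {e : ℝ × ℝ} (he : k e = 1) :
    CL G d (fun i q => c + Φ i (k q) + segInt (F i) (l q)) c ∧
    HF G d (fun i q => c + Φ i (k q) + segInt (F i) (l q))
      (fun i q => (m i (k q) * b i (k q) + r i (k q)) • k +
        (segIntDeriv (F i) (F' i) (l q)).comp l) ∧
    Cont G d (fun i q => ((m i (k q) * b i (k q) + r i (k q)) • k +
        (segIntDeriv (F i) (F' i) (l q)).comp l) e) ∧
    BoundedBy G d θ (fun i q => b i (k q))
      (fun i q => ((m i (k q) * b i (k q) + r i (k q)) • k +
        (segIntDeriv (F i) (F' i) (l q)).comp l) e) fun _ => 1 := by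
  have cI := ((cF.cb fun _ => le_rfl).segInt h.lim1).lin l hl
  have dI := (hF.segInt hF'.cont).lin l hl
  have cI1 := ((cF.segIntDeriv hF' h.limL).lin l hl).clm_apply (CL.const (l e))
  have hr' := (hr.lin k hk).add cI1
  have E : (fun i q => ((m i (k q) * b i (k q) + r i (k q)) • k +
        (segIntDeriv (F i) (F' i) (l q)).comp l) e) = fun i q => m i (k q) * b i (k q) +
        (r i (k q) + segIntDeriv (F i) (F' i) (l q) (l e)) := by
    funext i q
    simp [he]
    ring
  refine ⟨?_, ?_, ?_, ?_⟩
  · simpa using ((CL.const c).add (cΦ.lin k hk)).add cI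
  · refine Eventually.mono (((hΦ.lin k hk)).add dI) fun z hz => ?_
    convert hz.const_add c using 1
    funext q
    ring
  · rw [E]
    exact ((CB.mul (hm.lin k hk) (hb.lin k hk)).add (hr'.cb h.one_le)).cont
  · rw [E]
    exact BoundedBy.of_decomp (hm.lin k hk) (hr'.cb fun _ => le_rfl) (fun _ => zero_le_one) hθ

lemma exists_nextXu {θ : ℝ} (hθ : aconst S < θ) :
    CL G d (fun i => (D i).nextXu S) (1 / Γ₀ S) ∧ ∃ f : ι → ℝ × ℝ → ℝ,
      HF G d (fun i => (D i).nextXu S) (fun i q => coL (f i q, (D i).src S q)) ∧ Cont G d f ∧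
      BoundedBy G d θ (fun i q => (D i).Xuu (aconst S * q.1, q.1)) f fun _ => 1 := by
  obtain ⟨cΦ, m, r, r₀, hm, hr, hΦ⟩ := h.PhiL_prop
  obtain ⟨s₀, cs⟩ := h.exists_src_cl
  obtain ⟨P, hP, bP⟩ := h.exists_src_deriv
  obtain ⟨h1, h2, h3, h4⟩ := h.exists_interior norm_edgeL_le
    (k := ContinuousLinearMap.fst ℝ ℝ ℝ) norm_fst_le (1 / Γ₀ S) hm
    (h.Xuu_b.lin (lineL (aconst S)) (norm_lineL_le (aconst_abs_le S))) hr cΦ hΦ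
    (cs.lin swapL norm_swapL_le) (hP.lin swapL norm_swapL_le)
    (bP.lin swapL norm_swapL_le).comp_swapL (by rwa [abs_aconst]) (e := (1, 0)) rfl
  refine ⟨h1, _, Eventually.mono h2 fun z hz => ?_, h3, h4⟩
  refine HasFDerivAt.congr_fderiv hz (coL_ext ?_ ?_)
  · rfl
  · have := segIntDeriv_second (fun q => (D z.1).src S (swapL q))
      (fun q => (P z.1 (swapL q)).comp swapL) (edgeL z.2)
    simpa using this

lemma exists_nextXv {θ : ℝ} (hθ : aconst S < θ) :
    CL G d (fun i => (D i).nextXv S) 1 ∧ ∃ f : ι → ℝ × ℝ → ℝ,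
      HF G d (fun i => (D i).nextXv S) (fun i q => coL ((D i).src S q, f i q)) ∧ Cont G d f ∧
      BoundedBy G d θ (fun i q => (D i).Xvv (aconst S * q.2, aconst S * q.2)) f fun _ => 1 := by
  obtain ⟨cΦ, m, r, r₀, hm, hr, hΦ⟩ := h.PhiR_prop
  obtain ⟨s₀, cs⟩ := h.exists_src_cl
  obtain ⟨P, hP, bP⟩ := h.exists_src_deriv
  have ha := aconst_abs_le S
  obtain ⟨h1, h2, h3, h4⟩ := h.exists_interior (norm_baseL_le ha)
    (k := ContinuousLinearMap.snd ℝ ℝ ℝ) norm_snd_le 1 hm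
    (h.Xvv_b.lin (diagL.comp (scaleL (aconst S))) fun x =>
      (norm_diagL_le _).trans (norm_scaleL_le ha x)) hr cΦ hΦ
    cs hP bP (by rwa [abs_aconst]) (e := (0, 1)) rfl
  refine ⟨h1, _, Eventually.mono h2 fun z hz => ?_, h3, h4⟩
  refine HasFDerivAt.congr_fderiv hz (coL_ext ?_ ?_)
  · have := segIntDeriv_second ((D z.1).src S) (P z.1) (baseL (aconst S) z.2)
    simpa using this
  · rfl

lemma nextX_hf : HF G d (fun i => (D i).nextX S)
    fun i q => coL ((D i).nextXu S q, (D i).nextXv S q) := by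
  obtain ⟨s₀, cs⟩ := h.exists_src_cl
  obtain ⟨P, hP, bP⟩ := h.exists_src_deriv
  have ha := aconst_abs_le S
  have hb := norm_baseL_le ha
  have dI := (hP.segInt bP.cont).lin (baseL (aconst S)) hb
  have cI := ((cs.segIntDeriv bP h.limL).lin (baseL (aconst S)) hb).comp'
    (h := fun k : ℝ × ℝ × ℝ →L[ℝ] ℝ => k.comp (baseL (aconst S))) (by fun_prop)
  have d1 := h.PhiL_prop.1.cont.prim.lin (ContinuousLinearMap.fst ℝ ℝ ℝ) norm_fst_le
  have d2 := h.PhiR_prop.1.cont.prim.lin (ContinuousLinearMap.snd ℝ ℝ ℝ) norm_snd_le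
  have d3 := ((dI.curve diagL norm_diagL_le).cont.prim).lin (ContinuousLinearMap.fst ℝ ℝ ℝ)
    norm_fst_le
  have d4 := ((dI.lin swapL norm_swapL_le).segInt (((cI.lin swapL norm_swapL_le).cb
    (g := fun _ => 1) fun _ => le_rfl).comp_swapL.cont)).lin edgeL norm_edgeL_le
  refine Eventually.mono (((d1.add d2).add d3).add d4) fun z hz => ?_
  have h0 : HasFDerivAt (fun q : ℝ × ℝ => q.1 / Γ₀ S + q.2)
      ((Γ₀ S)⁻¹ • ContinuousLinearMap.fst ℝ ℝ ℝ + ContinuousLinearMap.snd ℝ ℝ ℝ) z.2 := by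
    simp_rw [div_eq_inv_mul]
    exact ((ContinuousLinearMap.fst ℝ ℝ ℝ).hasFDerivAt.const_mul (Γ₀ S)⁻¹).add
      (ContinuousLinearMap.snd ℝ ℝ ℝ).hasFDerivAt
  convert h0.add hz using 1
  · funext q
    simp only [Jet.nextX, Jet.inner]
    simp only [ContinuousLinearMap.coe_fst', ContinuousLinearMap.coe_snd', Pi.add_apply]
    ring
  · symm
    apply coL_ext
    · simp [segIntDeriv, Jet.nextXu]
      ring
    · simp [segIntDeriv, Jet.nextXv, Jet.inner]
      ring

end Fam

end

section

variable (S : Setup) (P : Triple)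

/-- The incoming speed along an iterate. -/
def stepIn (q : ℝ × ℝ) : ℝ := cin S (P.1 q.1) (P.2.1 q.2)

/-- The outgoing speed along an iterate. -/
def stepOut (q : ℝ × ℝ) : ℝ := cout S (P.1 q.1) (P.2.1 q.2)

/-- The function `t` along an iterate. -/
def stepT (q : ℝ × ℝ) : ℝ :=
  (∫ r in (0 : ℝ)..q.1, (pu P.2.2 (r, r) / stepIn S P (r, r) +
    pv P.2.2 (r, r) / stepOut S P (r, r))) +
    ∫ s in q.1..q.2, pv P.2.2 (q.1, s) / stepOut S P (q.1, s)

/-- The coefficient `Γ¹` along an iterate. -/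
def stepGamL (u : ℝ) : ℝ := gammaL S ((P.1 u, P.2.1 u), (stepT S P (u, u), P.2.2 (u, u)))

/-- The coefficient `Γ²` along an iterate. -/
def stepGamR (v : ℝ) : ℝ := gammaR S ((P.1 (aconst S * v), P.2.1 v),
  (stepT S P (aconst S * v, v), P.2.2 (aconst S * v, v)))

/-- The source term `M` along an iterate. -/
def stepSrc (q : ℝ × ℝ) : ℝ :=
  (1 / (stepOut S P q - stepIn S P q)) * (stepOut S P q / stepIn S P q) * pv (stepIn S P) q *
      pu P.2.2 q +
    -((1 / (stepOut S P q - stepIn S P q)) * (stepIn S P q / stepOut S P q) *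
      pu (stepOut S P) q) * pv P.2.2 q

/-- The density `Λ¹` along an iterate. -/
def stepLamL (u : ℝ) : ℝ :=
  deriv (fun u => stepGamR S P u / stepGamL S P u) u * pu P.2.2 (aconst S * u, u) +
    aconst S * (stepGamR S P u / stepGamL S P u) * pu (fun q => pu P.2.2 q) (aconst S * u, u) +
    (stepGamR S P u / stepGamL S P u) * stepSrc S P (aconst S * u, u)

/-- The density `Λ²` along an iterate. -/
def stepLamR (v : ℝ) : ℝ :=
  deriv (fun v => stepGamR S P v / stepGamL S P (aconst S * v)) v *
      pv P.2.2 (aconst S * v, aconst S * v) +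
    aconst S * (stepGamR S P v / stepGamL S P (aconst S * v)) *
      pv (fun q => pv P.2.2 q) (aconst S * v, aconst S * v) +
    aconst S * (stepGamR S P v / stepGamL S P (aconst S * v)) *
      stepSrc S P (aconst S * v, aconst S * v)

/-- The function `Φ¹` along an iterate. -/
def stepPhiL (u : ℝ) : ℝ :=
  (∫ r in (0 : ℝ)..u, stepLamL S P r) +
    (1 / stepGamL S P u) * ∫ r in (aconst S * u)..u, stepSrc S P (r, u)

/-- The function `Φ²` along an iterate. -/
def stepPhiR (v : ℝ) : ℝ :=
  (∫ s in (0 : ℝ)..v, stepLamR S P s) +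
    stepGamR S P v * ∫ s in (aconst S * v)..v, stepSrc S P (aconst S * v, s)

/-- The function `x` of the iterate that follows. -/
def stepX (q : ℝ × ℝ) : ℝ :=
  q.1 / Γ₀ S + q.2 + (∫ r in (0 : ℝ)..q.1, stepPhiL S P r) +
    (∫ s in (0 : ℝ)..q.2, stepPhiR S P s) +
    (∫ s in (0 : ℝ)..q.1, ∫ r in (aconst S * s)..s, stepSrc S P (r, s)) +
    ∫ s in q.1..q.2, ∫ r in (aconst S * s)..q.1, stepSrc S P (r, s)

lemma step_eq (T : IterSetup) (P : Triple) : step T P =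
    (fun u => behindL T (P.2.1 u, stepT T.toSetup P (u, u), P.2.2 (u, u)),
      fun v => behindR T (P.1 (aconst T.toSetup * v), stepT T.toSetup P (aconst T.toSetup * v, v),
        P.2.2 (aconst T.toSetup * v, v)), stepX T.toSetup P) := rfl

end

namespace Jet

/-- The triple underlying a jet. -/
def triple (J : Jet) : Triple := (J.A, J.B, J.X)

/-- The functions of a jet are derivatives of one another on the ball of radius `δ`. -/
structure Regular (J : Jet) (δ : ℝ) : Prop where
  A : ∀ s, ‖s‖ < δ → HasDerivAt J.A (J.A1 s) s
  A1 : ∀ s, ‖s‖ < δ → HasDerivAt J.A1 (J.A2 s) s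
  B : ∀ s, ‖s‖ < δ → HasDerivAt J.B (J.B1 s) s
  B1 : ∀ s, ‖s‖ < δ → HasDerivAt J.B1 (J.B2 s) s
  X : ∀ q, ‖q‖ < δ → HasFDerivAt J.X (coL (J.Xu q, J.Xv q)) q
  Xu : ∀ q, ‖q‖ < δ → HasFDerivAt J.Xu (coL (J.Xuu q, J.Xuv q)) q
  Xv : ∀ q, ‖q‖ < δ → HasFDerivAt J.Xv (coL (J.Xuv q, J.Xvv q)) q

end Jet

lemma hasDerivAt_fst {f : ℝ × ℝ → ℝ} {k : ℝ × ℝ →L[ℝ] ℝ} {q : ℝ × ℝ} (h : HasFDerivAt f k q) :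
    HasDerivAt (fun s => f (s, q.2)) (k (1, 0)) q.1 :=
  HasFDerivAt.comp_hasDerivAt (f := fun s => (s, q.2)) q.1 h
    ((hasDerivAt_id q.1).prodMk (hasDerivAt_const q.1 q.2))

lemma hasDerivAt_snd {f : ℝ × ℝ → ℝ} {k : ℝ × ℝ →L[ℝ] ℝ} {q : ℝ × ℝ} (h : HasFDerivAt f k q) :
    HasDerivAt (fun s => f (q.1, s)) (k (0, 1)) q.2 :=
  HasFDerivAt.comp_hasDerivAt (f := fun s => (q.1, s)) q.2 h
    ((hasDerivAt_const q.2 q.1).prodMk (hasDerivAt_id q.2))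

lemma pu_eq {f : ℝ × ℝ → ℝ} {k : ℝ × ℝ →L[ℝ] ℝ} {q : ℝ × ℝ} (h : HasFDerivAt f k q) :
    pu f q = k (1, 0) := (hasDerivAt_fst h).deriv

lemma pv_eq {f : ℝ × ℝ → ℝ} {k : ℝ × ℝ →L[ℝ] ℝ} {q : ℝ × ℝ} (h : HasFDerivAt f k q) :
    pv f q = k (0, 1) := (hasDerivAt_snd h).deriv

lemma eventually_norm_lt {E : Type*} [NormedAddCommGroup E] {x : E} {δ : ℝ} (h : ‖x‖ < δ) :
    ∀ᶠ y in 𝓝 x, ‖y‖ < δ := continuous_norm.continuousAt.eventually_lt_const h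

lemma norm_swapL (q : ℝ × ℝ) : ‖swapL q‖ = ‖q‖ := max_comm _ _

namespace Jet.Regular

variable {S : Setup} {J : Jet} {δ : ℝ} (h : J.Regular δ)
include h

lemma pu_X {q : ℝ × ℝ} (hq : ‖q‖ < δ) : pu J.X q = J.Xu q := by
  rw [pu_eq (h.X q hq)]; simp

lemma pv_X {q : ℝ × ℝ} (hq : ‖q‖ < δ) : pv J.X q = J.Xv q := by
  rw [pv_eq (h.X q hq)]; simp

lemma hasFDerivAt_pu {q : ℝ × ℝ} (hq : ‖q‖ < δ) :
    HasFDerivAt (fun q => pu J.X q) (coL (J.Xuu q, J.Xuv q)) q :=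
  (h.Xu q hq).congr_of_eventuallyEq ((eventually_norm_lt hq).mono fun _ hy => h.pu_X hy)

lemma hasFDerivAt_pv {q : ℝ × ℝ} (hq : ‖q‖ < δ) :
    HasFDerivAt (fun q => pv J.X q) (coL (J.Xuv q, J.Xvv q)) q :=
  (h.Xv q hq).congr_of_eventuallyEq ((eventually_norm_lt hq).mono fun _ hy => h.pv_X hy)

lemma hasFDerivAt_AB {q : ℝ × ℝ} (hq : ‖q‖ < δ) :
    HasFDerivAt (fun q : ℝ × ℝ => (J.A q.1, J.B q.2)) (J.dAB q) q :=
  ((h.A q.1 ((norm_fst_le q).trans_lt hq)).comp_hasFDerivAt q hasFDerivAt_fst).prodMk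
    ((h.B q.2 ((norm_snd_le q).trans_lt hq)).comp_hasFDerivAt q hasFDerivAt_snd)

lemma stepT_diag {u : ℝ} (hu : ‖u‖ < δ) : stepT S J.triple (u, u) = J.lt S u := by
  simp only [stepT, intervalIntegral.integral_same, add_zero, Jet.lt, prim]
  refine intervalIntegral.integral_congr fun x hx => ?_
  have hd : ‖(x, x)‖ < δ :=
    (norm_diagL_le x).trans_lt ((norm_le_of_mem_uIcc hx).trans_lt hu)
  simp only [Jet.triple, h.pu_X hd, h.pv_X hd, Jet.chi, Jet.phi, Jet.psi, recipIn, recipOut,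
    stepIn, stepOut, div_eq_mul_inv]

lemma stepT_line {v : ℝ} (hv : ‖v‖ < δ) :
    stepT S J.triple (aconst S * v, v) = J.rt S v := by
  have ha := norm_scaleL_le (aconst_abs_le S) v
  have hav : ‖aconst S * v‖ < δ := ha.trans_lt hv
  have e := h.stepT_diag (S := S) hav
  simp only [stepT, intervalIntegral.integral_same, add_zero] at e ⊢
  rw [e]
  simp only [Jet.rt, segInt]
  congr 1
  refine intervalIntegral.integral_congr fun x hx => ?_
  have hd : ‖(aconst S * v, x)‖ < δ := by
    have := norm_seg_le (p := rightL (aconst S) v) (norm_rightL_le (aconst_abs_le S) v) hx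
    rw [← norm_swapL] at this
    exact this.trans_lt hv
  simp only [Jet.triple, h.pv_X hd, Jet.psi, recipOut, stepOut, div_eq_mul_inv, swapL_apply]

lemma stepSrc_eq {q : ℝ × ℝ} (hq : ‖q‖ < δ) : stepSrc S J.triple q = J.src S q := by
  have h1 : HasFDerivAt (stepIn S J.triple)
      ((fderiv ℝ (fun q : ℝ × ℝ => cin S q.1 q.2) (J.A q.1, J.B q.2)).comp (J.dAB q)) q :=
    HasFDerivAt.comp (g := fun q : ℝ × ℝ => cin S q.1 q.2) q
      ((contDiff_cin S).differentiable (by simp) _).hasFDerivAt (h.hasFDerivAt_AB hq)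
  have h2 : HasFDerivAt (stepOut S J.triple)
      ((fderiv ℝ (fun q : ℝ × ℝ => cout S q.1 q.2) (J.A q.1, J.B q.2)).comp (J.dAB q)) q :=
    HasFDerivAt.comp (g := fun q : ℝ × ℝ => cout S q.1 q.2) q
      ((contDiff_cout S).differentiable (by simp) _).hasFDerivAt (h.hasFDerivAt_AB hq)
  rw [stepSrc, pv_eq h1, pu_eq h2]
  simp only [Jet.triple, h.pu_X hq, h.pv_X hq, Jet.src, sourceFun, stepIn, stepOut, tangentMap,
    ContinuousLinearMap.comp_apply]
  simp [Jet.dAB]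

lemma stepGamL_eq {u : ℝ} (hu : ‖u‖ < δ) : stepGamL S J.triple u = J.gamL S u := by
  rw [stepGamL, h.stepT_diag hu]; rfl

lemma stepGamR_eq {u : ℝ} (hu : ‖u‖ < δ) : stepGamR S J.triple u = J.gamR S u := by
  rw [stepGamR, h.stepT_line hu]; rfl

lemma stepLamL_eq {u : ℝ} (hu : ‖u‖ < δ) : stepLamL S J.triple u = J.LamL S u := by
  have hl : ‖(aconst S * u, u)‖ < δ := (norm_lineL_le (aconst_abs_le S) u).trans_lt hu
  have e : (fun u => stepGamR S J.triple u / stepGamL S J.triple u) =ᶠ[𝓝 u] J.kL S :=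
    (eventually_norm_lt hu).mono fun y hy => by
      simp only [h.stepGamL_eq hy, h.stepGamR_eq hy]; rfl
  rw [stepLamL, e.deriv_eq, h.stepSrc_eq hl, h.stepGamL_eq hu, h.stepGamR_eq hu]
  simp only [Jet.triple]
  rw [h.pu_X hl, pu_eq (h.hasFDerivAt_pu hl)]
  simp [Jet.LamL, Jet.kL]

lemma stepLamR_eq {v : ℝ} (hv : ‖v‖ < δ) : stepLamR S J.triple v = J.LamR S v := by
  have ha : ∀ {y : ℝ}, ‖y‖ < δ → ‖aconst S * y‖ < δ := fun hy =>
    (norm_scaleL_le (aconst_abs_le S) _).trans_lt hy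
  have hl : ‖(aconst S * v, aconst S * v)‖ < δ := (norm_diagL_le _).trans_lt (ha hv)
  have e : (fun v => stepGamR S J.triple v / stepGamL S J.triple (aconst S * v)) =ᶠ[𝓝 v] J.kR S :=
    (eventually_norm_lt hv).mono fun y hy => by
      simp only [h.stepGamL_eq (ha hy), h.stepGamR_eq hy]; rfl
  rw [stepLamR, e.deriv_eq, h.stepSrc_eq hl, h.stepGamL_eq (ha hv), h.stepGamR_eq hv]
  simp only [Jet.triple]
  rw [h.pv_X hl, pv_eq (h.hasFDerivAt_pv hl)]
  simp [Jet.LamR, Jet.kR]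

lemma integral_stepSrc {p : ℝ × ℝ × ℝ} (hp : ‖p‖ < δ) :
    ∫ x in p.1..p.2.1, stepSrc S J.triple (x, p.2.2) = segInt (J.src S) p :=
  intervalIntegral.integral_congr fun _ hx => h.stepSrc_eq ((norm_seg_le le_rfl hx).trans_lt hp)

lemma stepPhiL_eq {u : ℝ} (hu : ‖u‖ < δ) : stepPhiL S J.triple u = J.PhiL S u := by
  have hl := (norm_leftL_le (aconst_abs_le S) u).trans_lt hu
  have e := h.integral_stepSrc (S := S) hl
  rw [stepPhiL, Jet.PhiL, h.stepGamL_eq hu, ← e]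
  congr 1
  exact intervalIntegral.integral_congr fun x hx =>
    h.stepLamL_eq ((norm_le_of_mem_uIcc hx).trans_lt hu)

lemma stepPhiR_eq {v : ℝ} (hv : ‖v‖ < δ) : stepPhiR S J.triple v = J.PhiR S v := by
  have hl := (norm_rightL_le (aconst_abs_le S) v).trans_lt hv
  rw [stepPhiR, Jet.PhiR, h.stepGamR_eq hv]
  congr 1
  · exact intervalIntegral.integral_congr fun x hx =>
      h.stepLamR_eq ((norm_le_of_mem_uIcc hx).trans_lt hv)
  · congr 1
    refine intervalIntegral.integral_congr fun x hx => h.stepSrc_eq ?_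
    have := norm_seg_le (p := rightL (aconst S) v) le_rfl hx
    rw [← norm_swapL] at this
    exact this.trans_lt hl

lemma stepX_eq {q : ℝ × ℝ} (hq : ‖q‖ < δ) : stepX S J.triple q = J.nextX S q := by
  have h1 := (norm_fst_le q).trans_lt hq
  have h2 := (norm_snd_le q).trans_lt hq
  have ha := aconst_abs_le S
  rw [stepX, Jet.nextX]
  congr 1
  · congr 1
    · congr 1
      · congr 1
        exact intervalIntegral.integral_congr fun x hx =>
          h.stepPhiL_eq ((norm_le_of_mem_uIcc hx).trans_lt h1)
      · exact intervalIntegral.integral_congr fun x hx =>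
          h.stepPhiR_eq ((norm_le_of_mem_uIcc hx).trans_lt h2)
    · exact intervalIntegral.integral_congr fun x hx =>
        h.integral_stepSrc (p := baseL (aconst S) (diagL x))
          (((norm_baseL_le ha _).trans ((norm_diagL_le x).trans (norm_le_of_mem_uIcc hx))).trans_lt
            h1)
  · refine intervalIntegral.integral_congr fun x hx =>
      h.integral_stepSrc (p := baseL (aconst S) (q.1, x)) ((norm_baseL_le ha _).trans_lt ?_)
    have := norm_seg_le (p := edgeL q) (norm_edgeL_le q) hx
    rw [← norm_swapL] at this
    exact this.trans_lt hq

end Jet.Regular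

/-- A regular jet on the ball of radius `δ` with the prescribed values at the origin, whose second
and third derivatives are bounded by `N`, `L` and `K`. -/
structure Jet.Good (S : Setup) (δ N L K : ℝ) (J : Jet) : Prop extends J.Regular δ where
  Xuv : ∀ q, ‖q‖ < δ → HasFDerivAt J.Xuv (J.W q) q
  A2_cont : ∀ s, ‖s‖ < δ → ContinuousAt J.A2 s
  B2_cont : ∀ s, ‖s‖ < δ → ContinuousAt J.B2 s
  Xuu_cont : ∀ q, ‖q‖ < δ → ContinuousAt J.Xuu q
  Xvv_cont : ∀ q, ‖q‖ < δ → ContinuousAt J.Xvv q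
  W_cont : ∀ q, ‖q‖ < δ → ContinuousAt J.W q
  A2_le : ∀ s, ‖s‖ < δ → |J.A2 s| ≤ L
  B2_le : ∀ s, ‖s‖ < δ → |J.B2 s| ≤ L
  Xuu_le : ∀ q, ‖q‖ < δ → |J.Xuu q| ≤ N
  Xuv_le : ∀ q, ‖q‖ < δ → |J.Xuv q| ≤ N
  Xvv_le : ∀ q, ‖q‖ < δ → |J.Xvv q| ≤ N
  W_le : ∀ q, ‖q‖ < δ → ‖J.W q‖ ≤ K
  A_zero : J.A 0 = β₀ S
  A1_zero : J.A1 0 = α₀' S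
  B_zero : J.B 0 = β₀ S
  B1_zero : J.B1 0 = β₀' S
  X_zero : J.X 0 = 0
  Xu_zero : J.Xu 0 = 1 / Γ₀ S
  Xv_zero : J.Xv 0 = 1

/-- A jet together with the radius of its domain and bounds for its derivatives. -/
structure Stage where
  rad : ℝ
  bdN : ℝ
  bdL : ℝ
  bdK : ℝ
  jet : Jet

namespace Stage

/-- The gauge of the second derivatives of `x`. -/
def gN (i : Stage) : ℝ := 1 + |i.bdN|

/-- The gauge of the second derivatives of `α` and `β`. -/
def gL (i : Stage) : ℝ := 1 + |i.bdN| + |i.bdL|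

/-- The gauge of the third derivatives of `x`. -/
def gK (i : Stage) : ℝ := 1 + |i.bdN| + |i.bdL| + |i.bdK|

/-- Good stages of radius small compared with their bounds. -/
def small (S : Setup) : Filter Stage :=
  comap (fun i => i.rad * i.gK) (𝓝 0) ⊓
    𝓟 {i | (0 < i.rad ∧ 0 ≤ i.bdN ∧ 0 ≤ i.bdL ∧ 0 ≤ i.bdK) ∧
      i.jet.Good S i.rad i.bdN i.bdL i.bdK}

lemma eventually_small (S : Setup) : ∀ᶠ i in small S,
    (0 < i.rad ∧ 0 ≤ i.bdN ∧ 0 ≤ i.bdL ∧ 0 ≤ i.bdK) ∧ i.jet.Good S i.rad i.bdN i.bdL i.bdK :=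
  mem_inf_of_right (mem_principal_self _)

lemma cb_small {S : Setup} {E V : Type*} [NormedAddCommGroup E] [NormedSpace ℝ E]
    [NormedAddCommGroup V] [NormedSpace ℝ V] {f : Stage → E → V} {g : Stage → ℝ}
    (hc : ∀ i : Stage, i.jet.Good S i.rad i.bdN i.bdL i.bdK → ∀ x, ‖x‖ < i.rad →
      ContinuousAt (f i) x)
    (hb : ∀ i : Stage, i.jet.Good S i.rad i.bdN i.bdL i.bdK → ∀ x, ‖x‖ < i.rad →
      ‖f i x‖ ≤ g i) :
    CB (small S) rad f g :=
  ⟨eventually_nearF.2 ((eventually_small S).mono fun i hi => hc i hi.2),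
    Asymptotics.IsBigO.of_bound 1 (eventually_nearF.2 ((eventually_small S).mono
      fun i hi x hx => by
        rw [one_mul]; exact (hb i hi.2 x hx).trans (le_abs_self _)))⟩

lemma fam_small (S : Setup) : Fam S (small S) rad gN gL gK jet where
  one_le i := by simp [gN]
  le₁ i := by simp [gN, gL]
  le₂ i := by simp [gL, gK]
  lim := tendsto_comap.mono_left inf_le_left
  pos := (eventually_small S).mono fun i hi => hi.1.1
  A := eventually_nearF.2 ((eventually_small S).mono fun i hi => hi.2.A)
  A1 := eventually_nearF.2 ((eventually_small S).mono fun i hi => hi.2.A1)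
  A2 := cb_small (fun i hi => hi.A2_cont) fun i hi s hs => (hi.A2_le s hs).trans (by
    rw [gL]; linarith [le_abs_self i.bdL, abs_nonneg i.bdN])
  A_zero := (eventually_small S).mono fun i hi => hi.2.A_zero
  A1_zero := (eventually_small S).mono fun i hi => hi.2.A1_zero
  B := eventually_nearF.2 ((eventually_small S).mono fun i hi => hi.2.B)
  B1 := eventually_nearF.2 ((eventually_small S).mono fun i hi => hi.2.B1)
  B2 := cb_small (fun i hi => hi.B2_cont) fun i hi s hs => (hi.B2_le s hs).trans (by
    rw [gL]; linarith [le_abs_self i.bdL, abs_nonneg i.bdN])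
  B_zero := (eventually_small S).mono fun i hi => hi.2.B_zero
  B1_zero := (eventually_small S).mono fun i hi => hi.2.B1_zero
  X := eventually_nearF.2 ((eventually_small S).mono fun i hi => hi.2.X)
  Xu := eventually_nearF.2 ((eventually_small S).mono fun i hi => hi.2.Xu)
  Xv := eventually_nearF.2 ((eventually_small S).mono fun i hi => hi.2.Xv)
  Xuv := eventually_nearF.2 ((eventually_small S).mono fun i hi => hi.2.Xuv)
  W := cb_small (fun i hi => hi.W_cont) fun i hi s hs => (hi.W_le s hs).trans (by
    rw [gK]; linarith [le_abs_self i.bdK, abs_nonneg i.bdN, abs_nonneg i.bdL])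
  Xuu_b := cb_small (fun i hi => hi.Xuu_cont) fun i hi s hs => (hi.Xuu_le s hs).trans (by
    rw [gN]; linarith [le_abs_self i.bdN])
  Xuv_b := cb_small (fun i hi q hq => (hi.Xuv q hq).continuousAt)
    fun i hi s hs => (hi.Xuv_le s hs).trans (by rw [gN]; linarith [le_abs_self i.bdN])
  Xvv_b := cb_small (fun i hi => hi.Xvv_cont) fun i hi s hs => (hi.Xvv_le s hs).trans (by
    rw [gN]; linarith [le_abs_self i.bdN])
  X_zero := (eventually_small S).mono fun i hi => hi.2.X_zero
  Xu_zero := (eventually_small S).mono fun i hi => hi.2.Xu_zero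
  Xv_zero := (eventually_small S).mono fun i hi => hi.2.Xv_zero

end Stage

/-- The constant by which one iteration contracts the second derivatives. -/
lemma exists_contraction (S : Setup) :
    ∃ θ, 0 < θ ∧ θ < 1 ∧ aconst S < θ ∧ |F₁₀ S| < θ ∧ |F₂₀ S| < θ := by
  obtain ⟨θ, h1, h2⟩ := exists_between
    (max_lt (aconst_lt_one S) (max_lt (abs_F₁₀_lt S) (abs_F₂₀_lt S)))
  obtain ⟨h3, h4⟩ := max_lt_iff.1 h1
  obtain ⟨h5, h6⟩ := max_lt_iff.1 h4
  exact ⟨θ, (aconst_pos S).trans h3, h2, h3, h5, h6⟩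

open Stage in
/-- One iteration maps a good stage of small radius to a good stage of the same radius, and
contracts the second derivatives up to lower order terms. -/
lemma exists_step (T : IterSetup) : ∃ θ c : ℝ, 0 < θ ∧ θ < 1 ∧ 0 ≤ c ∧
    ∀ᶠ i in small T.toSetup, ∃ J : Jet, J.triple = step T i.jet.triple ∧
      J.Good T.toSetup i.rad (θ * i.bdN + c) (θ * i.bdL + c * (1 + i.bdN))
        (c * (1 + i.bdN + i.bdL)) := by
  obtain ⟨θ, hθ0, hθ1, hθa, hθl, hθr⟩ := exists_contraction T.toSetup
  have h := fam_small T.toSetup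
  have a0 := aconst_pos T.toSetup
  have a1 := (aconst_lt_one T.toSetup).le
  obtain ⟨l1, l2, hl, hl1, cl2, zl, zl1, C₁, hC₁, bl⟩ := h.exists_next_left hθl
  obtain ⟨r1, r2, hr, hr1, cr2, zr, zr1, C₂, hC₂, br⟩ := h.exists_next_right hθr
  obtain ⟨zu, xuu, hu, cuu, C₃, hC₃, bu⟩ := h.exists_nextXu hθa
  obtain ⟨zv, xvv, hv, cvv, C₄, hC₄, bv⟩ := h.exists_nextXv hθa
  obtain ⟨m, hm⟩ := h.exists_src_cl
  obtain ⟨P, hP, bP⟩ := h.exists_src_deriv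
  obtain ⟨C₅, hC₅, bm⟩ := (hm.cb (g := fun _ => 1) fun _ => le_rfl).forall
  obtain ⟨C₆, hC₆, bP'⟩ := bP.forall
  refine ⟨θ, C₁ + C₂ + C₃ + C₄ + C₅ + C₆, hθ0, hθ1, by positivity, ?_⟩
  filter_upwards [eventually_small T.toSetup, hl.forall, hl1.forall, cl2.forall, zl.zero, zl1.zero,
    hr.forall, hr1.forall, cr2.forall, zr.zero, zr1.zero, zu.zero, hu.forall, cuu.forall, zv.zero,
    hv.forall, cvv.forall, hP.forall, bP.cont.forall, h.nextX_hf.forall, eventually_nearF.1 bl,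
    eventually_nearF.1 br, eventually_nearF.1 bu, eventually_nearF.1 bv, bm, bP'] with i hi hl hl1
    cl2 zl zl1 hr hr1 cr2 zr zr1 zu hu cuu zv hv cvv hP cP hX bl br bu bv bm bP
  obtain ⟨⟨hd, hN, hL, hK⟩, hi⟩ := hi
  have reg := hi.toRegular
  have e1 : ∀ u : ℝ, ‖u‖ < i.rad → (step T i.jet.triple).1 u =
      behindL T (i.jet.B u, i.jet.lt T.toSetup u, i.jet.lx u) := fun u hu => by
    rw [step_eq, ← reg.stepT_diag hu]; rfl
  have e2 : ∀ v : ℝ, ‖v‖ < i.rad → (step T i.jet.triple).2.1 v =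
      behindR T (i.jet.A (aconst T.toSetup * v), i.jet.rt T.toSetup v, i.jet.rx T.toSetup v) :=
    fun v hv => by rw [step_eq, ← reg.stepT_line hv]; rfl
  have e3 : ∀ q : ℝ × ℝ, ‖q‖ < i.rad → (step T i.jet.triple).2.2 q = i.jet.nextX T.toSetup q :=
    fun q hq => by rw [step_eq]; exact reg.stepX_eq hq
  have z1 : ‖(0 : ℝ)‖ < i.rad := by simpa using hd
  have z2 : ‖(0 : ℝ × ℝ)‖ < i.rad := by simpa using hd
  set c := C₁ + C₂ + C₃ + C₄ + C₅ + C₆ with hc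
  have gN_eq : i.gN = 1 + i.bdN := by rw [gN, abs_of_nonneg hN]
  have gL_eq : i.gL = 1 + i.bdN + i.bdL := by rw [gL, abs_of_nonneg hN, abs_of_nonneg hL]
  refine ⟨⟨(step T i.jet.triple).1, l1 i, l2 i, (step T i.jet.triple).2.1, r1 i, r2 i,
    (step T i.jet.triple).2.2, i.jet.nextXu T.toSetup, i.jet.nextXv T.toSetup, xuu i,
    i.jet.src T.toSetup, xvv i, P i⟩, rfl, ?_⟩
  constructor
  · exact {
      A := fun s hs => (hl s hs).congr_of_eventuallyEq ((eventually_norm_lt hs).mono e1)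
      A1 := hl1
      B := fun s hs => (hr s hs).congr_of_eventuallyEq ((eventually_norm_lt hs).mono e2)
      B1 := hr1
      X := fun q hq => (hX q hq).congr_of_eventuallyEq ((eventually_norm_lt hq).mono e3)
      Xu := hu
      Xv := hv }
  · exact hP
  · exact cl2
  · exact cr2
  · exact cuu
  · exact cvv
  · exact cP
  · intro s hs
    refine (bl s hs).trans ?_
    rw [gN_eq]
    gcongr
    · exact hi.B2_le s hs
    · rw [hc]; linarith
  · intro s hs
    refine (br s hs).trans ?_
    rw [gN_eq]
    have has := norm_scaleL_le (aconst_abs_le T.toSetup) s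
    have hA := hi.A2_le _ (has.trans_lt hs)
    gcongr
    · rw [abs_mul, abs_mul, abs_of_pos a0]
      exact (mul_le_of_le_one_left (by positivity) a1).trans
        ((mul_le_of_le_one_left (by positivity) a1).trans hA)
    · rw [hc]; linarith
  · intro q hq
    refine (bu q hq).trans ?_
    rw [mul_one]
    gcongr
    · exact hi.Xuu_le _ ((norm_lineL_le (aconst_abs_le T.toSetup) q.1).trans_lt
        ((norm_fst_le q).trans_lt hq))
    · rw [hc]; linarith
  · intro q hq
    refine (bm q hq).trans ?_
    rw [norm_one, mul_one]
    have : 0 ≤ θ * i.bdN := by positivity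
    rw [hc]; linarith
  · intro q hq
    refine (bv q hq).trans ?_
    rw [mul_one]
    gcongr
    · exact hi.Xvv_le _ ((norm_diagL_le _).trans_lt ((norm_scaleL_le (aconst_abs_le T.toSetup)
        q.2).trans_lt ((norm_snd_le q).trans_lt hq)))
    · rw [hc]; linarith
  · intro q hq
    refine (bP q hq).trans ?_
    rw [gL_eq, Real.norm_of_nonneg (by positivity)]
    gcongr
    rw [hc]; linarith
  · exact (e1 0 z1).trans zl
  · exact zl1
  · exact (e2 0 z1).trans zr
  · exact zr1
  · simp [step_eq, stepX]
  · exact zu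
  · exact zv

section

variable {E V : Type*} [NormedAddCommGroup E] [NormedSpace ℝ E] [NormedAddCommGroup V]
  [NormedSpace ℝ V] {δ : ℝ}

lemma contDiffAt_one_of_ball {f : E → V} {f' : E → E →L[ℝ] V} {x : E}
    (h : ∀ y, ‖y‖ < δ → HasFDerivAt f (f' y) y) (hc : ∀ y, ‖y‖ < δ → ContinuousAt f' y)
    (hx : ‖x‖ < δ) : ContDiffAt ℝ 1 f x :=
  contDiffAt_one_iff.2 ⟨f', {y | ‖y‖ < δ}, eventually_norm_lt hx,
    fun y hy => (hc y hy).continuousWithinAt, h⟩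

lemma contDiffAt_two_of_ball {f : E → V} {f' : E → E →L[ℝ] V} {x : E}
    (h : ∀ y, ‖y‖ < δ → HasFDerivAt f (f' y) y) (hc : ContDiffAt ℝ 1 f' x)
    (hx : ‖x‖ < δ) : ContDiffAt ℝ 2 f x := by
  have := (contDiffAt_succ_iff_hasFDerivAt (n := 1) (𝕜 := ℝ) (f := f) (x := x)).2
    ⟨f', ⟨{y | ‖y‖ < δ}, eventually_norm_lt hx, h⟩, hc⟩
  exact this.of_le (by norm_num)

lemma contDiffAt_two_of_hasDerivAt {f f1 f2 : ℝ → ℝ} {x : ℝ}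
    (h : ∀ y, ‖y‖ < δ → HasDerivAt f (f1 y) y) (h1 : ∀ y, ‖y‖ < δ → HasDerivAt f1 (f2 y) y)
    (hc : ∀ y, ‖y‖ < δ → ContinuousAt f2 y) (hx : ‖x‖ < δ) : ContDiffAt ℝ 2 f x := by
  let k : ℝ →L[ℝ] ℝ →L[ℝ] ℝ := ContinuousLinearMap.smulRightL ℝ ℝ ℝ (1 : ℝ →L[ℝ] ℝ)
  have hk : ∀ {g g' : ℝ → ℝ}, (∀ y, ‖y‖ < δ → HasDerivAt g (g' y) y) →
      ∀ y, ‖y‖ < δ → HasFDerivAt g (k (g' y)) y := fun hg y hy =>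
    (hg y hy).hasFDerivAt.congr_fderiv (by ext; simp [k])
  refine contDiffAt_two_of_ball (hk h) ?_ hx
  exact k.contDiff.contDiffAt.comp x (contDiffAt_one_of_ball (hk h1)
    (fun y hy => k.continuous.continuousAt.comp (hc y hy)) hx)

lemma deriv_deriv_of_ball {f f1 f2 : ℝ → ℝ} {x : ℝ}
    (h : ∀ y, ‖y‖ < δ → HasDerivAt f (f1 y) y) (h1 : ∀ y, ‖y‖ < δ → HasDerivAt f1 (f2 y) y)
    (hx : ‖x‖ < δ) : deriv (deriv f) x = f2 x := by
  have e : deriv f =ᶠ[𝓝 x] f1 := (eventually_norm_lt hx).mono fun y hy => (h y hy).deriv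
  rw [e.deriv_eq, (h1 x hx).deriv]

end

namespace Jet.Good

variable {S : Setup} {δ N L K ε : ℝ} {J : Jet} (h : J.Good S δ N L K)
include h

lemma memBA (hε : 0 < ε) (hδ : ε < δ) : memBA S ε L J.A := by
  have hs : ∀ s ∈ Icc 0 (aconst S * ε), ‖s‖ < δ := fun s hs => by
    rw [Real.norm_of_nonneg hs.1]
    exact (hs.2.trans (mul_le_of_le_one_left hε.le (aconst_lt_one S).le)).trans_lt hδ
  refine ⟨fun s h' => (contDiffAt_two_of_hasDerivAt h.A h.A1 h.A2_cont
    (hs s h')).contDiffWithinAt, h.A_zero, ?_, fun s h' => ?_⟩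
  · rw [(h.A 0 (by simpa using hε.trans hδ)).deriv, h.A1_zero]
  · rw [deriv_deriv_of_ball h.A h.A1 (hs s h')]
    exact h.A2_le s (hs s h')

lemma memBB (hε : 0 < ε) (hδ : ε < δ) : memBB S ε L J.B := by
  have hs : ∀ s ∈ Icc 0 ε, ‖s‖ < δ := fun s hs => by
    rw [Real.norm_of_nonneg hs.1]
    exact hs.2.trans_lt hδ
  refine ⟨fun s h' => (contDiffAt_two_of_hasDerivAt h.B h.B1 h.B2_cont
    (hs s h')).contDiffWithinAt, h.B_zero, ?_, fun s h' => ?_⟩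
  · rw [(h.B 0 (by simpa using hε.trans hδ)).deriv, h.B1_zero]
  · rw [deriv_deriv_of_ball h.B h.B1 (hs s h')]
    exact h.B2_le s (hs s h')

lemma contDiffAt_X {q : ℝ × ℝ} (hq : ‖q‖ < δ) : ContDiffAt ℝ 2 J.X q := by
  have hc := fun y hy => (h.Xuv y hy).continuousAt
  refine contDiffAt_two_of_ball h.X (coL.contDiff.contDiffAt.comp q
    ((contDiffAt_one_of_ball h.Xu ?_ hq).prodMk (contDiffAt_one_of_ball h.Xv ?_ hq))) hq
  · exact fun y hy => coL.continuous.continuousAt.comp ((h.Xuu_cont y hy).prodMk (hc y hy))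
  · exact fun y hy => coL.continuous.continuousAt.comp ((hc y hy).prodMk (h.Xvv_cont y hy))

lemma memBN (hε : 0 < ε) (hδ : ε < δ) : memBN S ε N J.X := by
  have hs : ∀ q ∈ Teps (aconst S) ε, ‖q‖ < δ := fun q hq => by
    obtain ⟨h1, h2, h3, h4⟩ := hq
    rw [Prod.norm_def, Real.norm_of_nonneg h1, Real.norm_of_nonneg (h1.trans h2)]
    exact (max_le (h2.trans (h3.trans h4)) (h3.trans h4)).trans_lt hδ
  have h0 : ‖((0, 0) : ℝ × ℝ)‖ < δ := by simpa using hε.trans hδ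
  refine ⟨fun q hq => (h.contDiffAt_X (hs q hq)).contDiffWithinAt, h.X_zero, ?_, ?_,
    fun q hq => ⟨?_, ?_, ?_⟩⟩
  · rw [h.pu_X h0]; exact h.Xu_zero
  · rw [h.pv_X h0]; exact h.Xv_zero
  · rw [pu_eq (h.hasFDerivAt_pu (hs q hq))]
    simpa using h.Xuu_le q (hs q hq)
  · rw [pv_eq (h.hasFDerivAt_pu (hs q hq))]
    simpa using h.Xuv_le q (hs q hq)
  · rw [pv_eq (h.hasFDerivAt_pv (hs q hq))]
    simpa using h.Xvv_le q (hs q hq)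

end Jet.Good

/-- The jet of the initial iterate. -/
def initialJet (S : Setup) : Jet where
  A u := β₀ S + α₀' S * u
  A1 _ := α₀' S
  A2 _ := 0
  B v := β₀ S + β₀' S * v
  B1 _ := β₀' S
  B2 _ := 0
  X q := q.1 / Γ₀ S + q.2
  Xu _ := 1 / Γ₀ S
  Xv _ := 1
  Xuu _ := 0
  Xuv _ := 0
  Xvv _ := 0
  W _ := 0

lemma initialJet_good (S : Setup) {δ N L K : ℝ} (hN : 0 ≤ N) (hL : 0 ≤ L) (hK : 0 ≤ K) :
    (initialJet S).Good S δ N L K where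
  A s _ := by simpa [initialJet] using ((hasDerivAt_id s).const_mul (α₀' S)).const_add (β₀ S)
  A1 s _ := hasDerivAt_const s _
  B s _ := by simpa [initialJet] using ((hasDerivAt_id s).const_mul (β₀' S)).const_add (β₀ S)
  B1 s _ := hasDerivAt_const s _
  X q _ := by
    have : (initialJet S).X = coL (1 / Γ₀ S, 1) := by
      funext q
      simp [initialJet, div_eq_inv_mul]
    rw [this]
    exact (coL (1 / Γ₀ S, 1)).hasFDerivAt
  Xu q _ := by simpa [initialJet, ← Prod.zero_eq_mk] using hasFDerivAt_const (1 / Γ₀ S) q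
  Xv q _ := by simpa [initialJet, ← Prod.zero_eq_mk] using hasFDerivAt_const (1 : ℝ) q
  Xuv q _ := hasFDerivAt_const 0 q
  A2_cont _ _ := continuousAt_const
  B2_cont _ _ := continuousAt_const
  Xuu_cont _ _ := continuousAt_const
  Xvv_cont _ _ := continuousAt_const
  W_cont _ _ := continuousAt_const
  A2_le _ _ := by simpa [initialJet] using hL
  B2_le _ _ := by simpa [initialJet] using hL
  Xuu_le _ _ := by simpa [initialJet] using hN
  Xuv_le _ _ := by simpa [initialJet] using hN
  Xvv_le _ _ := by simpa [initialJet] using hN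
  W_le _ _ := by simpa [initialJet] using hK
  A_zero := by simp [initialJet]
  A1_zero := rfl
  B_zero := by simp [initialJet]
  B1_zero := rfl
  X_zero := by simp [initialJet]
  Xu_zero := rfl
  Xv_zero := rfl

/-- A property of small stages holds for all good jets on small balls. -/
lemma Stage.eventually_of_small {S : Setup} {p : Stage → Prop} (h : ∀ᶠ i in small S, p i)
    {N L K : ℝ} (hN : 0 ≤ N) (hL : 0 ≤ L) (hK : 0 ≤ K) :
    ∀ᶠ δ in 𝓝[>] (0 : ℝ), ∀ J : Jet, J.Good S δ N L K → p ⟨δ, N, L, K, J⟩ := by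
  rw [small, eventually_inf_principal, eventually_comap] at h
  have ht : Tendsto (fun δ : ℝ => δ * (1 + |N| + |L| + |K|)) (𝓝[>] 0) (𝓝 0) := by
    have : Tendsto (fun δ : ℝ => δ * (1 + |N| + |L| + |K|)) (𝓝 0) (𝓝 (0 * _)) :=
      tendsto_id.mul_const _
    rw [zero_mul] at this
    exact this.mono_left nhdsWithin_le_nhds
  filter_upwards [ht.eventually h, self_mem_nhdsWithin] with δ hδ h0 J hJ
  exact hδ ⟨δ, N, L, K, J⟩ rfl ⟨⟨h0, hN, hL, hK⟩, hJ⟩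

/-- All iterates come from good jets on a common ball with common bounds. -/
lemma exists_good_seq (T : IterSetup) : ∃ δ N L K : ℝ, 0 < δ ∧ 0 ≤ N ∧ 0 ≤ L ∧
    ∀ n, ∃ J : Jet, J.triple = seq T n ∧ J.Good T.toSetup δ N L K := by
  obtain ⟨θ, c, hθ0, hθ1, hc, h⟩ := exists_step T
  have hθ : 0 < 1 - θ := sub_pos.2 hθ1
  obtain ⟨N, hN⟩ : ∃ N, N = c / (1 - θ) := ⟨_, rfl⟩
  obtain ⟨L, hL⟩ : ∃ L, L = c * (1 + N) / (1 - θ) := ⟨_, rfl⟩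
  have N0 : 0 ≤ N := by rw [hN]; positivity
  have L0 : 0 ≤ L := by rw [hL]; positivity
  have K0 : 0 ≤ c * (1 + N + L) := by positivity
  have eN : θ * N + c = N := by
    rw [eq_div_iff hθ.ne'] at hN
    linarith
  have eL : θ * L + c * (1 + N) = L := by
    rw [eq_div_iff hθ.ne'] at hL
    linarith
  obtain ⟨δ, hδ, δ0⟩ := ((Stage.eventually_of_small h N0 L0 K0).and self_mem_nhdsWithin).exists
  refine ⟨δ, N, L, c * (1 + N + L), δ0, N0, L0, fun n => ?_⟩
  induction n with
  | zero => exact ⟨initialJet T.toSetup, rfl, initialJet_good T.toSetup N0 L0 K0⟩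
  | succ n ih =>
    obtain ⟨J, hJ, hg⟩ := ih
    obtain ⟨J', hJ', hg'⟩ := hδ J hg
    refine ⟨J', by rw [hJ', hJ]; rfl, ?_⟩
    rwa [eN, eL] at hg'

end

/-- **Inductive confinement of the iteration.**
The constants `A, B, N₀ > 0` can be chosen, depending only on the data at the interaction
point, such that for `ε` sufficiently small every iterate `(α¹₊,ₙ, β²₊,ₙ, xₙ)` of the shock
interaction iteration scheme belongs to `B_A × B_B × B_{N₀}`. -/
theorem iteration_confined (T : IterSetup) :
    ∃ A B N₀ : ℝ, 0 < A ∧ 0 < B ∧ 0 < N₀ ∧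
      ∃ ε₀ > (0 : ℝ), ∀ ε : ℝ, 0 < ε → ε ≤ ε₀ → ∀ n : ℕ,
        memBA T.toSetup ε A (seq T n).1 ∧
        memBB T.toSetup ε B (seq T n).2.1 ∧
        memBN T.toSetup ε N₀ (seq T n).2.2 := by
  obtain ⟨δ, N, L, K, hδ, hN, hL, h⟩ := exists_good_seq T
  refine ⟨L + 1, L + 1, N + 1, by positivity, by positivity, by positivity, δ / 2, half_pos hδ,
    fun ε h0 hε n => ?_⟩
  obtain ⟨J, hJ, hg⟩ := h n
  have hlt : ε < δ := hε.trans_lt (half_lt_self hδ)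
  have hL1 : L ≤ L + 1 := by linarith
  have hN1 : N ≤ N + 1 := by linarith
  rw [← hJ]
  obtain ⟨a1, a2, a3, a4⟩ := hg.memBA h0 hlt
  obtain ⟨b1, b2, b3, b4⟩ := hg.memBB h0 hlt
  obtain ⟨x1, x2, x3, x4, x5⟩ := hg.memBN h0 hlt
  exact ⟨⟨a1, a2, a3, fun u hu => (a4 u hu).trans hL1⟩, ⟨b1, b2, b3, fun u hu => (b4 u hu).trans hL1⟩,
    x1, x2, x3, x4, fun q hq => ⟨(x5 q hq).1.trans hN1, (x5 q hq).2.1.trans hN1,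
      (x5 q hq).2.2.trans hN1⟩⟩

end ShockInteraction
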